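/- If $a < c_1 < c_2 < b$, then $\mathfrak{B}(c_1)$ is isometrically embedded in, but not equal to, $\mathfrak{B}(c_2)$. Furthermore, the chain is continuous: for each $c\in(a,b)$, $\overline{\bigcup_{x\in(a,c)}\mathfrak{B}(x)} = \mathfrak{B}(c) = \bigcap_{x\in(c,b)}\mathfrak{B}(x)$. -/

import Mathlib

open MeasureTheory Set Filter Complex Topology ComplexConjugate

noncomputable section

/-- `f` is locally absolutely continuous on `(a,b)` with a.e. derivative `g`,
encoded via the integral representation. -/
def HasACDeriv (a b : ℝ) (f g : ℝ → ℂ) : Prop :=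
  ∀ x ∈ Set.Ioo a b, ∀ y ∈ Set.Ioo a b,
    IntervalIntegrable g volume y x ∧ f x = f y + ∫ t in y..x, g t

/-- `f` lies in the domain `𝔇_τ` with first quasi-derivative `fq = p (f' + s f)` and
`τ f = w`, encoded via the equivalent first order system
`(f, f^{[1]})' = ((-s, 1/p), (q - 0·r, s)) (f, f^{[1]}) - (0, r·w)`. -/
structure SLSys (a b : ℝ) (p q r s : ℝ → ℝ) (f fq w : ℝ → ℂ) : Prop where
  fst : HasACDeriv a b f fun x => fq x / (p x : ℂ) - (s x : ℂ) * f x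
  snd : HasACDeriv a b fq fun x => (s x : ℂ) * fq x + (q x : ℂ) * f x - (r x : ℂ) * w x

/-- Standing hypothesis on the coefficients `p, q, r, s` on `(a,b)`:
real-valued and measurable, `p⁻¹, q, r, s ∈ L¹_loc((a,b))`, `p ≠ 0` and `r > 0` a.e. -/
structure SLHyp (a b : ℝ) (p q r s : ℝ → ℝ) : Prop where
  lt : a < b
  mp : Measurable p
  mq : Measurable q
  mr : Measurable r
  ms : Measurable s
  ip : ∀ x ∈ Set.Ioo a b, ∀ y ∈ Set.Ioo a b,
    IntervalIntegrable (fun t => (p t)⁻¹) volume y x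
  iq : ∀ x ∈ Set.Ioo a b, ∀ y ∈ Set.Ioo a b, IntervalIntegrable q volume y x
  ir : ∀ x ∈ Set.Ioo a b, ∀ y ∈ Set.Ioo a b, IntervalIntegrable r volume y x
  is' : ∀ x ∈ Set.Ioo a b, ∀ y ∈ Set.Ioo a b, IntervalIntegrable s volume y x
  pne : ∀ᵐ t ∂(volume.restrict (Set.Ioo a b)), p t ≠ 0
  rpos : ∀ᵐ t ∂(volume.restrict (Set.Ioo a b)), 0 < r t

/-- The modified Wronskian `W(f,g)(x) = f(x) g^{[1]}(x) - f^{[1]}(x) g(x)`. -/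
def Wr (f fq g gq : ℝ → ℂ) (x : ℝ) : ℂ := f x * gq x - fq x * g x
/-- A non-trivial real entire solution family `φ_z` of `(τ - z) u = 0` (with quasi-derivative
family `φq`) which lies in the domain of `S` near `a`: square integrable near `a`
w.r.t. `r dx` and satisfying the boundary condition at `a`, the latter encoded through
the vanishing at `a` of the Wronskians of members of the family. -/
structure RealEntireSolFam (a b : ℝ) (p q r s : ℝ → ℝ) (φ φq : ℂ → ℝ → ℂ) : Prop where
  sol : ∀ z : ℂ, SLSys a b p q r s (φ z) (φq z) fun x => z * φ z x
  entire : ∀ x ∈ Set.Ioo a b,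
    (Differentiable ℂ fun z => φ z x) ∧ Differentiable ℂ fun z => φq z x
  real : ∀ z : ℂ, ∀ x ∈ Set.Ioo a b,
    φ (conj z) x = conj (φ z x) ∧ φq (conj z) x = conj (φq z x)
  nontriv : ∀ z : ℂ, ∃ x ∈ Set.Ioo a b, φ z x ≠ 0 ∨ φq z x ≠ 0
  sqint : ∀ z : ℂ, ∀ c ∈ Set.Ioo a b,
    IntegrableOn (fun x => ‖φ z x‖ ^ 2 * r x) (Set.Ioo a c)
  bc : ∀ z ζ : ℂ, Tendsto (Wr (φ z) (φq z) (φ ζ) (φq ζ)) (𝓝[>] a) (𝓝 0)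

/-- The de Branges function `E(z,c) = φ_z(c) + i φ_z^{[1]}(c)`. -/
def dBE (φ φq : ℂ → ℝ → ℂ) (c : ℝ) (z : ℂ) : ℂ := φ z c + Complex.I * φq z c
/-- The open upper complex half-plane. -/
def UHP : Set ℂ := {z : ℂ | 0 < z.im}

/-- `N` is of bounded type in `ℂ₊`: a quotient of two bounded analytic functions. -/
def OfBoundedType (N : ℂ → ℂ) : Prop :=
  ∃ u v : ℂ → ℂ, DifferentiableOn ℂ u UHP ∧ DifferentiableOn ℂ v UHP ∧
    (∃ C : ℝ, ∀ z ∈ UHP, ‖u z‖ ≤ C) ∧ (∃ C : ℝ, ∀ z ∈ UHP, ‖v z‖ ≤ C) ∧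
    ∀ z ∈ UHP, v z ≠ 0 ∧ N z = u z / v z

/-- `N` has non-positive mean type: `limsup_{y→∞} ln |N(iy)| / y ≤ 0`. -/
def NonposMeanType (N : ℂ → ℂ) : Prop :=
  Filter.limsup (fun y : ℝ => Real.log ‖N ((y : ℂ) * Complex.I)‖ / y) Filter.atTop ≤ 0

/-- Membership in the de Branges space `𝔅` associated with the de Branges function `E`. -/
def MemDB (E F : ℂ → ℂ) : Prop :=
  Differentiable ℂ F ∧
  Integrable (fun t : ℝ => ‖F (t : ℂ)‖ ^ 2 / ‖E (t : ℂ)‖ ^ 2) ∧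
  OfBoundedType (fun z => F z / E z) ∧ NonposMeanType (fun z => F z / E z) ∧
  OfBoundedType (fun z => conj (F (conj z)) / E z) ∧
  NonposMeanType (fun z => conj (F (conj z)) / E z)

/-- The squared norm of the de Branges space with de Branges function `E`. -/
def DBnormSq (E F : ℂ → ℂ) : ℝ :=
  (1 / Real.pi) * ∫ t : ℝ, ‖F (t : ℂ)‖ ^ 2 / ‖E (t : ℂ)‖ ^ 2

/-- The inner product of the de Branges space with de Branges function `E`. -/
def DBinner (E F G : ℂ → ℂ) : ℂ :=
  ((1 / Real.pi : ℝ) : ℂ) * ∫ t : ℝ, F (t : ℂ) * conj (G (t : ℂ)) / ((‖E (t : ℂ)‖ : ℂ) ^ 2)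

/-- The kernel `K(ζ,z,c) = ∫_a^c φ_z(x) conj (φ_ζ(x)) r(x) dx`. -/
def dBK (a c : ℝ) (r : ℝ → ℝ) (φ : ℂ → ℝ → ℂ) (ζ z : ℂ) : ℂ :=
  ∫ x in Set.Ioo a c, φ z x * conj (φ ζ x) * (r x : ℂ)


namespace DBC

theorem ac_congr {f g : ℝ → ℂ} {a b : ℝ} (hf : AbsolutelyContinuousOnInterval f a b)
    (h : ∀ x ∈ uIcc a b, f x = g x) : AbsolutelyContinuousOnInterval g a b := by
  rw [absolutelyContinuousOnInterval_iff] at hf ⊢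
  intro ε hε
  obtain ⟨δ, hδ, H⟩ := hf ε hε
  refine ⟨δ, hδ, fun E hE hs => ?_⟩
  have := H E hE hs
  refine lt_of_eq_of_lt (Finset.sum_congr rfl fun i hi => ?_) this
  have h1 := hE.1 i hi
  rw [h _ h1.1, h _ h1.2]

theorem ac_ofReal {f : ℝ → ℝ} {a b : ℝ} (hf : AbsolutelyContinuousOnInterval f a b) (w : ℂ) :
    AbsolutelyContinuousOnInterval (fun x => (f x : ℂ) * w) a b := by
  have hc : AbsolutelyContinuousOnInterval (fun _ : ℝ => w) a b :=
    (LipschitzOnWith.of_dist_le_mul (K := 0) (by intro x _ y _; simp)).absolutelyContinuousOnInterval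
  have := hf.smul hc
  refine ac_congr this fun x _ => by simp

theorem ac_prim {g : ℝ → ℂ} {a b c : ℝ} (h : IntervalIntegrable g volume a b) (hc : c ∈ uIcc a b) :
    AbsolutelyContinuousOnInterval (fun x => ∫ t in c..x, g t) a b := by
  have hre : IntervalIntegrable (fun t => (g t).re) volume a b := ⟨h.1.re, h.2.re⟩
  have him : IntervalIntegrable (fun t => (g t).im) volume a b := ⟨h.1.im, h.2.im⟩
  have h1 := ac_ofReal (hre.absolutelyContinuousOnInterval_intervalIntegral hc) 1
  have h2 := ac_ofReal (him.absolutelyContinuousOnInterval_intervalIntegral hc) I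
  refine ac_congr (h1.add h2) fun x hx => ?_
  have hi : IntervalIntegrable g volume c x := h.mono_set (uIcc_subset_uIcc hc hx)
  have hir : IntervalIntegrable (fun t => (g t).re) volume c x :=
    hre.mono_set (uIcc_subset_uIcc hc hx)
  have hii : IntervalIntegrable (fun t => (g t).im) volume c x :=
    him.mono_set (uIcc_subset_uIcc hc hx)
  simp only [Pi.add_apply, mul_one]
  rw [← intervalIntegral.integral_ofReal, ← intervalIntegral.integral_ofReal,
    ← intervalIntegral.integral_mul_const, ← intervalIntegral.integral_add]
  · refine intervalIntegral.integral_congr fun t _ => ?_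
    exact Complex.re_add_im (g t)
  · exact ⟨hir.1.ofReal, hir.2.ofReal⟩
  · exact IntervalIntegrable.mul_const ⟨hii.1.ofReal, hii.2.ofReal⟩ I

/-- absolutely continuous on the unordered interval with given derivative -/
structure ACOn (y x : ℝ) (f f' : ℝ → ℂ) : Prop where
  int : IntervalIntegrable f' volume y x
  eq : ∀ t ∈ uIcc y x, f t = f y + ∫ s in y..t, f' s

theorem ACOn.ac {y x : ℝ} {f f' : ℝ → ℂ} (h : ACOn y x f f') :
    AbsolutelyContinuousOnInterval f y x := by
  have hc : AbsolutelyContinuousOnInterval (fun _ : ℝ => f y) y x :=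
    (LipschitzOnWith.of_dist_le_mul (K := 0) (by intro x _ y _; simp)).absolutelyContinuousOnInterval
  refine ac_congr (hc.add (ac_prim h.int left_mem_uIcc)) fun t ht => (h.eq t ht).symm

theorem ACOn.cont {y x : ℝ} {f f' : ℝ → ℂ} (h : ACOn y x f f') : ContinuousOn f (uIcc y x) :=
  h.ac.continuousOn

theorem ae_mem_Ioo (y x : ℝ) : ∀ᵐ t : ℝ, t ∈ uIcc y x → t ∈ Ioo (min y x) (max y x) := by
  have h1 : ∀ᵐ t : ℝ, t ≠ min y x := by simp [ae_iff, measure_singleton]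
  have h2 : ∀ᵐ t : ℝ, t ≠ max y x := by simp [ae_iff, measure_singleton]
  filter_upwards [h1, h2] with t h1 h2 ht
  exact ⟨lt_of_le_of_ne ht.1 (Ne.symm h1), lt_of_le_of_ne ht.2 h2⟩

theorem ACOn.ae_deriv {y x : ℝ} {f f' : ℝ → ℂ} (h : ACOn y x f f') :
    ∀ᵐ t, t ∈ uIcc y x → HasDerivAt f (f' t) t := by
  filter_upwards [h.int.ae_hasDerivAt_integral, ae_mem_Ioo y x] with t ht hm htx
  have h1 := (ht htx y left_mem_uIcc).const_add (f y)
  refine h1.congr_of_eventuallyEq ?_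
  have : Ioo (min y x) (max y x) ∈ 𝓝 t := isOpen_Ioo.mem_nhds (hm htx)
  filter_upwards [this] with s hs
  exact h.eq s (Ioo_subset_Icc_self hs)

theorem ACOn.mul {y x : ℝ} {f f' g g' : ℝ → ℂ} (hf : ACOn y x f f') (hg : ACOn y x g g') :
    ACOn y x (fun t => f t * g t) (fun t => f' t * g t + f t * g' t) := by
  have hint : IntervalIntegrable (fun t => f' t * g t + f t * g' t) volume y x :=
    (hf.int.mul_continuousOn hg.cont).add (hg.int.continuousOn_mul hf.cont)
  refine ⟨hint, ?_⟩
  have h1 : AbsolutelyContinuousOnInterval (fun t => f t * g t - ∫ s in y..t, (f' s * g s + f s * g' s)) y x :=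
    (hf.ac.smul hg.ac).sub (ac_prim hint left_mem_uIcc)
  obtain ⟨C, hC⟩ := h1.const_of_ae_hasDerivAt_zero (by
    filter_upwards [hf.ae_deriv, hg.ae_deriv, hint.ae_hasDerivAt_integral] with t h1 h2 h3 ht
    have := ((h1 ht).mul (h2 ht)).sub (h3 ht y left_mem_uIcc)
    rw [sub_self] at this
    exact this)
  intro t ht
  have e1 := hC t ht
  have e2 := hC y left_mem_uIcc
  simp at e2
  rw [e2, ← e1]; ring

theorem ACOn.sub {y x : ℝ} {f f' g g' : ℝ → ℂ} (hf : ACOn y x f f') (hg : ACOn y x g g') :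
    ACOn y x (fun t => f t - g t) (fun t => f' t - g' t) := by
  refine ⟨hf.int.sub hg.int, fun t ht => ?_⟩
  have h1 : uIcc y t ⊆ uIcc y x := uIcc_subset_uIcc left_mem_uIcc ht
  rw [intervalIntegral.integral_sub (hf.int.mono_set h1) (hg.int.mono_set h1), hf.eq t ht, hg.eq t ht]
  ring

theorem ACOn.conj {y x : ℝ} {f f' : ℝ → ℂ} (hf : ACOn y x f f') :
    ACOn y x (fun t => conj (f t)) (fun t => conj (f' t)) := by
  refine ⟨⟨?_, ?_⟩, fun t ht => ?_⟩
  · exact (Complex.conjLIE.toContinuousLinearEquiv : ℂ →L[ℝ] ℂ).integrable_comp hf.int.1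
  · exact (Complex.conjLIE.toContinuousLinearEquiv : ℂ →L[ℝ] ℂ).integrable_comp hf.int.2
  · rw [hf.eq t ht, map_add]
    congr 1
    rw [intervalIntegral, intervalIntegral, map_sub, ← integral_conj, ← integral_conj]

theorem ACOn.congr' {y x : ℝ} {f f' g' : ℝ → ℂ} (hf : ACOn y x f f')
    (h : ∀ᵐ t, t ∈ uIcc y x → f' t = g' t) : ACOn y x f g' := by
  have h2 : ∀ u ∈ uIcc y x, ∀ᵐ t, t ∈ uIoc y u → f' t = g' t := by
    intro u hu
    filter_upwards [h] with t ht htu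
    exact ht (uIcc_subset_uIcc left_mem_uIcc hu (uIoc_subset_uIcc htu))
  refine ⟨hf.int.congr_ae ?_, fun t ht => ?_⟩
  · rw [EventuallyEq, ae_restrict_iff' measurableSet_uIoc]; exact h2 x right_mem_uIcc
  · rw [hf.eq t ht]; congr 1
    exact intervalIntegral.integral_congr_ae (h2 t ht)

theorem ACOn.end_eq {y x : ℝ} {f f' : ℝ → ℂ} (hf : ACOn y x f f') :
    f x - f y = ∫ s in y..x, f' s := by
  rw [hf.eq x right_mem_uIcc]; ring

theorem ACOn.of_has {a b : ℝ} {f g : ℝ → ℂ} (h : HasACDeriv a b f g) {x y : ℝ}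
    (hx : x ∈ Ioo a b) (hy : y ∈ Ioo a b) : ACOn y x f g := by
  refine ⟨(h x hx y hy).1, fun t ht => (h t ?_ y hy).2⟩
  exact (ordConnected_Ioo.uIcc_subset hy hx) ht

/-- vanishing primitives -/
theorem ae_zero_of_prim {y x : ℝ} {g : ℝ → ℂ} (hg : IntervalIntegrable g volume y x)
    (h : ∀ t ∈ uIcc y x, ∫ s in y..t, g s = 0) : ∀ᵐ t, t ∈ uIcc y x → g t = 0 := by
  have : ACOn y x (fun _ => 0) g := ⟨hg, fun t ht => by simp [h t ht]⟩
  filter_upwards [this.ae_deriv] with t ht htx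
  exact (ht htx).unique (hasDerivAt_const t 0)

end DBC

namespace DBC

theorem ac_pow {κ : ℝ → ℝ} {c x : ℝ} (hκ : IntervalIntegrable κ volume c x) (n : ℕ) :
    ACOn c x (fun t => ((∫ s in c..t, κ s : ℝ) : ℂ) ^ (n + 1))
      (fun t => (n + 1) * ((∫ s in c..t, κ s : ℝ) : ℂ) ^ n * (κ t : ℂ)) := by
  have h0 : ACOn c x (fun t => ((∫ s in c..t, κ s : ℝ) : ℂ)) (fun t => (κ t : ℂ)) := by
    refine ⟨⟨hκ.1.ofReal, hκ.2.ofReal⟩, fun t ht => ?_⟩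
    rw [intervalIntegral.integral_ofReal]; simp
  induction n with
  | zero => simpa using h0
  | succ n ih =>
    have := ih.mul h0
    refine ⟨?_, ?_⟩
    · refine this.int.congr ?_
      intro t _
      simp only
      push_cast; ring
    · intro t ht
      have h := this.eq t ht
      simp only [← pow_succ] at h
      rw [h]
      congr 1
      refine intervalIntegral.integral_congr fun s _ => ?_
      beta_reduce
      push_cast; ring

theorem int_pow {κ : ℝ → ℝ} {c x : ℝ} (hκ : IntervalIntegrable κ volume c x) (n : ℕ) :
    (n + 1) * ∫ t in c..x, κ t * (∫ s in c..t, κ s) ^ n = (∫ s in c..x, κ s) ^ (n + 1) := by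
  have h := (ac_pow hκ n).end_eq
  simp only [intervalIntegral.integral_same, ofReal_zero, ne_eq, Nat.add_eq_zero_iff, one_ne_zero,
    and_false, not_false_eq_true, zero_pow, sub_zero] at h
  have h2 : (((∫ s in c..x, κ s) ^ (n + 1) : ℝ) : ℂ) =
     (((n + 1) * ∫ t in c..x, κ t * (∫ s in c..t, κ s) ^ n : ℝ) : ℂ) := by
    rw [← intervalIntegral.integral_const_mul, ← intervalIntegral.integral_ofReal]
    push_cast
    push_cast at h
    rw [h]
    refine intervalIntegral.integral_congr fun s _ => ?_
    beta_reduce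
    ring
  exact (ofReal_injective h2).symm

theorem int_abs_pow {κ : ℝ → ℝ} {c x : ℝ} (hκ : IntervalIntegrable κ volume c x)
    (h0 : ∀ t, 0 ≤ κ t) (n : ℕ) :
    |∫ t in c..x, κ t * |∫ s in c..t, κ s| ^ n| = |∫ s in c..x, κ s| ^ (n + 1) / (n + 1) := by
  have key := int_pow hκ n
  have hn : (0 : ℝ) < n + 1 := by positivity
  rcases le_total c x with h | h
  · have e : ∫ t in c..x, κ t * |∫ s in c..t, κ s| ^ n = ∫ t in c..x, κ t * (∫ s in c..t, κ s) ^ n := by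
      refine intervalIntegral.integral_congr fun t ht => ?_
      rw [uIcc_of_le h] at ht
      beta_reduce
      rw [abs_of_nonneg (intervalIntegral.integral_nonneg_of_forall ht.1 h0)]
    rw [e, ← abs_pow, ← key, abs_mul, abs_of_pos hn]; field_simp
  · have e : ∫ t in c..x, κ t * |∫ s in c..t, κ s| ^ n
        = (-1) ^ n * ∫ t in c..x, κ t * (∫ s in c..t, κ s) ^ n := by
      rw [← intervalIntegral.integral_const_mul]
      refine intervalIntegral.integral_congr fun t ht => ?_
      rw [uIcc_of_ge h] at ht
      beta_reduce
      have : ∫ s in c..t, κ s ≤ 0 := by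
        rw [intervalIntegral.integral_symm]
        exact neg_nonpos.2 (intervalIntegral.integral_nonneg_of_forall ht.2 h0)
      rw [abs_of_nonpos this, neg_pow]; ring
    rw [e, ← abs_pow, ← key, abs_mul, abs_mul, abs_of_pos hn, abs_pow, abs_neg, abs_one, one_pow]
    field_simp

variable {α β : ℝ}

abbrev XS (α β : ℝ) := C(Icc α β, ℂ)

theorem J_int (hab : α ≤ β) {k : ℝ → ℂ} (hk : IntervalIntegrable k volume α β) (y : XS α β) :
    IntervalIntegrable (fun t => k t * IccExtend hab y t) volume α β :=
  hk.mul_continuousOn (y.continuous.Icc_extend').continuousOn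

theorem J_mono (hab : α ≤ β) (c x : Icc α β) : uIcc (c : ℝ) x ⊆ uIcc α β := by
  rw [uIcc_of_le hab]; exact ordConnected_Icc.uIcc_subset c.2 x.2

theorem J_cont (hab : α ≤ β) (c : Icc α β) {k : ℝ → ℂ} (hk : IntervalIntegrable k volume α β)
    (y : XS α β) : Continuous fun x : Icc α β => ∫ t in (c : ℝ)..x, k t * IccExtend hab y t := by
  have h := (ac_prim (J_int hab hk y) (c := c) (by rw [uIcc_of_le hab]; exact c.2)).continuousOn
  rw [uIcc_of_le hab] at h
  exact h.comp_continuous continuous_subtype_val fun x => x.2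

/-- Volterra integration operator, linear version -/
def Jlin (hab : α ≤ β) (c : Icc α β) (k : ℝ → ℂ) (hk : IntervalIntegrable k volume α β) :
    XS α β →ₗ[ℂ] XS α β where
  toFun y := ⟨fun x => ∫ t in (c : ℝ)..x, k t * IccExtend hab y t, J_cont hab c hk y⟩
  map_add' y y' := by
    ext x
    simp only [ContinuousMap.coe_mk, ContinuousMap.add_apply]
    rw [← intervalIntegral.integral_add ((J_int hab hk y).mono_set (J_mono hab c x))
      ((J_int hab hk y').mono_set (J_mono hab c x))]
    refine intervalIntegral.integral_congr fun t _ => ?_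
    simp only [IccExtend, Function.comp, ContinuousMap.add_apply]; ring
  map_smul' a y := by
    ext x
    simp only [ContinuousMap.coe_mk, ContinuousMap.smul_apply, RingHom.id_apply, smul_eq_mul]
    rw [← intervalIntegral.integral_const_mul]
    refine intervalIntegral.integral_congr fun t _ => ?_
    simp only [IccExtend, Function.comp, ContinuousMap.smul_apply, smul_eq_mul]; ring

/-- Volterra integration operator -/
def J (hab : α ≤ β) (c : Icc α β) (k : ℝ → ℂ) (hk : IntervalIntegrable k volume α β) :
    XS α β →L[ℂ] XS α β :=
  LinearMap.mkContinuous (Jlin hab c k hk)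
    (∫ t in α..β, ‖k t‖) (by
      intro y
      rw [ContinuousMap.norm_le _ (mul_nonneg (intervalIntegral.integral_nonneg hab fun _ _ => norm_nonneg _) (norm_nonneg _))]
      intro x
      change ‖∫ t in (c : ℝ)..x, k t * IccExtend hab y t‖ ≤ _
      refine (intervalIntegral.norm_integral_le_integral_norm_uIoc).trans ?_
      rw [intervalIntegral.integral_of_le hab, ← integral_mul_const]
      have h1 : uIoc (c : ℝ) x ⊆ Ioc α β := by
        rw [← uIoc_of_le hab]
        exact uIoc_subset_uIoc_of_uIcc_subset_uIcc (J_mono hab c x)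
      have hk' : IntegrableOn (fun t => ‖k t‖ * ‖y‖) (Ioc α β) := (hk.1.norm).mul_const _
      calc ∫ t in uIoc (c : ℝ) x, ‖k t * IccExtend hab y t‖
          ≤ ∫ t in uIoc (c : ℝ) x, ‖k t‖ * ‖y‖ := by
            refine integral_mono_of_nonneg (Eventually.of_forall fun _ => norm_nonneg _) (hk'.mono_set h1)
              (Eventually.of_forall fun t => ?_)
            simp only [norm_mul]
            gcongr
            exact y.norm_coe_le_norm _
        _ ≤ _ := setIntegral_mono_set hk' (Eventually.of_forall fun t => by positivity) h1.eventuallyLE)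

theorem J_apply (hab : α ≤ β) (c : Icc α β) (k : ℝ → ℂ) (hk : IntervalIntegrable k volume α β)
    (y : XS α β) (x : Icc α β) :
    J hab c k hk y x = ∫ t in (c : ℝ)..x, k t * IccExtend hab y t := rfl

theorem J_bound (hab : α ≤ β) (c : Icc α β) (k : ℝ → ℂ) (hk : IntervalIntegrable k volume α β)
    (y : XS α β) (b : ℝ → ℝ) (hb : ContinuousOn b (Icc α β)) (h : ∀ x : Icc α β, ‖y x‖ ≤ b x)
    (κ : ℝ → ℝ) (hκ : IntervalIntegrable κ volume α β) (hkκ : ∀ t, ‖k t‖ ≤ κ t) (x : Icc α β) :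
    ‖J hab c k hk y x‖ ≤ |∫ t in (c : ℝ)..x, κ t * b t| := by
  rw [J_apply]
  have hm : uIcc (c : ℝ) x ⊆ Icc α β := ordConnected_Icc.uIcc_subset c.2 x.2
  refine intervalIntegral.norm_integral_le_abs_of_norm_le ((ae_restrict_iff' measurableSet_uIoc).2 (Eventually.of_forall ?_)) ?_
  · intro t ht
    rw [norm_mul]
    have ht' : t ∈ Icc α β := hm (uIoc_subset_uIcc ht)
    have := h ⟨t, ht'⟩
    rw [IccExtend_of_mem hab y ht']
    exact mul_le_mul (hkκ t) this (norm_nonneg _) ((norm_nonneg _).trans (hkκ t))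
  · refine (hκ.mono_set ?_).mul_continuousOn (hb.mono hm)
    rw [uIcc_of_le hab]; exact hm

end DBC

namespace DBC

theorem ring_diff {A : Type*} [NormedRing A] [NormedAlgebra ℂ A] [CompleteSpace A] (a b : A)
    (h : ∀ z : ℂ, IsUnit (1 - (a + z • b))) :
    Differentiable ℂ fun z : ℂ => Ring.inverse (1 - (a + z • b)) := by
  intro z
  have h1 : DifferentiableAt ℂ (fun z : ℂ => 1 - (a + z • b)) z := by fun_prop
  exact (differentiableAt_inverse (𝕜 := ℂ) (h z)).comp z h1

theorem ring_unit {A : Type*} [Ring A] (a : A) (n : ℕ) (h : IsUnit (1 - a ^ n)) :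
    IsUnit (1 - a) := by
  have h2 := mul_neg_geom_sum a n
  have hcomm : Commute (1 - a) (∑ i ∈ Finset.range n, a ^ i) := by
    refine Commute.sum_right _ _ _ fun i _ => ?_
    exact ((Commute.one_left _).sub_left (Commute.refl _)).pow_right i
  rw [← h2] at h
  exact (hcomm.isUnit_mul_iff.1 h).1

/-- coefficients on a compact interval -/
structure Coef (α β : ℝ) where
  hab : α ≤ β
  c : Icc α β
  kp : ℝ → ℂ
  ks : ℝ → ℂ
  kq : ℝ → ℂ
  kr : ℝ → ℂ
  ip : IntervalIntegrable kp volume α β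
  is' : IntervalIntegrable ks volume α β
  iq : IntervalIntegrable kq volume α β
  ir : IntervalIntegrable kr volume α β

variable {α β : ℝ} (D : Coef α β)

abbrev XX (α β : ℝ) := XS α β × XS α β

def Coef.V0 : XX α β →L[ℂ] XX α β :=
  ((J D.hab D.c D.kp D.ip).comp (ContinuousLinearMap.snd ℂ _ _)
    - (J D.hab D.c D.ks D.is').comp (ContinuousLinearMap.fst ℂ _ _)).prod
  ((J D.hab D.c D.ks D.is').comp (ContinuousLinearMap.snd ℂ _ _)
    + (J D.hab D.c D.kq D.iq).comp (ContinuousLinearMap.fst ℂ _ _))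

def Coef.V1 : XX α β →L[ℂ] XX α β :=
  (0 : XX α β →L[ℂ] XS α β).prod
  (-((J D.hab D.c D.kr D.ir).comp (ContinuousLinearMap.fst ℂ (XS α β) (XS α β))))

def Coef.V (z : ℂ) : XX α β →L[ℂ] XX α β := D.V0 + z • D.V1

def Coef.κ (z : ℂ) (t : ℝ) : ℝ := ‖D.kp t‖ + 2 * ‖D.ks t‖ + ‖D.kq t‖ + ‖z‖ * ‖D.kr t‖

theorem Coef.κ_nonneg (z : ℂ) (t : ℝ) : 0 ≤ D.κ z t := by unfold Coef.κ; positivity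

theorem Coef.κ_int (z : ℂ) : IntervalIntegrable (D.κ z) volume α β :=
  ((D.ip.norm.add (D.is'.norm.const_mul 2)).add D.iq.norm).add (D.ir.norm.const_mul _)

theorem Coef.V_fst (z : ℂ) (y : XX α β) (x : Icc α β) :
    (D.V z y).1 x = ∫ t in (D.c : ℝ)..x, (D.kp t * IccExtend D.hab y.2 t - D.ks t * IccExtend D.hab y.1 t) := by
  have h1 := (J_int D.hab D.ip y.2).mono_set (J_mono D.hab D.c x)
  have h2 := (J_int D.hab D.is' y.1).mono_set (J_mono D.hab D.c x)
  rw [intervalIntegral.integral_sub h1 h2]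
  simp [Coef.V, Coef.V0, Coef.V1, J_apply]

theorem Coef.V_snd (z : ℂ) (y : XX α β) (x : Icc α β) :
    (D.V z y).2 x = ∫ t in (D.c : ℝ)..x, (D.ks t * IccExtend D.hab y.2 t + D.kq t * IccExtend D.hab y.1 t
      - z * (D.kr t * IccExtend D.hab y.1 t)) := by
  have h1 := (J_int D.hab D.is' y.2).mono_set (J_mono D.hab D.c x)
  have h2 := (J_int D.hab D.iq y.1).mono_set (J_mono D.hab D.c x)
  have h3 := (J_int D.hab D.ir y.1).mono_set (J_mono D.hab D.c x)
  rw [intervalIntegral.integral_sub (h1.add h2) (h3.const_mul z), intervalIntegral.integral_add h1 h2,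
    intervalIntegral.integral_const_mul]
  simp [Coef.V, Coef.V0, Coef.V1, J_apply]
  ring

theorem Coef.V_bound (z : ℂ) (y : XX α β) (b : ℝ → ℝ) (hb : ContinuousOn b (Icc α β))
    (h1 : ∀ x : Icc α β, ‖y.1 x‖ ≤ b x) (h2 : ∀ x : Icc α β, ‖y.2 x‖ ≤ b x) (x : Icc α β) :
    ‖(D.V z y).1 x‖ ≤ |∫ t in (D.c : ℝ)..x, D.κ z t * b t| ∧
    ‖(D.V z y).2 x‖ ≤ |∫ t in (D.c : ℝ)..x, D.κ z t * b t| := by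
  have hm : uIcc (D.c : ℝ) x ⊆ Icc α β := ordConnected_Icc.uIcc_subset D.c.2 x.2
  have hi : IntervalIntegrable (fun t => D.κ z t * b t) volume D.c x := by
    refine ((D.κ_int z).mono_set ?_).mul_continuousOn (hb.mono hm)
    rw [uIcc_of_le D.hab]; exact hm
  rw [Coef.V_fst, Coef.V_snd]
  constructor
  · refine intervalIntegral.norm_integral_le_abs_of_norm_le
      ((ae_restrict_iff' measurableSet_uIoc).2 (Eventually.of_forall fun t ht => ?_)) hi
    have ht' : t ∈ Icc α β := hm (uIoc_subset_uIcc ht)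
    rw [IccExtend_of_mem D.hab _ ht', IccExtend_of_mem D.hab _ ht']
    have a1 := h1 ⟨t, ht'⟩
    have a2 := h2 ⟨t, ht'⟩
    have hb0 : 0 ≤ b t := (norm_nonneg _).trans a1
    refine (norm_sub_le _ _).trans ?_
    rw [norm_mul, norm_mul]
    have := mul_le_mul_of_nonneg_left a1 (norm_nonneg (D.ks t))
    have := mul_le_mul_of_nonneg_left a2 (norm_nonneg (D.kp t))
    have : 0 ≤ (‖D.ks t‖ + ‖D.kq t‖ + ‖z‖ * ‖D.kr t‖) * b t := by positivity
    unfold Coef.κ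
    simp only at *
    nlinarith
  · refine intervalIntegral.norm_integral_le_abs_of_norm_le
      ((ae_restrict_iff' measurableSet_uIoc).2 (Eventually.of_forall fun t ht => ?_)) hi
    have ht' : t ∈ Icc α β := hm (uIoc_subset_uIcc ht)
    rw [IccExtend_of_mem D.hab _ ht', IccExtend_of_mem D.hab _ ht']
    have a1 := h1 ⟨t, ht'⟩
    have a2 := h2 ⟨t, ht'⟩
    have hb0 : 0 ≤ b t := (norm_nonneg _).trans a1
    refine (norm_sub_le _ _).trans ?_
    refine (add_le_add_left (norm_add_le _ _) _).trans ?_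
    rw [norm_mul, norm_mul, norm_mul, norm_mul]
    have := mul_le_mul_of_nonneg_left a1 (norm_nonneg (D.kq t))
    have := mul_le_mul_of_nonneg_left a2 (norm_nonneg (D.ks t))
    have := mul_le_mul_of_nonneg_left (mul_le_mul_of_nonneg_left a1 (norm_nonneg (D.kr t))) (norm_nonneg z)
    have : 0 ≤ (‖D.ks t‖ + ‖D.kp t‖) * b t := by positivity
    unfold Coef.κ
    simp only at *
    nlinarith

theorem Coef.pow_bound (z : ℂ) (n : ℕ) (y : XX α β) (x : Icc α β) :
    ‖((D.V z ^ n) y).1 x‖ ≤ |∫ t in (D.c : ℝ)..x, D.κ z t| ^ n / n.factorial * ‖y‖ ∧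
    ‖((D.V z ^ n) y).2 x‖ ≤ |∫ t in (D.c : ℝ)..x, D.κ z t| ^ n / n.factorial * ‖y‖ := by
  induction n generalizing x with
  | zero =>
    simp only [pow_zero, one_apply_eq_self, Nat.factorial_zero, Nat.cast_one, div_one, one_mul]
    exact ⟨(y.1.norm_coe_le_norm x).trans (norm_fst_le y), (y.2.norm_coe_le_norm x).trans (norm_snd_le y)⟩
  | succ n ih =>
    have hc : ContinuousOn (fun x => |∫ t in (D.c : ℝ)..x, D.κ z t| ^ n / n.factorial * ‖y‖) (Icc α β) := by
      have h := ((D.κ_int z).absolutelyContinuousOnInterval_intervalIntegral (c := D.c)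
        (by rw [uIcc_of_le D.hab]; exact D.c.2)).continuousOn
      rw [uIcc_of_le D.hab] at h
      exact ((h.abs.pow n).div_const _).mul_const _
    have := D.V_bound z ((D.V z ^ n) y) _ hc (fun x => (ih x).1) (fun x => (ih x).2) x
    have e : |∫ t in (D.c : ℝ)..x, D.κ z t * (|∫ t in (D.c : ℝ)..t, D.κ z t| ^ n / n.factorial * ‖y‖)|
      = |∫ t in (D.c : ℝ)..x, D.κ z t| ^ (n + 1) / (n + 1).factorial * ‖y‖ := by
      have h1 := int_abs_pow ((D.κ_int z).mono_set (J_mono D.hab D.c x)) (D.κ_nonneg z) n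
      have h2 : ∀ t, D.κ z t * (|∫ t in (D.c : ℝ)..t, D.κ z t| ^ n / n.factorial * ‖y‖)
        = (D.κ z t * |∫ t in (D.c : ℝ)..t, D.κ z t| ^ n) * (‖y‖ / n.factorial) := fun t => by ring
      simp_rw [h2]
      rw [intervalIntegral.integral_mul_const, abs_mul, h1, abs_of_nonneg (by positivity : 0 ≤ ‖y‖ / n.factorial),
        Nat.factorial_succ]
      push_cast
      field_simp
    rw [e] at this
    rw [pow_succ']
    exact this

theorem Coef.isUnit (z : ℂ) : IsUnit (1 - D.V z) := by
  set M := ∫ t in α..β, D.κ z t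
  have hM : 0 ≤ M := intervalIntegral.integral_nonneg D.hab fun t _ => D.κ_nonneg z t
  have hb : ∀ x : Icc α β, |∫ t in (D.c : ℝ)..x, D.κ z t| ≤ M := by
    intro x
    refine intervalIntegral.abs_integral_mono_interval ?_ ?_ (D.κ_int z) |>.trans (abs_of_nonneg hM).le
    · exact uIoc_subset_uIoc_of_uIcc_subset_uIcc (J_mono D.hab D.c x)
    · exact Eventually.of_forall fun t => D.κ_nonneg z t
  obtain ⟨n, hn⟩ := ((FloorSemiring.tendsto_pow_div_factorial_atTop M).eventually (gt_mem_nhds one_pos)).exists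
  have hV : ‖D.V z ^ n‖ < 1 := by
    refine lt_of_le_of_lt (ContinuousLinearMap.opNorm_le_bound _ (by positivity) fun y => ?_) hn
    have hb' : ∀ x : Icc α β, |∫ t in (D.c : ℝ)..x, D.κ z t| ^ n / n.factorial * ‖y‖ ≤ M ^ n / n.factorial * ‖y‖ := by
      intro x; gcongr; exact hb x
    rw [Prod.norm_def, max_le_iff]
    constructor <;> rw [ContinuousMap.norm_le _ (by positivity)] <;> intro x
    · exact ((D.pow_bound z n y x).1).trans (hb' x)
    · exact ((D.pow_bound z n y x).2).trans (hb' x)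
  have h1 := isUnit_one_sub_of_norm_lt_one (R := XX α β →L[ℂ] XX α β) hV
  exact ring_unit _ n h1

def Coef.R (z : ℂ) : XX α β →L[ℂ] XX α β := Ring.inverse (1 - D.V z)

theorem Coef.R_diff : Differentiable ℂ D.R := by
  exact ring_diff (A := XX α β →L[ℂ] XX α β) D.V0 D.V1 D.isUnit

theorem Coef.R_eq {z : ℂ} {y g : XX α β} (h : y = g + D.V z y) : y = D.R z g := by
  have h1 : (1 - D.V z) y = g := by
    simp only [sub_apply, one_apply_eq_self]
    exact sub_eq_of_eq_add h
  have h2 := Ring.inverse_mul_cancel _ (D.isUnit z)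
  have h3 := congrArg (fun A : XX α β →L[ℂ] XX α β => A y) h2
  simp only [mul_apply_eq_comp, one_apply_eq_self] at h3
  rw [h1] at h3
  exact h3.symm

theorem Coef.R_spec (z : ℂ) (g : XX α β) : D.R z g = g + D.V z (D.R z g) := by
  have h2 := Ring.mul_inverse_cancel _ (D.isUnit z)
  have h3 := congrArg (fun A : XX α β →L[ℂ] XX α β => A g) h2
  simp only [mul_apply_eq_comp, one_apply_eq_self, sub_apply] at h3
  exact eq_add_of_sub_eq h3

end DBC

namespace DBC

variable {a b : ℝ} {p q r s : ℝ → ℝ} 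

theorem ii_ofReal {f : ℝ → ℝ} {x y : ℝ} (h : IntervalIntegrable f volume x y) :
    IntervalIntegrable (fun t => (f t : ℂ)) volume x y := ⟨h.1.ofReal, h.2.ofReal⟩

def mkCoef (hyp : SLHyp a b p q r s) {α β : ℝ} (hα : α ∈ Ioo a b) (hβ : β ∈ Ioo a b) (hab : α ≤ β)
    (c : Icc α β) : Coef α β where
  hab := hab
  c := c
  kp t := (((p t)⁻¹ : ℝ) : ℂ)
  ks t := (s t : ℂ)
  kq t := (q t : ℂ)
  kr t := (r t : ℂ)
  ip := ii_ofReal (hyp.ip β hβ α hα)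
  is' := ii_ofReal (hyp.is' β hβ α hα)
  iq := ii_ofReal (hyp.iq β hβ α hα)
  ir := ii_ofReal (hyp.ir β hβ α hα)

theorem HasAC.cont {f g : ℝ → ℂ} (h : HasACDeriv a b f g) {α β : ℝ} (hα : α ∈ Ioo a b)
    (hβ : β ∈ Ioo a b) (hab : α ≤ β) : ContinuousOn f (Icc α β) := by
  have := (ACOn.of_has h hβ hα).cont
  rwa [uIcc_of_le hab] at this

/-- restriction to a compact interval -/
def rst {f : ℝ → ℂ} {α β : ℝ} (h : ContinuousOn f (Icc α β)) : XS α β :=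
  ⟨fun x => f x, h.comp_continuous continuous_subtype_val fun x => x.2⟩

theorem rst_ext {f : ℝ → ℂ} {α β : ℝ} (hab : α ≤ β) (h : ContinuousOn f (Icc α β)) {t : ℝ}
    (ht : t ∈ Icc α β) : IccExtend hab (rst h) t = f t := by
  rw [IccExtend_of_mem hab _ ht]; rfl

def cst (α β : ℝ) (v : ℂ) : XS α β := v • (1 : XS α β)

theorem rep (hyp : SLHyp a b p q r s) {α β : ℝ} (hα : α ∈ Ioo a b) (hβ : β ∈ Ioo a b) (hab : α ≤ β)
    (c : Icc α β) {f fq : ℝ → ℂ} {z : ℂ} (h : SLSys a b p q r s f fq (fun x => z * f x))  :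
    ((rst (HasAC.cont h.fst hα hβ hab), rst (HasAC.cont h.snd hα hβ hab)) : XX α β) =
      (mkCoef hyp hα hβ hab c).R z (cst α β (f c), cst α β (fq c)) := by
  apply Coef.R_eq
  have hs : Icc α β ⊆ Ioo a b := fun t ht => ⟨hα.1.trans_le ht.1, ht.2.trans_lt hβ.2⟩
  ext x
  · simp only [Prod.fst_add, ContinuousMap.add_apply]
    rw [Coef.V_fst]
    change f x = f c * 1 + _
    rw [(h.fst x (hs x.2) c (hs c.2)).2, mul_one]
    congr 1
    refine intervalIntegral.integral_congr fun t ht => ?_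
    have ht' := ordConnected_Icc.uIcc_subset c.2 x.2 ht
    beta_reduce
    rw [rst_ext _ _ ht', rst_ext _ _ ht']
    simp only [mkCoef]
    push_cast
    ring
  · simp only [Prod.snd_add, ContinuousMap.add_apply]
    rw [Coef.V_snd]
    change fq x = fq c * 1 + _
    rw [(h.snd x (hs x.2) c (hs c.2)).2, mul_one]
    congr 1
    refine intervalIntegral.integral_congr fun t ht => ?_
    have ht' := ordConnected_Icc.uIcc_subset c.2 x.2 ht
    beta_reduce
    rw [rst_ext _ _ ht', rst_ext _ _ ht']
    simp only [mkCoef]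
    ring

theorem sol_unique (hyp : SLHyp a b p q r s) {f fq : ℝ → ℂ} {z : ℂ}
    (h : SLSys a b p q r s f fq (fun x => z * f x)) {c : ℝ} (hc : c ∈ Ioo a b) (h0 : f c = 0)
    (h1 : fq c = 0) {x : ℝ} (hx : x ∈ Ioo a b) : f x = 0 ∧ fq x = 0 := by
  have hα : min c x ∈ Ioo a b := by
    constructor
    · exact lt_min hc.1 hx.1
    · exact (min_le_left _ _).trans_lt hc.2
  have hβ : max c x ∈ Ioo a b := by
    constructor
    · exact hc.1.trans_le (le_max_left _ _)
    · exact max_lt hc.2 hx.2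
  have hab : min c x ≤ max c x := min_le_max
  have := rep hyp hα hβ hab ⟨c, min_le_left _ _, le_max_left _ _⟩ h
  have e0 : cst (min c x) (max c x) 0 = 0 := by
    ext t; change (0 : ℂ) * _ = 0; exact zero_mul _
  have e1 : ((cst (min c x) (max c x) (f c), cst (min c x) (max c x) (fq c)) : XX (min c x) (max c x)) = 0 := by
    rw [h0, h1, e0]; rfl
  have this := this.trans ((congrArg _ e1).trans (map_zero _))
  have hx' : x ∈ Icc (min c x) (max c x) := ⟨min_le_right _ _, le_max_right _ _⟩
  constructor
  · exact congrArg (fun y : XX (min c x) (max c x) => y.1 ⟨x, hx'⟩) this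
  · exact congrArg (fun y : XX (min c x) (max c x) => y.2 ⟨x, hx'⟩) this

variable {φ φq : ℂ → ℝ → ℂ}

theorem phi_diff (hyp : SLHyp a b p q r s) (hφ : RealEntireSolFam a b p q r s φ φq) {α β : ℝ}
    (hα : α ∈ Ioo a b) (hβ : β ∈ Ioo a b) (hab : α ≤ β) :
    ∃ Φ : ℂ → XS α β, Differentiable ℂ Φ ∧ ∀ z (x : Icc α β), Φ z x = φ z x := by
  let c : Icc α β := ⟨β, hab, le_rfl⟩
  refine ⟨fun z => ((mkCoef hyp hα hβ hab c).R z (cst α β (φ z c), cst α β (φq z c))).1, ?_, ?_⟩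
  · have h1 := (mkCoef hyp hα hβ hab c).R_diff
    have h2 := (hφ.entire β hβ).1
    have h3 := (hφ.entire β hβ).2
    have h4 : Differentiable ℂ (fun z => ((cst α β (φ z c), cst α β (φq z c)) : XX α β)) :=
      (h2.smul_const _).prodMk (h3.smul_const _)
    have h5 : Differentiable ℂ fun z => ((mkCoef hyp hα hβ hab c).R z (cst α β (φ z c), cst α β (φq z c))) :=
      h1.clm_apply h4
    exact (ContinuousLinearMap.fst ℂ (XS α β) (XS α β)).differentiable.comp h5
  · intro z x
    have := rep hyp hα hβ hab c (hφ.sol z)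
    exact (congrArg (fun y : XX α β => y.1 x) this).symm

theorem exists_sol (hyp : SLHyp a b p q r s) {α c : ℝ} (hα : α ∈ Ioo a b) (hc : c ∈ Ioo a b)
    (hab : α ≤ c) (f : ℝ → ℂ) (hf : IntervalIntegrable (fun t => (r t : ℂ) * f t) volume α c) :
    ∃ U : ℂ → XS α c, Differentiable ℂ U ∧ ∀ z, ∃ u1 : ℝ → ℂ,
      ACOn c α (IccExtend hab (U z)) (fun x => u1 x / (p x : ℂ) - (s x : ℂ) * IccExtend hab (U z) x) ∧
      ACOn c α u1 (fun x => (s x : ℂ) * u1 x + (q x : ℂ) * IccExtend hab (U z) x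
        - (r x : ℂ) * (z * IccExtend hab (U z) x + f x)) ∧
      IccExtend hab (U z) c = 0 ∧ u1 c = 0 := by
  let c' : Icc α c := ⟨c, hab, le_rfl⟩
  let D := mkCoef hyp hα hc hab c'
  have hG : ContinuousOn (fun x => ∫ t in c..x, (r t : ℂ) * f t) (Icc α c) := by
    have := (ac_prim hf (c := c) right_mem_uIcc).continuousOn
    rwa [uIcc_of_le hab] at this
  refine ⟨fun z => (D.R z (0, - rst hG)).1, ?_, fun z => ⟨IccExtend hab (D.R z (0, - rst hG)).2, ?_⟩⟩
  · have h5 : Differentiable ℂ fun z => D.R z (0, - rst hG) := D.R_diff.clm_apply (differentiable_const _)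
    exact (ContinuousLinearMap.fst ℂ (XS α c) (XS α c)).differentiable.comp h5
  · set y := D.R z (0, - rst hG) with hy
    have hspec := D.R_spec z (0, - rst hG)
    rw [← hy] at hspec
    have e1 : ∀ x ∈ Icc α c, IccExtend hab y.1 x = ∫ t in c..x, (IccExtend hab y.2 t / (p t : ℂ) - (s t : ℂ) * IccExtend hab y.1 t) := by
      intro x hx
      have := congrArg (fun y : XX α c => y.1 ⟨x, hx⟩) hspec
      simp only [Prod.fst_add, zero_add] at this
      rw [IccExtend_of_mem hab _ hx, this, Coef.V_fst]
      refine intervalIntegral.integral_congr fun t ht => ?_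
      simp only [D, mkCoef]
      push_cast
      ring
    have i1 : IntervalIntegrable (fun t => IccExtend hab y.2 t / (p t : ℂ) - (s t : ℂ) * IccExtend hab y.1 t) volume c α := by
      refine ((J_int hab D.ip y.2).sub (J_int hab D.is' y.1)).symm.congr ?_
      intro t ht
      simp only [D, mkCoef]
      push_cast
      ring
    have i20 := ((J_int hab D.is' y.2).add (J_int hab D.iq y.1)).sub ((J_int hab D.ir y.1).const_mul z)
    have i2 : IntervalIntegrable (fun x => (s x : ℂ) * IccExtend hab y.2 x + (q x : ℂ) * IccExtend hab y.1 x
        - (r x : ℂ) * (z * IccExtend hab y.1 x + f x)) volume c α := by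
      refine (i20.sub hf).symm.congr ?_
      intro t ht
      simp only [D, mkCoef]
      ring
    have e2 : ∀ x ∈ Icc α c, IccExtend hab y.2 x = ∫ x in c..x, ((s x : ℂ) * IccExtend hab y.2 x + (q x : ℂ) * IccExtend hab y.1 x
        - (r x : ℂ) * (z * IccExtend hab y.1 x + f x)) := by
      intro x hx
      have := congrArg (fun y : XX α c => y.2 ⟨x, hx⟩) hspec
      simp only [Prod.snd_add, ContinuousMap.add_apply] at this
      rw [IccExtend_of_mem hab _ hx, this, Coef.V_snd]
      change - (∫ t in c..x, (r t : ℂ) * f t) + _ = _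
      have hm : uIcc c x ⊆ uIcc α c := by
        rw [uIcc_of_le hab]; exact ordConnected_Icc.uIcc_subset c'.2 hx
      rw [neg_add_eq_sub]
      erw [← intervalIntegral.integral_sub (i20.mono_set hm) (hf.mono_set hm)]
      refine intervalIntegral.integral_congr fun t ht => ?_
      simp only [D, mkCoef]
      ring
    have hcm : c ∈ Icc α c := c'.2
    have z1 : IccExtend hab y.1 c = 0 := by rw [e1 c hcm]; simp
    have z2 : IccExtend hab y.2 c = 0 := by rw [e2 c hcm]; simp
    refine ⟨⟨i1, fun x hx => ?_⟩, ⟨i2, fun x hx => ?_⟩, z1, z2⟩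
    · rw [uIcc_of_ge hab] at hx
      rw [z1, zero_add, ← e1 x hx]
    · rw [uIcc_of_ge hab] at hx
      rw [z2, zero_add, ← e2 x hx]

end DBC

namespace DBC

variable {a b : ℝ} {p q r s : ℝ → ℝ} 

theorem wr_acon {y x : ℝ} {f fq w g gq v : ℝ → ℂ}
    (hf : ACOn y x f fun x => fq x / (p x : ℂ) - (s x : ℂ) * f x)
    (hfq : ACOn y x fq fun x => (s x : ℂ) * fq x + (q x : ℂ) * f x - (r x : ℂ) * w x)
    (hg : ACOn y x g fun x => gq x / (p x : ℂ) - (s x : ℂ) * g x)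
    (hgq : ACOn y x gq fun x => (s x : ℂ) * gq x + (q x : ℂ) * g x - (r x : ℂ) * v x) :
    ACOn y x (Wr f fq g gq) (fun t => (r t : ℂ) * (w t * g t - f t * v t)) := by
  refine ((hf.mul hgq).sub (hfq.mul hg)).congr' (Eventually.of_forall fun t _ => ?_)
  ring

variable {φ φq : ℂ → ℝ → ℂ}

theorem phi_cont (hφ : RealEntireSolFam a b p q r s φ φq) (z : ℂ) : ContinuousOn (φ z) (Ioo a b) := by
  intro x hx
  obtain ⟨α, h1, h2⟩ := exists_between hx.1
  obtain ⟨β, h3, h4⟩ := exists_between hx.2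
  have := HasAC.cont (hφ.sol z).fst (α := α) (β := β) ⟨h1, h2.trans hx.2⟩ ⟨hx.1.trans h3, h4⟩ (h2.trans h3).le
  exact (this.continuousAt (Icc_mem_nhds h2 h3)).continuousWithinAt

/-- `ψ_z = φ_z √r` -/
def psi (r : ℝ → ℝ) (φ : ℂ → ℝ → ℂ) (z : ℂ) (x : ℝ) : ℂ := φ z x * (Real.sqrt (r x) : ℂ)

theorem ae_rpos (hyp : SLHyp a b p q r s) {x : ℝ} (hx : x ≤ b) :
    ∀ᵐ t ∂(volume.restrict (Ioo a x)), 0 < r t :=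
  ae_mono (Measure.restrict_mono (Ioo_subset_Ioo_right hx) le_rfl) hyp.rpos

theorem psi_memLp (hyp : SLHyp a b p q r s) (hφ : RealEntireSolFam a b p q r s φ φq) (z : ℂ) {c : ℝ}
    (hc : c ∈ Ioo a b) : MemLp (psi r φ z) 2 (volume.restrict (Ioo a c)) := by
  have hm : AEStronglyMeasurable (psi r φ z) (volume.restrict (Ioo a c)) := by
    refine AEStronglyMeasurable.mul ?_ ?_
    · exact ((phi_cont hφ z).mono (Ioo_subset_Ioo_right hc.2.le)).aestronglyMeasurable measurableSet_Ioo
    · exact (measurable_ofReal.comp hyp.mr.sqrt).aestronglyMeasurable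
  rw [memLp_two_iff_integrable_sq_norm hm]
  refine (hφ.sqint z c hc).congr ?_
  filter_upwards [ae_rpos hyp hc.2.le] with t ht
  rw [psi, norm_mul, mul_pow, norm_real, Real.norm_of_nonneg (Real.sqrt_nonneg _), Real.sq_sqrt ht.le]

theorem psi_mul (z ζ : ℂ) {t : ℝ} (ht : 0 < r t) :
    psi r φ z t * psi r φ ζ t = (r t : ℂ) * (φ z t * φ ζ t) := by
  have : ((Real.sqrt (r t) : ℝ) : ℂ) * (Real.sqrt (r t) : ℝ) = (r t : ℂ) := by
    rw [← ofReal_mul, Real.mul_self_sqrt ht.le]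
  unfold psi
  rw [← this]; ring

theorem psi_conj (hφ : RealEntireSolFam a b p q r s φ φq) (z : ℂ) {x : ℝ} (hx : x ∈ Ioo a b) :
    psi r φ (conj z) x = conj (psi r φ z x) := by
  simp [psi, (hφ.real z x hx).1]

/-- limits of integrals towards the left endpoint -/
theorem tendsto_left {g : ℝ → ℂ} {a c : ℝ} (hac : a < c) (hg : IntegrableOn g (Ioo a c)) :
    Tendsto (fun x => ∫ t in x..c, g t) (𝓝[>] a) (𝓝 (∫ t in Ioo a c, g t)) := by
  have hg' : IntegrableOn g (Icc a c) := by rwa [integrableOn_Icc_iff_integrableOn_Ioo]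
  have hI : IntervalIntegrable g volume a c := by
    rw [intervalIntegrable_iff_integrableOn_Icc_of_le hac.le]; exact hg'
  have h := (ac_prim hI (c := c) right_mem_uIcc).continuousOn
  have h1 : ContinuousWithinAt (fun x => ∫ t in c..x, g t) (Icc a c) a := by
    rw [uIcc_of_le hac.le] at h; exact h a ⟨le_rfl, hac.le⟩
  have h2 : Tendsto (fun x => ∫ t in c..x, g t) (𝓝[>] a) (𝓝 (∫ t in c..a, g t)) := by
    refine h1.tendsto.mono_left ?_
    rw [← nhdsWithin_Ioc_eq_nhdsGT hac]
    exact nhdsWithin_mono _ Ioc_subset_Icc_self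
  have h3 := h2.neg
  simp only [← intervalIntegral.integral_symm] at h3
  rwa [intervalIntegral.integral_of_le hac.le, integral_Ioc_eq_integral_Ioo] at h3

theorem lagrange (hyp : SLHyp a b p q r s) (hφ : RealEntireSolFam a b p q r s φ φq) (z ζ : ℂ) {c : ℝ}
    (hc : c ∈ Ioo a b) : Wr (φ z) (φq z) (φ ζ) (φq ζ) c
      = (z - ζ) * ∫ x in Ioo a c, psi r φ z x * psi r φ ζ x := by
  have hi : IntegrableOn (fun x => psi r φ z x * psi r φ ζ x) (Ioo a c) :=
    (psi_memLp hyp hφ z hc).integrable_mul (psi_memLp hyp hφ ζ hc)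
  have h1 := (tendsto_left hc.1 hi).const_mul (z - ζ)
  have h2 : Tendsto (fun x => Wr (φ z) (φq z) (φ ζ) (φq ζ) c - Wr (φ z) (φq z) (φ ζ) (φq ζ) x)
      (𝓝[>] a) (𝓝 (Wr (φ z) (φq z) (φ ζ) (φq ζ) c - 0)) := (hφ.bc z ζ).const_sub _
  rw [sub_zero] at h2
  refine tendsto_nhds_unique (h2.congr' ?_) h1
  filter_upwards [Ioo_mem_nhdsGT hc.1] with x hx
  have hx' : x ∈ Ioo a b := ⟨hx.1, hx.2.trans hc.2⟩
  have := (wr_acon (ACOn.of_has (hφ.sol z).fst hc hx') (ACOn.of_has (hφ.sol z).snd hc hx')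
    (ACOn.of_has (hφ.sol ζ).fst hc hx') (ACOn.of_has (hφ.sol ζ).snd hc hx')).end_eq
  rw [this, ← intervalIntegral.integral_const_mul]
  refine intervalIntegral.integral_congr_ae ?_
  have := hyp.rpos
  rw [ae_restrict_iff' measurableSet_Ioo] at this
  filter_upwards [this] with t ht htm
  rw [uIoc_of_le hx.2.le] at htm
  rw [psi_mul z ζ (ht ⟨hx.1.trans htm.1, htm.2.trans_lt hc.2⟩)]
  ring

/-- `∫|ψ_z|²` on `(a,c)` -/
def nrm2 (a : ℝ) (r : ℝ → ℝ) (φ : ℂ → ℝ → ℂ) (c : ℝ) (z : ℂ) : ℝ := ∫ x in Ioo a c, ‖psi r φ z x‖ ^ 2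

theorem nrm2_eq (hφ : RealEntireSolFam a b p q r s φ φq) (z : ℂ) {c : ℝ} (hc : c ∈ Ioo a b) :
    ∫ x in Ioo a c, psi r φ z x * psi r φ (conj z) x = (nrm2 a r φ c z : ℂ) := by
  rw [nrm2, ← integral_complex_ofReal]
  refine setIntegral_congr_fun measurableSet_Ioo fun x hx => ?_
  beta_reduce
  rw [psi_conj hφ z ⟨hx.1, hx.2.trans hc.2⟩, mul_conj, normSq_eq_norm_sq]

theorem phi_ne (hyp : SLHyp a b p q r s) (hφ : RealEntireSolFam a b p q r s φ φq) (z : ℂ) {c : ℝ}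
    (hc : c ∈ Ioo a b) : φ z c ≠ 0 ∨ φq z c ≠ 0 := by
  by_contra! h
  obtain ⟨x, hx, h'⟩ := hφ.nontriv z
  have := sol_unique hyp (hφ.sol z) hc h.1 h.2 hx
  tauto

/-- if `φ_z` vanishes a.e. on a subinterval it vanishes -/
theorem phi_not_ae_zero (hyp : SLHyp a b p q r s) (hφ : RealEntireSolFam a b p q r s φ φq) (z : ℂ) {c : ℝ}
    (hc : c ∈ Ioo a b) : ¬ (∀ x ∈ Ioo a c, φ z x = 0) := by
  intro h
  obtain ⟨y, hy1, hy2⟩ := exists_between hc.1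
  obtain ⟨x, hx1, hx2⟩ := exists_between hy2
  have hyb : y ∈ Ioo a b := ⟨hy1, hy2.trans hc.2⟩
  have hxb : x ∈ Ioo a b := ⟨hy1.trans hx1, hx2.trans hc.2⟩
  have h1 := ACOn.of_has (hφ.sol z).fst hxb hyb
  have hz : ∀ t ∈ uIcc y x, φ z t = 0 := by
    intro t ht
    rw [uIcc_of_le hx1.le] at ht
    exact h t ⟨hy1.trans_le ht.1, ht.2.trans_lt hx2⟩
  have h2 := ae_zero_of_prim h1.int (fun t ht => by
    have := h1.eq t ht
    rw [hz t ht, hz y left_mem_uIcc, zero_add] at this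
    exact this.symm)
  have hp := hyp.pne
  rw [ae_restrict_iff' measurableSet_Ioo] at hp
  have h3 : φq z =ᵐ[volume.restrict (Icc y x)] fun _ => 0 := by
    rw [EventuallyEq, ae_restrict_iff' measurableSet_Icc]
    filter_upwards [h2, hp] with t h2 hp ht
    rw [← uIcc_of_le hx1.le] at ht
    have e := h2 ht
    rw [hz t ht, mul_zero, sub_zero, div_eq_zero_iff] at e
    refine e.resolve_right ?_
    rw [uIcc_of_le hx1.le] at ht
    exact_mod_cast hp ⟨hy1.trans_le ht.1, ht.2.trans_lt hxb.2⟩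
  have h4 := (ACOn.of_has (hφ.sol z).snd hxb hyb).cont
  rw [uIcc_of_le hx1.le] at h4
  have h5 := Measure.eqOn_Icc_of_ae_eq volume hx1.ne h3 h4 continuousOn_const
  have := phi_ne hyp hφ z hyb
  rw [hz y left_mem_uIcc, h5 ⟨le_rfl, hx1.le⟩] at this
  simp at this

theorem nrm2_pos (hyp : SLHyp a b p q r s) (hφ : RealEntireSolFam a b p q r s φ φq) (z : ℂ) {c : ℝ}
    (hc : c ∈ Ioo a b) : 0 < nrm2 a r φ c z := by
  have h0 : 0 ≤ nrm2 a r φ c z := integral_nonneg fun x => by positivity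
  refine lt_of_le_of_ne h0 fun h => ?_
  have hi : IntegrableOn (fun x => ‖psi r φ z x‖ ^ 2) (Ioo a c) :=
    (memLp_two_iff_integrable_sq_norm (psi_memLp hyp hφ z hc).1).1 (psi_memLp hyp hφ z hc)
  have h1 := (integral_eq_zero_iff_of_nonneg (fun x => by positivity) hi).1 h.symm
  have h2 : φ z =ᵐ[volume.restrict (Ioo a c)] fun _ => 0 := by
    filter_upwards [h1, ae_rpos hyp hc.2.le] with t h1 hr
    simp only [psi, Pi.zero_apply, ne_eq, OfNat.ofNat_ne_zero, not_false_eq_true, pow_eq_zero_iff, norm_eq_zero,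
      mul_eq_zero, ofReal_eq_zero] at h1
    exact h1.resolve_right (Real.sqrt_pos.2 hr).ne'
  have := Measure.eqOn_Ioo_of_ae_eq volume h2 ((phi_cont hφ z).mono (Ioo_subset_Ioo_right hc.2.le)) continuousOn_const
  exact phi_not_ae_zero hyp hφ z hc this

theorem E_kernel (hyp : SLHyp a b p q r s) (hφ : RealEntireSolFam a b p q r s φ φq) (z ζ : ℂ) {c : ℝ}
    (hc : c ∈ Ioo a b) : dBE φ φq c z * conj (dBE φ φq c ζ) - conj (dBE φ φq c (conj z)) * dBE φ φq c (conj ζ)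
      = 2 * I * (conj ζ - z) * ∫ x in Ioo a c, psi r φ z x * conj (psi r φ ζ x) := by
  have h := lagrange hyp hφ z (conj ζ) hc
  have e : ∫ x in Ioo a c, psi r φ z x * conj (psi r φ ζ x) = ∫ x in Ioo a c, psi r φ z x * psi r φ (conj ζ) x := by
    refine setIntegral_congr_fun measurableSet_Ioo fun x hx => ?_
    beta_reduce
    rw [psi_conj hφ ζ ⟨hx.1, hx.2.trans hc.2⟩]
  rw [e]
  unfold Wr at h
  simp only [dBE, map_add, map_mul, conj_I, (hφ.real z c hc).1, (hφ.real z c hc).2, (hφ.real ζ c hc).1,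
    (hφ.real ζ c hc).2, conj_conj] at h ⊢
  linear_combination (-2 * I) * h

theorem E_real_ne (hyp : SLHyp a b p q r s) (hφ : RealEntireSolFam a b p q r s φ φq) (t : ℝ) {c : ℝ}
    (hc : c ∈ Ioo a b) : dBE φ φq c t ≠ 0 := by
  intro h
  have h1 := hφ.real t c hc
  rw [conj_ofReal] at h1
  obtain ⟨x, hx⟩ := conj_eq_iff_real.1 h1.1.symm
  obtain ⟨y, hy⟩ := conj_eq_iff_real.1 h1.2.symm
  have := phi_ne hyp hφ t hc
  rw [dBE, hx, hy] at h
  have h2 := congrArg re h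
  have h3 := congrArg im h
  simp at h2 h3
  simp [hx, hy, h2, h3] at this

end DBC

namespace DBC

theorem cs {Ω : Type*} [MeasurableSpace Ω] {ν : Measure Ω} {f g : Ω → ℂ} (hf : MemLp f 2 ν) (hg : MemLp g 2 ν) :
    ‖∫ x, f x * g x ∂ν‖ ≤ Real.sqrt (∫ x, ‖f x‖ ^ 2 ∂ν) * Real.sqrt (∫ x, ‖g x‖ ^ 2 ∂ν) := by
  refine (norm_integral_le_integral_norm _).trans ?_
  simp_rw [norm_mul]
  have h2 : ENNReal.ofReal 2 = 2 := by simp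
  have := integral_mul_norm_le_Lp_mul_Lq (μ := ν) (f := f) (g := g) Real.HolderConjugate.two_two
    (by rwa [h2]) (by rwa [h2])
  rw [Real.sqrt_eq_rpow, Real.sqrt_eq_rpow]
  simpa using this

variable {a b : ℝ} {p q r s : ℝ → ℝ} {φ φq : ℂ → ℝ → ℂ}

theorem sq_integrable {Ω : Type*} [MeasurableSpace Ω] {ν : Measure Ω} {f : Ω → ℂ} (hf : MemLp f 2 ν) :
    Integrable (fun x => ‖f x‖ ^ 2) ν := (memLp_two_iff_integrable_sq_norm hf.1).1 hf

theorem nrm2_bdd_nonreal (hyp : SLHyp a b p q r s) (hφ : RealEntireSolFam a b p q r s φ φq) {c : ℝ}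
    (hc : c ∈ Ioo a b) (R : ℝ) (hR : 0 < R) : ∃ C, ∀ z : ℂ, ‖z‖ ≤ R → z.im ≠ 0 → nrm2 a r φ c z ≤ C := by
  have key : ∀ f : ℂ → ℂ, Differentiable ℂ f → ∃ L, 0 ≤ L ∧ (∀ z : ℂ, ‖z‖ ≤ R → ‖f z‖ ≤ L) ∧
      ∀ z w : ℂ, ‖z‖ ≤ R → ‖w‖ ≤ R → ‖f z - f w‖ ≤ L * ‖z - w‖ := by
    intro f hf
    have hcp : IsCompact (Metric.closedBall (0 : ℂ) R) := isCompact_closedBall _ _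
    obtain ⟨L1, h1⟩ := hcp.exists_bound_of_continuousOn hf.continuous.continuousOn
    have hd : Differentiable ℂ (deriv f) := hf.contDiff (n := 2) |>.differentiable_deriv_two
    obtain ⟨L2, h2⟩ := hcp.exists_bound_of_continuousOn hd.continuous.continuousOn
    have h0 : (0 : ℂ) ∈ Metric.closedBall (0 : ℂ) R := by simp [hR.le]
    refine ⟨max L1 L2, ((norm_nonneg _).trans (h1 0 h0)).trans (le_max_left _ _), fun z hz => ?_, fun z w hz hw => ?_⟩
    · exact (h1 z (by simpa using hz)).trans (le_max_left _ _)
    · exact (convex_closedBall (0 : ℂ) R).norm_image_sub_le_of_norm_deriv_le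
        (fun x _ => hf x) (fun x hx => (h2 x hx).trans (le_max_right _ _)) (by simpa using hw) (by simpa using hz)
  obtain ⟨L, hL0, hL1, hL2⟩ := key _ (hφ.entire c hc).1
  obtain ⟨M, hM0, hM1, hM2⟩ := key _ (hφ.entire c hc).2
  refine ⟨2 * L * M, fun z hz him => ?_⟩
  have h := lagrange hyp hφ z (conj z) hc
  rw [nrm2_eq hφ z hc] at h
  have hz' : ‖conj z‖ ≤ R := by rwa [RCLike.norm_conj]
  have hne : 0 < ‖z - conj z‖ := by
    rw [norm_pos_iff, sub_ne_zero]
    intro h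
    exact him (conj_eq_iff_im.1 h.symm)
  have h1 : Wr (φ z) (φq z) (φ (conj z)) (φq (conj z)) c =
    φ z c * (φq (conj z) c - φq z c) - φq z c * (φ (conj z) c - φ z c) := by unfold Wr; ring
  have h2 := congrArg norm h
  rw [h1, norm_mul, norm_real, Real.norm_of_nonneg (nrm2_pos hyp hφ z hc).le] at h2
  have h3 : ‖φ z c * (φq (conj z) c - φq z c) - φq z c * (φ (conj z) c - φ z c)‖ ≤
      L * (M * ‖z - conj z‖) + M * (L * ‖z - conj z‖) := by
    refine (norm_sub_le _ _).trans ?_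
    rw [norm_mul, norm_mul, norm_sub_rev z]
    gcongr
    · exact hL1 z hz
    · exact hM2 _ _ hz' hz
    · exact hM1 z hz
    · exact hL2 _ _ hz' hz
  rw [h2] at h3
  have : ‖z - conj z‖ * nrm2 a r φ c z ≤ ‖z - conj z‖ * (2 * L * M) := by linarith
  exact le_of_mul_le_mul_left this hne

theorem nrm2_bdd (hyp : SLHyp a b p q r s) (hφ : RealEntireSolFam a b p q r s φ φq) {c : ℝ}
    (hc : c ∈ Ioo a b) (R : ℝ) (hR : 0 < R) : ∃ C, ∀ z : ℂ, ‖z‖ ≤ R → nrm2 a r φ c z ≤ C := by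
  obtain ⟨C, hC⟩ := nrm2_bdd_nonreal hyp hφ hc (R + 1) (by linarith)
  refine ⟨C, fun z hz => ?_⟩
  by_cases him : z.im ≠ 0
  · exact hC z (by linarith) him
  push Not at him
  let w : ℕ → ℂ := fun n => z + ((1 / ((n : ℝ) + 1) : ℝ) : ℂ) * I
  have hw : Tendsto w atTop (𝓝 z) := by
    have h1 : Tendsto (fun n : ℕ => ((1 / ((n : ℝ) + 1) : ℝ) : ℂ)) atTop (𝓝 ((0 : ℝ) : ℂ)) :=
      (continuous_ofReal.tendsto 0).comp tendsto_one_div_add_atTop_nhds_zero_nat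
    have := (h1.mul_const I).const_add z
    simp only [ofReal_zero, zero_mul, add_zero] at this
    exact this
  have hwi : ∀ n, (w n).im ≠ 0 := by
    intro n
    have : (w n).im = 1 / ((n : ℝ) + 1) := by simp only [w, add_im, him, mul_im, ofReal_re, ofReal_im, I_re, I_im]; ring
    rw [this]; positivity
  have hwn : ∀ n, ‖w n‖ ≤ R + 1 := by
    intro n
    refine (norm_add_le _ _).trans (add_le_add hz ?_)
    rw [norm_mul, norm_I, mul_one, norm_real, Real.norm_of_nonneg (by positivity)]
    rw [div_le_one (by positivity)]; linarith [(n.cast_nonneg : (0 : ℝ) ≤ n)]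
  have hC0 : 0 ≤ C := (nrm2_pos hyp hφ (w 0) hc).le.trans (hC _ (hwn 0) (hwi 0))
  have e : ∀ y, ENNReal.ofReal (nrm2 a r φ c y) = ∫⁻ x in Ioo a c, ENNReal.ofReal (‖psi r φ y x‖ ^ 2) := fun y =>
    ofReal_integral_eq_lintegral_ofReal (sq_integrable (psi_memLp hyp hφ y hc)) (Eventually.of_forall fun x => by positivity)
  rw [← ENNReal.ofReal_le_ofReal_iff hC0, e]
  have h1 : ∫⁻ x in Ioo a c, ENNReal.ofReal (‖psi r φ z x‖ ^ 2) =
      ∫⁻ x in Ioo a c, liminf (fun n => ENNReal.ofReal (‖psi r φ (w n) x‖ ^ 2)) atTop := by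
    refine setLIntegral_congr_fun measurableSet_Ioo fun x hx => ?_
    have hx' : x ∈ Ioo a b := ⟨hx.1, hx.2.trans hc.2⟩
    have h2 : Tendsto (fun n => psi r φ (w n) x) atTop (𝓝 (psi r φ z x)) := by
      have := (((hφ.entire x hx').1.continuous.tendsto z).comp hw).mul_const ((Real.sqrt (r x) : ℝ) : ℂ)
      exact this
    exact (((ENNReal.continuous_ofReal.tendsto _).comp (h2.norm.pow 2)).liminf_eq).symm
  rw [h1]
  refine (lintegral_liminf_le' fun n => ?_).trans ?_
  · exact ((psi_memLp hyp hφ (w n) hc).1.norm.pow 2).aemeasurable.ennreal_ofReal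
  · refine liminf_le_of_le (by isBoundedDefault) fun B hB => ?_
    obtain ⟨n, hn⟩ := hB.exists
    refine hn.trans ?_
    rw [← e]
    exact ENNReal.ofReal_le_ofReal (hC _ (hwn n) (hwi n))

/-- the transform -/
def hat (a : ℝ) (r : ℝ → ℝ) (φ : ℂ → ℝ → ℂ) (c : ℝ) (g : ℝ → ℂ) (z : ℂ) : ℂ :=
  ∫ x in Ioo a c, psi r φ z x * g x

theorem sqrt_memLp (hyp : SLHyp a b p q r s) {α c : ℝ} (hα : α ∈ Ioo a b) (hc : c ∈ Ioo a b) (hac : α ≤ c) :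
    MemLp (fun t => (Real.sqrt (r t) : ℂ)) 2 (volume.restrict (Ioc α c)) := by
  have hm : AEStronglyMeasurable (fun t => (Real.sqrt (r t) : ℂ)) (volume.restrict (Ioc α c)) :=
    (measurable_ofReal.comp hyp.mr.sqrt).aestronglyMeasurable
  rw [memLp_two_iff_integrable_sq_norm hm]
  have h := hyp.ir c hc α hα
  refine h.1.congr ?_
  have h2 := ae_mono (Measure.restrict_mono (fun t ht => ⟨hα.1.trans ht.1, ht.2.trans_lt hc.2⟩ : Ioc α c ⊆ Ioo a b) le_rfl) hyp.rpos
  filter_upwards [h2] with t ht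
  rw [norm_real, Real.norm_of_nonneg (Real.sqrt_nonneg _), Real.sq_sqrt ht.le]

theorem restrict_Ioc_le {a α c : ℝ} (hα : a ≤ α) : volume.restrict (Ioc α c) ≤ volume.restrict (Ioo a c) := by
  rw [← Measure.restrict_congr_set (Ioo_ae_eq_Ioc (a := α) (b := c))]
  exact Measure.restrict_mono (Ioo_subset_Ioo_left hα) le_rfl

theorem sqrt_mul_int (hyp : SLHyp a b p q r s) {α c : ℝ} (hα : α ∈ Ioo a b) (hc : c ∈ Ioo a b) (hac : α ≤ c)
    {g : ℝ → ℂ} (hg : MemLp g 2 (volume.restrict (Ioo a c))) :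
    IntervalIntegrable (fun t => (Real.sqrt (r t) : ℂ) * g t) volume α c := by
  rw [intervalIntegrable_iff_integrableOn_Ioc_of_le hac]
  exact (sqrt_memLp hyp hα hc hac).integrable_mul (hg.mono_measure (restrict_Ioc_le hα.1.le))

theorem hat_part_diff (hyp : SLHyp a b p q r s) (hφ : RealEntireSolFam a b p q r s φ φq) {α c : ℝ}
    (hα : α ∈ Ioo a b) (hc : c ∈ Ioo a b) (hac : α ≤ c) {g : ℝ → ℂ} (hg : MemLp g 2 (volume.restrict (Ioo a c))) :
    Differentiable ℂ fun z => ∫ x in α..c, psi r φ z x * g x := by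
  obtain ⟨Φ, h1, h2⟩ := phi_diff hyp hφ hα hc hac
  let L := J hac ⟨α, le_rfl, hac⟩ _ (sqrt_mul_int hyp hα hc hac hg)
  have h3 : Differentiable ℂ fun z => L (Φ z) := L.differentiable.comp h1
  have h4 : Differentiable ℂ fun z => L (Φ z) ⟨c, hac, le_rfl⟩ :=
    (ContinuousMap.evalCLM ℂ (⟨c, hac, le_rfl⟩ : Icc α c) : C(Icc α c, ℂ) →L[ℂ] ℂ).differentiable.comp h3
  refine (congrArg _ (funext fun z => ?_)).mp h4
  simp only [L, J_apply]
  refine intervalIntegral.integral_congr fun t ht => ?_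
  rw [uIcc_of_le hac] at ht
  beta_reduce
  rw [IccExtend_of_mem hac _ ht, h2, psi]
  ring

theorem split_int {g : ℝ → ℂ} {a α c : ℝ} (h1 : a < α) (h2 : α ≤ c) (hg : IntegrableOn g (Ioo a c)) :
    ∫ x in Ioo a c, g x = (∫ x in Ioo a α, g x) + ∫ x in α..c, g x := by
  rw [intervalIntegral.integral_of_le h2, ← integral_Ioc_eq_integral_Ioo, ← integral_Ioc_eq_integral_Ioo,
    ← Ioc_union_Ioc_eq_Ioc h1.le h2]
  have hg' : IntegrableOn g (Ioc a c) := by rwa [integrableOn_Ioc_iff_integrableOn_Ioo]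
  refine setIntegral_union ?_ measurableSet_Ioc (hg'.mono_set (Ioc_subset_Ioc_right h2))
    (hg'.mono_set (Ioc_subset_Ioc_left h1.le))
  rw [Set.disjoint_left]; intro t h1 h2; exact absurd h2.1 (not_lt.2 h1.2)

theorem hat_diff (hyp : SLHyp a b p q r s) (hφ : RealEntireSolFam a b p q r s φ φq) {c : ℝ}
    (hc : c ∈ Ioo a b) {g : ℝ → ℂ} (hg : MemLp g 2 (volume.restrict (Ioo a c))) :
    Differentiable ℂ (hat a r φ c g) := by
  obtain ⟨α, -, hα, hlim⟩ := exists_seq_strictAnti_tendsto' hc.1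
  have hg2 : IntegrableOn (fun x => ((‖g x‖ ^ 2 : ℝ) : ℂ)) (Ioo a c) := (sq_integrable hg).ofReal
  -- tail
  have htail : Tendsto (fun n => ∫ x in Ioo a (α n), ‖g x‖ ^ 2) atTop (𝓝 0) := by
    have h1 := (tendsto_left hc.1 hg2).comp (tendsto_nhdsWithin_iff.2 ⟨hlim, Eventually.of_forall fun n => (hα n).1⟩)
    have h2 := (h1.const_sub (∫ x in Ioo a c, ((‖g x‖ ^ 2 : ℝ) : ℂ))).norm
    rw [sub_self, norm_zero] at h2
    refine h2.congr fun n => ?_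
    simp only [Function.comp]
    rw [split_int (hα n).1 (hα n).2.le hg2, add_sub_cancel_right,
      integral_complex_ofReal, norm_real, Real.norm_of_nonneg (integral_nonneg fun x => by positivity)]
  rw [← differentiableOn_univ]
  have hαb : ∀ n, α n ∈ Ioo a b := fun n => ⟨(hα n).1, (hα n).2.trans hc.2⟩
  refine TendstoLocallyUniformlyOn.differentiableOn (φ := atTop) (F := fun n z => ∫ x in α n..c, psi r φ z x * g x)
    ?_ (Eventually.of_forall fun n => (hat_part_diff hyp hφ (hαb n) hc (hα n).2.le hg).differentiableOn) isOpen_univ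
  rw [tendstoLocallyUniformlyOn_iff_forall_isCompact isOpen_univ]
  intro K _ hK
  obtain ⟨R, hR0, hR⟩ := hK.isBounded.subset_closedBall_lt 0 0
  obtain ⟨C, hC⟩ := nrm2_bdd hyp hφ hc R hR0
  rw [Metric.tendstoUniformlyOn_iff]
  intro ε hε
  have h3 : Tendsto (fun n => Real.sqrt C * Real.sqrt (∫ x in Ioo a (α n), ‖g x‖ ^ 2)) atTop (𝓝 (Real.sqrt C * Real.sqrt 0)) :=
    ((Real.continuous_sqrt.tendsto 0).comp htail).const_mul _
  rw [Real.sqrt_zero, mul_zero] at h3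
  filter_upwards [h3.eventually (gt_mem_nhds hε)] with n hn z hz
  have hle : volume.restrict (Ioo a (α n)) ≤ volume.restrict (Ioo a c) :=
    Measure.restrict_mono (Ioo_subset_Ioo_right (hα n).2.le) le_rfl
  have hpsi := psi_memLp hyp hφ z hc
  have hint : IntegrableOn (fun x => psi r φ z x * g x) (Ioo a c) := hpsi.integrable_mul hg
  rw [dist_eq_norm, hat, split_int (hα n).1 (hα n).2.le hint, add_sub_cancel_right]
  refine lt_of_le_of_lt ((cs (hpsi.mono_measure hle) (hg.mono_measure hle)).trans ?_) hn
  refine mul_le_mul_of_nonneg_right (Real.sqrt_le_sqrt ?_) (Real.sqrt_nonneg _)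
  refine le_trans ?_ (hC z (by simpa using hR hz))
  exact setIntegral_mono_set (sq_integrable hpsi) (Eventually.of_forall fun x => by positivity)
    (Ioo_subset_Ioo_right (hα n).2.le).eventuallyLE

end DBC

namespace DBC

theorem liouville_im {h : ℂ → ℂ} (hd : Differentiable ℂ h) {C : ℝ} (hC : ∀ z, ‖h z‖ * |z.im| ≤ C) (z0 : ℂ) :
    h z0 = 0 := by
  have hC0 : 0 ≤ C := le_trans (by positivity) (hC 0)
  have key : ∀ R : ℝ, ‖z0‖ < R → ‖h z0‖ * ‖z0 ^ 2 - (R : ℂ) ^ 2‖ ≤ 2 * R * C := by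
    intro R hR
    have hR0 : 0 < R := (norm_nonneg _).trans_lt hR
    have hk : DiffContOnCl ℂ (fun z => h z * (z ^ 2 - (R : ℂ) ^ 2)) (Metric.ball 0 R) :=
      (hd.mul ((differentiable_pow 2).sub_const _)).diffContOnCl
    have := Complex.norm_le_of_forall_mem_frontier_norm_le Metric.isBounded_ball hk (C := 2 * R * C) (z := z0)
      (fun z hz => ?_) (subset_closure (by simpa using hR))
    · simpa using this
    · rw [frontier_ball _ hR0.ne'] at hz
      have hz' : ‖z‖ = R := by simpa using hz
      have e : z ^ 2 - (R : ℂ) ^ 2 = z * (z - conj z) := by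
        have : z * conj z = (R : ℂ) ^ 2 := by rw [mul_conj, normSq_eq_norm_sq, hz']; push_cast; ring
        rw [← this]; ring
      rw [norm_mul, e, norm_mul, hz', sub_conj]
      have : ‖((2 * z.im : ℝ) : ℂ) * I‖ = 2 * |z.im| := by simp [abs_mul]
      push_cast at this
      push_cast
      rw [this]
      have := mul_le_mul_of_nonneg_left (hC z) (by positivity : 0 ≤ 2 * R)
      nlinarith
  by_contra hne
  have hpos : 0 < ‖h z0‖ := norm_pos_iff.2 hne
  -- pick R large
  obtain ⟨R, hR1, hR2⟩ : ∃ R : ℝ, 2 * ‖z0‖ + 1 < R ∧ 4 * C / ‖h z0‖ < R := by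
    refine ⟨max (2 * ‖z0‖ + 1) (4 * C / ‖h z0‖) + 1, ?_, ?_⟩
    · linarith [le_max_left (2 * ‖z0‖ + 1) (4 * C / ‖h z0‖)]
    · linarith [le_max_right (2 * ‖z0‖ + 1) (4 * C / ‖h z0‖)]
  have hn := norm_nonneg z0
  have h1 := key R (by linarith)
  have h2 : R ^ 2 / 2 ≤ ‖z0 ^ 2 - (R : ℂ) ^ 2‖ := by
    have : ‖(R : ℂ) ^ 2‖ - ‖z0 ^ 2‖ ≤ ‖z0 ^ 2 - (R : ℂ) ^ 2‖ := by rw [norm_sub_rev]; exact norm_sub_norm_le _ _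
    rw [norm_pow, norm_pow, norm_real, Real.norm_of_nonneg (by linarith)] at this
    nlinarith
  have h3 : ‖h z0‖ * (R ^ 2 / 2) ≤ 2 * R * C := (mul_le_mul_of_nonneg_left h2 hpos.le).trans h1
  rw [div_lt_iff₀ hpos] at hR2
  nlinarith

variable {a b : ℝ} {p q r s : ℝ → ℝ} {φ φq : ℂ → ℝ → ℂ}

theorem r_sqrt (x : ℝ) (y : ℂ) : (x : ℂ) * (y / (Real.sqrt x : ℂ)) = (Real.sqrt x : ℂ) * y := by
  rcases le_or_gt x 0 with h | h
  · simp [Real.sqrt_eq_zero'.2 h]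
  · have h1 : (Real.sqrt x : ℂ) ≠ 0 := by exact_mod_cast (Real.sqrt_pos.2 h).ne'
    have h2 : (x : ℂ) = (Real.sqrt x : ℂ) * (Real.sqrt x : ℂ) := by
      rw [← ofReal_mul, Real.mul_self_sqrt h.le]
    field_simp
    rw [sq, ← h2]; ring

theorem pluecker (A B C D : ℂ) : ‖C * B - D * A‖ ^ 2 - ‖C * conj B - D * conj A‖ ^ 2
    = -4 * (C * conj D).im * (A * conj B).im := by
  simp only [← normSq_eq_norm_sq, normSq_apply]
  simp
  ring

/-- Energy estimate. -/
theorem energy (hyp : SLHyp a b p q r s) (hφ : RealEntireSolFam a b p q r s φ φq) {α c : ℝ}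
    (hα : α ∈ Ioo a b) (hc : c ∈ Ioo a b) (hac : α < c) {g : ℝ → ℂ} (hg : MemLp g 2 (volume.restrict (Ioo a c)))
    (hz0 : ∀ z, hat a r φ c g z = 0) (z : ℂ) {u u1 : ℝ → ℂ} (hu : Continuous u)
    (h1 : ACOn c α u (fun x => u1 x / (p x : ℂ) - (s x : ℂ) * u x))
    (h2 : ACOn c α u1 (fun x => (s x : ℂ) * u1 x + (q x : ℂ) * u x
        - (r x : ℂ) * (z * u x + g x / (Real.sqrt (r x) : ℂ)))) (h3 : u c = 0) (h4 : u1 c = 0) :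
    z.im ^ 2 * ∫ x in Ioc α c, ‖(Real.sqrt (r x) : ℂ) * u x‖ ^ 2 ≤
      (1 / 4) * (∫ x in Ioo a c, ‖g x‖ ^ 2) + |z.im| * (Real.sqrt (∫ x in Ioo a c, ‖g x‖ ^ 2) *
        Real.sqrt (∫ x in Ioc α c, ‖(Real.sqrt (r x) : ℂ) * u x‖ ^ 2)) := by
  set v : ℝ → ℂ := fun x => (Real.sqrt (r x) : ℂ) * u x with hv
  set G := ∫ x in Ioo a c, ‖g x‖ ^ 2 with hG
  have hrpos : ∀ᵐ t ∂(volume.restrict (Ioc α c)), 0 < r t :=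
    ae_mono (Measure.restrict_mono (fun t ht => ⟨hα.1.trans ht.1, ht.2.trans_lt hc.2⟩ : Ioc α c ⊆ Ioo a b) le_rfl) hyp.rpos
  have hG0 : 0 ≤ G := integral_nonneg fun x => by positivity
  have hgm : MemLp g 2 (volume.restrict (Ioc α c)) := hg.mono_measure (restrict_Ioc_le hα.1.le)
  have hvm : MemLp v 2 (volume.restrict (Ioc α c)) := by
    obtain ⟨M, hM⟩ := isCompact_Icc.exists_bound_of_continuousOn (hu.continuousOn (s := Icc α c))
    refine ((sqrt_memLp hyp hα hc hac.le).const_mul (M : ℂ)).mono ?_ ?_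
    · exact (sqrt_memLp hyp hα hc hac.le).1.mul hu.aestronglyMeasurable
    · rw [ae_restrict_iff' measurableSet_Ioc]
      refine Eventually.of_forall fun t ht => ?_
      simp only [hv]
      rw [norm_mul, norm_mul, mul_comm, norm_real]
      exact mul_le_mul_of_nonneg_right ((hM t (Ioc_subset_Icc_self ht)).trans (by rw [norm_real]; exact le_abs_self M)) (norm_nonneg _)
  -- W(φ_z,u)
  have hφ1 := ACOn.of_has (hφ.sol z).fst hα hc
  have hφ2 := ACOn.of_has (hφ.sol z).snd hα hc
  have w1 := (wr_acon h1 h2 hφ1 hφ2).end_eq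
  have hint : IntegrableOn (fun x => psi r φ z x * g x) (Ioo a c) := (psi_memLp hyp hφ z hc).integrable_mul hg
  have w1' : Wr u u1 (φ z) (φq z) α = ∫ x in Ioo a α, psi r φ z x * g x := by
    have e1 := split_int hα.1 hac.le hint
    have e0 := hz0 z
    rw [hat] at e0
    rw [e0] at e1
    have : Wr u u1 (φ z) (φq z) c = 0 := by simp [Wr, h3, h4]
    rw [this, sub_zero] at w1
    rw [w1, intervalIntegral.integral_symm]
    have e2 : ∫ t in α..c, (r t : ℂ) * ((z * u t + g t / (Real.sqrt (r t) : ℂ)) * φ z t - u t * (z * φ z t)) =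
      ∫ x in α..c, psi r φ z x * g x := by
      refine intervalIntegral.integral_congr fun t _ => ?_
      have := r_sqrt (r t) (g t)
      simp only [psi]
      linear_combination φ z t * this
    rw [e2]
    linear_combination e1
  have w1n : ‖Wr u u1 (φ z) (φq z) α‖ ^ 2 ≤ nrm2 a r φ α z * G := by
    have hle : volume.restrict (Ioo a α) ≤ volume.restrict (Ioo a c) :=
      Measure.restrict_mono (Ioo_subset_Ioo_right hac.le) le_rfl
    have e := cs (psi_memLp hyp hφ z hα) (hg.mono_measure hle)
    rw [← w1'] at e
    have e2 : ∫ x in Ioo a α, ‖g x‖ ^ 2 ≤ G :=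
      setIntegral_mono_set (sq_integrable hg) (Eventually.of_forall fun x => by positivity)
        (Ioo_subset_Ioo_right hac.le).eventuallyLE
    have e3 := pow_le_pow_left₀ (norm_nonneg _) e 2
    rw [mul_pow, Real.sq_sqrt (integral_nonneg fun x => by positivity),
      Real.sq_sqrt (integral_nonneg fun x => by positivity)] at e3
    exact e3.trans (mul_le_mul_of_nonneg_left e2 (nrm2_pos hyp hφ z hα).le)
  -- W(u, ū)
  have hc1 : ACOn c α (fun x => conj (u x)) (fun x => conj (u1 x) / (p x : ℂ) - (s x : ℂ) * conj (u x)) :=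
    h1.conj.congr' (Eventually.of_forall fun t _ => by simp)
  have hc2 : ACOn c α (fun x => conj (u1 x)) (fun x => (s x : ℂ) * conj (u1 x) + (q x : ℂ) * conj (u x)
        - (r x : ℂ) * conj (z * u x + g x / (Real.sqrt (r x) : ℂ))) :=
    h2.conj.congr' (Eventually.of_forall fun t _ => by simp)
  have w2 := (wr_acon h1 h2 hc1 hc2).end_eq
  have w2a : Wr u u1 (fun x => conj (u x)) (fun x => conj (u1 x)) c = 0 := by simp [Wr, h3, h4]
  have w2b : Wr u u1 (fun x => conj (u x)) (fun x => conj (u1 x)) α = 2 * I * ((u α * conj (u1 α)).im : ℂ) := by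
    simp only [Wr]
    apply Complex.ext <;> simp <;> ring
  have hvv : Integrable (fun x => v x * conj (v x)) (volume.restrict (Ioc α c)) := hvm.integrable_mul hvm.star
  have hgv : Integrable (fun x => g x * conj (v x)) (volume.restrict (Ioc α c)) := hgm.integrable_mul hvm.star
  have w2c : (u α * conj (u1 α)).im = -(z.im * (∫ x in Ioc α c, ‖v x‖ ^ 2) + (∫ x in Ioc α c, g x * conj (v x)).im) := by
    rw [w2a, sub_zero, w2b, intervalIntegral.integral_symm, intervalIntegral.integral_of_le hac.le] at w2
    have e : ∫ x in Ioc α c, (r x : ℂ) * ((z * u x + g x / (Real.sqrt (r x) : ℂ)) * conj (u x) - u x * conj (z * u x + g x / (Real.sqrt (r x) : ℂ)))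
       = (z - conj z) * (∫ x in Ioc α c, v x * conj (v x)) + (∫ x in Ioc α c, g x * conj (v x)) - conj (∫ x in Ioc α c, g x * conj (v x)) := by
      have hcj : Integrable (fun x => conj (g x * conj (v x))) (volume.restrict (Ioc α c)) :=
        (Complex.conjLIE.toContinuousLinearEquiv : ℂ →L[ℝ] ℂ).integrable_comp hgv
      have hadd : Integrable (fun x => (z - conj z) * (v x * conj (v x)) + g x * conj (v x)) (volume.restrict (Ioc α c)) :=
        (hvv.const_mul _).add hgv
      rw [← integral_conj, ← integral_const_mul, ← integral_add (hvv.const_mul _) hgv, ← integral_sub hadd hcj]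
      refine integral_congr_ae ?_
      filter_upwards [hrpos] with t ht
      have e1 := r_sqrt (r t) (g t)
      have e2 : (r t : ℂ) = (Real.sqrt (r t) : ℂ) * (Real.sqrt (r t) : ℂ) := by
        rw [← ofReal_mul, Real.mul_self_sqrt ht.le]
      have e3 := congrArg conj e1
      simp only [map_mul, map_div₀, conj_ofReal] at e3
      simp only [hv, map_mul, map_add, map_div₀, conj_ofReal, conj_conj]
      linear_combination conj (u t) * e1 - u t * e3 + (z - conj z) * u t * conj (u t) * e2
    rw [e] at w2
    have e4 : ∫ x in Ioc α c, v x * conj (v x) = ((∫ x in Ioc α c, ‖v x‖ ^ 2 : ℝ) : ℂ) := by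
      rw [← integral_complex_ofReal]
      refine integral_congr_ae (Eventually.of_forall fun t => ?_)
      simp only
      rw [mul_conj, normSq_eq_norm_sq]
    rw [e4] at w2
    generalize (u α * conj (u1 α)).im = ω at w2 ⊢
    generalize (∫ x in Ioc α c, ‖v x‖ ^ 2) = Vn at w2 ⊢
    generalize (∫ x in Ioc α c, g x * conj (v x)) = Y at w2 ⊢
    have e5 := congrArg im w2
    simp at e5
    linarith
  -- φ side
  have hN := lagrange hyp hφ z (conj z) hα
  rw [nrm2_eq hφ z hα] at hN
  have hN' : (φ z α * conj (φq z α)).im = z.im * nrm2 a r φ α z := by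
    have e : Wr (φ z) (φq z) (φ (conj z)) (φq (conj z)) α = 2 * I * ((φ z α * conj (φq z α)).im : ℂ) := by
      simp only [Wr, (hφ.real z α hα).1, (hφ.real z α hα).2]
      apply Complex.ext <;> simp <;> ring
    rw [e] at hN
    generalize (φ z α * conj (φq z α)).im = ω at hN ⊢
    generalize nrm2 a r φ α z = Vn at hN ⊢
    have e5 := congrArg im hN
    simp at e5
    linarith
  have hpl := pluecker (φ z α) (φq z α) (u α) (u1 α)
  rw [hN', w2c] at hpl
  have hpos := nrm2_pos hyp hφ z hα
  have hW : ‖u α * φq z α - u1 α * φ z α‖ ^ 2 ≤ nrm2 a r φ α z * G := w1n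
  set Vn := ∫ x in Ioc α c, ‖v x‖ ^ 2 with hVn
  set Y := (∫ x in Ioc α c, g x * conj (v x)) with hY
  have h5 : 4 * (z.im * Vn + Y.im) * (z.im * nrm2 a r φ α z) ≤ nrm2 a r φ α z * G := by
    have : 0 ≤ ‖u α * conj (φq z α) - u1 α * conj (φ z α)‖ ^ 2 := by positivity
    nlinarith
  have h6 : 4 * (z.im * Vn + Y.im) * z.im ≤ G := by
    refine le_of_mul_le_mul_left ?_ hpos
    linarith
  have h7 : |Y.im| ≤ Real.sqrt G * Real.sqrt Vn := by
    refine (abs_im_le_norm _).trans ?_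
    have e := cs hgm hvm.star
    simp only [Pi.star_apply, norm_star] at e
    refine e.trans ?_
    gcongr
    have := integral_mono_measure (restrict_Ioc_le (c := c) hα.1.le) (Eventually.of_forall fun x => by positivity) (sq_integrable hg)
    exact this
  have h8 : -(|z.im| * |Y.im|) ≤ Y.im * z.im := by
    rw [← abs_mul, mul_comm z.im]; exact neg_abs_le _
  have h9 := mul_le_mul_of_nonneg_left h7 (abs_nonneg z.im)
  nlinarith

theorem hat_inj (hyp : SLHyp a b p q r s) (hφ : RealEntireSolFam a b p q r s φ φq) {c : ℝ}
    (hc : c ∈ Ioo a b) {g : ℝ → ℂ} (hg : MemLp g 2 (volume.restrict (Ioo a c)))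
    (hz0 : ∀ z, hat a r φ c g z = 0) : g =ᵐ[volume.restrict (Ioo a c)] 0 := by
  have step : ∀ α ∈ Ioo a c, ∀ᵐ t, t ∈ Icc α c → g t = 0 := by
    intro α hα'
    have hα : α ∈ Ioo a b := ⟨hα'.1, hα'.2.trans hc.2⟩
    have hac := hα'.2
    have hrf : IntervalIntegrable (fun t => (r t : ℂ) * (g t / (Real.sqrt (r t) : ℂ))) volume α c := by
      simp_rw [r_sqrt]; exact sqrt_mul_int hyp hα hc hac.le hg
    obtain ⟨U, hUd, hU⟩ := exists_sol hyp hα hc hac.le _ hrf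
    choose u1 h1 h2 h3 h4 using hU
    set G := ∫ x in Ioo a c, ‖g x‖ ^ 2
    set v : ℂ → ℝ → ℂ := fun z x => (Real.sqrt (r x) : ℂ) * IccExtend hac.le (U z) x with hv
    have hucont : ∀ z, Continuous (IccExtend hac.le (U z)) := fun z => (U z).continuous.Icc_extend'
    have hvm : ∀ z, MemLp (v z) 2 (volume.restrict (Ioc α c)) := by
      intro z
      obtain ⟨M, hM⟩ := isCompact_Icc.exists_bound_of_continuousOn ((hucont z).continuousOn (s := Icc α c))
      refine ((sqrt_memLp hyp hα hc hac.le).const_mul (M : ℂ)).mono ?_ ?_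
      · exact (sqrt_memLp hyp hα hc hac.le).1.mul (hucont z).aestronglyMeasurable
      · rw [ae_restrict_iff' measurableSet_Ioc]
        refine Eventually.of_forall fun t ht => ?_
        simp only [hv]
        rw [norm_mul, norm_mul, mul_comm, norm_real]
        exact mul_le_mul_of_nonneg_right ((hM t (Ioc_subset_Icc_self ht)).trans (by rw [norm_real]; exact le_abs_self M)) (norm_nonneg _)
    have hb : ∀ z : ℂ, |z.im| * Real.sqrt (∫ x in Ioc α c, ‖v z x‖ ^ 2) ≤ 2 * Real.sqrt G := by
      intro z
      have e := energy hyp hφ hα hc hac hg hz0 z (hucont z) (h1 z) (h2 z) (h3 z) (h4 z)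
      have hV0 : 0 ≤ ∫ x in Ioc α c, ‖v z x‖ ^ 2 := integral_nonneg fun x => by positivity
      have hG0 : 0 ≤ G := integral_nonneg fun x => by positivity
      have s1 := Real.sq_sqrt hV0
      have s2 := Real.sq_sqrt hG0
      have a1 := Real.sqrt_nonneg (∫ x in Ioc α c, ‖v z x‖ ^ 2)
      have a2 := Real.sqrt_nonneg G
      have a3 := abs_nonneg z.im
      have a4 := sq_abs z.im
      change z.im ^ 2 * (∫ x in Ioc α c, ‖v z x‖ ^ 2) ≤ (1 / 4) * G + |z.im| * (Real.sqrt G * Real.sqrt (∫ x in Ioc α c, ‖v z x‖ ^ 2)) at e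
      set V := Real.sqrt (∫ x in Ioc α c, ‖v z x‖ ^ 2)
      set g' := Real.sqrt G
      rw [← s1, ← s2, ← a4] at e
      by_contra! hlt
      have : 0 ≤ |z.im| * V := by positivity
      nlinarith
    -- the entire function
    let k : ℝ → ℂ := fun x => (Real.sqrt (r x) : ℂ) * conj (v I x)
    have hk : IntervalIntegrable k volume α c := by
      rw [intervalIntegrable_iff_integrableOn_Ioc_of_le hac.le]
      exact (sqrt_memLp hyp hα hc hac.le).integrable_mul (hvm I).star
    let L := J hac.le ⟨α, le_rfl, hac.le⟩ k hk
    let H : ℂ → ℂ := fun z => L (U z) ⟨c, hac.le, le_rfl⟩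
    have hHd : Differentiable ℂ H := by
      have h3 : Differentiable ℂ fun z => L (U z) := L.differentiable.comp hUd
      exact (ContinuousMap.evalCLM ℂ (⟨c, hac.le, le_rfl⟩ : Icc α c) : C(Icc α c, ℂ) →L[ℂ] ℂ).differentiable.comp h3
    have hH : ∀ z, H z = ∫ x in Ioc α c, v z x * conj (v I x) := by
      intro z
      simp only [H, L, J_apply]
      rw [intervalIntegral.integral_of_le hac.le]
      refine integral_congr_ae (Eventually.of_forall fun t => ?_)
      simp only [k, hv]; ring
    have hH0 : ∀ z, H z = 0 := by
      refine liouville_im hHd (C := 2 * Real.sqrt G * Real.sqrt (∫ x in Ioc α c, ‖v I x‖ ^ 2)) fun z => ?_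
      rw [hH z]
      have e := cs (hvm z) (hvm I).star
      simp only [Pi.star_apply, norm_star] at e
      have := hb z
      have a1 := Real.sqrt_nonneg (∫ x in Ioc α c, ‖v I x‖ ^ 2)
      calc _ ≤ (Real.sqrt (∫ x in Ioc α c, ‖v z x‖ ^ 2) * Real.sqrt (∫ x in Ioc α c, ‖v I x‖ ^ 2)) * |z.im| :=
            mul_le_mul_of_nonneg_right e (abs_nonneg _)
        _ = (|z.im| * Real.sqrt (∫ x in Ioc α c, ‖v z x‖ ^ 2)) * Real.sqrt (∫ x in Ioc α c, ‖v I x‖ ^ 2) := by ring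
        _ ≤ _ := mul_le_mul_of_nonneg_right this a1
    have hvI : ∫ x in Ioc α c, ‖v I x‖ ^ 2 = 0 := by
      have e := hH0 I
      rw [hH I] at e
      have e4 : ∫ x in Ioc α c, v I x * conj (v I x) = ((∫ x in Ioc α c, ‖v I x‖ ^ 2 : ℝ) : ℂ) := by
        rw [← integral_complex_ofReal]
        refine integral_congr_ae (Eventually.of_forall fun t => ?_)
        simp only
        rw [mul_conj, normSq_eq_norm_sq]
      rw [e4] at e
      exact_mod_cast e
    have h5 := (integral_eq_zero_iff_of_nonneg (fun x => by positivity) (sq_integrable (hvm I))).1 hvI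
    have hrpos : ∀ᵐ t ∂(volume.restrict (Ioc α c)), 0 < r t :=
      ae_mono (Measure.restrict_mono (fun t ht => ⟨hα.1.trans ht.1, ht.2.trans_lt hc.2⟩ : Ioc α c ⊆ Ioo a b) le_rfl) hyp.rpos
    have h6 : IccExtend hac.le (U I) =ᵐ[volume.restrict (Icc α c)] fun _ => 0 := by
      rw [← Measure.restrict_congr_set (Ioc_ae_eq_Icc (a := α) (b := c))]
      filter_upwards [h5, hrpos] with t h5 hr
      simp only [hv, Pi.zero_apply, ne_eq, OfNat.ofNat_ne_zero, not_false_eq_true, pow_eq_zero_iff, norm_eq_zero,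
        mul_eq_zero, ofReal_eq_zero] at h5
      exact h5.resolve_left (Real.sqrt_pos.2 hr).ne'
    have h7 := Measure.eqOn_Icc_of_ae_eq volume hac.ne h6 (hucont I).continuousOn continuousOn_const
    have hcI : uIcc c α = Icc α c := uIcc_of_ge hac.le
    have h8 := ae_zero_of_prim (h1 I).int (fun t ht => by
      have := (h1 I).eq t ht
      rw [hcI] at ht
      rw [h7 ht, h3 I, zero_add] at this
      exact this.symm)
    have hp := hyp.pne
    rw [ae_restrict_iff' measurableSet_Ioo] at hp
    have hsub : Icc α c ⊆ Ioo a b := fun t ht => ⟨hα.1.trans_le ht.1, ht.2.trans_lt hc.2⟩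
    have h9 : u1 I =ᵐ[volume.restrict (Icc α c)] fun _ => 0 := by
      rw [EventuallyEq, ae_restrict_iff' measurableSet_Icc]
      filter_upwards [h8, hp] with t h8 hp ht
      have e := h8 (by rwa [hcI])
      rw [h7 ht, mul_zero, sub_zero, div_eq_zero_iff] at e
      refine e.resolve_right ?_
      exact_mod_cast hp (hsub ht)
    have hc1 := (h2 I).cont
    rw [hcI] at hc1
    have h10 := Measure.eqOn_Icc_of_ae_eq volume hac.ne h9 hc1 continuousOn_const
    have h11 := ae_zero_of_prim (h2 I).int (fun t ht => by
      have := (h2 I).eq t ht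
      rw [hcI] at ht
      rw [h10 ht, h4 I, zero_add] at this
      exact this.symm)
    have hr := hyp.rpos
    rw [ae_restrict_iff' measurableSet_Ioo] at hr
    filter_upwards [h11, hr] with t h11 hr ht
    have e := h11 (by rwa [hcI])
    rw [h7 ht, h10 ht] at e
    simp only [mul_zero, zero_add, zero_sub, neg_eq_zero] at e
    rw [r_sqrt, mul_eq_zero] at e
    refine e.resolve_left ?_
    exact_mod_cast (Real.sqrt_pos.2 (hr (hsub ht))).ne'
  obtain ⟨α, -, hα, hlim⟩ := exists_seq_strictAnti_tendsto' hc.1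
  have h := ae_all_iff.2 fun n => step (α n) (hα n)
  rw [EventuallyEq, ae_restrict_iff' measurableSet_Ioo]
  filter_upwards [h] with t h ht
  obtain ⟨n, hn⟩ := (hlim.eventually (gt_mem_nhds ht.1)).exists
  exact h n ⟨hn.le, ht.2.le⟩

end DBC

namespace DBC

/-- closed upper half plane -/
def CUHP : Set ℂ := {z : ℂ | 0 ≤ z.im}

theorem UHP_open : IsOpen UHP := isOpen_lt continuous_const continuous_im
theorem UHP_sub : UHP ⊆ CUHP := fun z (hz : 0 < z.im) => (show 0 ≤ z.im from hz.le)

/-- exponent of the multiplier -/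
def mExp (C R : ℝ) (z : ℂ) : ℂ :=
  -(3 * C * R ^ 2 : ℝ) * I * (1 / (z - R) + 1 / (z + R)) + 3 * C * I * z

theorem mExp_re (C R : ℝ) (z : ℂ) : (mExp C R z).re =
    -(3 * C * R ^ 2) * (z.im / normSq (z - R) + z.im / normSq (z + R)) - 3 * C * z.im := by
  rw [mExp]
  generalize 3 * C * R ^ 2 = k
  simp [inv_im, inv_re]
  ring

theorem mExp_re_real (C R t : ℝ) : (mExp C R t).re = 0 := by
  rw [mExp_re]; simp

theorem mExp_re_nonpos {C R : ℝ} (hC : 0 ≤ C) {z : ℂ} (hz : 0 ≤ z.im) : (mExp C R z).re ≤ 0 := by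
  rw [mExp_re]
  have h1 : 0 ≤ z.im / normSq (z - R) := div_nonneg hz (normSq_nonneg _)
  have h2 : 0 ≤ z.im / normSq (z + R) := div_nonneg hz (normSq_nonneg _)
  have : 0 ≤ (3 * C * R ^ 2) * (z.im / normSq (z - R) + z.im / normSq (z + R)) := by positivity
  have : 0 ≤ 3 * C * z.im := by positivity
  linarith

theorem mExp_side {C R : ℝ} (hC : 0 ≤ C) (hR : 1 ≤ R) {z : ℂ} (hz : 0 < z.im) (hx : z.re = R ∨ z.re = -R) :
    (mExp C R z).re + C * (1 + ‖z‖ ^ 2) / z.im ≤ 0 := by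
  rw [mExp_re, ← normSq_eq_norm_sq, normSq_apply z]
  have key : ∀ s : ℝ, z.re = s → 1 ≤ s ^ 2 → (-(3 * C * s ^ 2) * (z.im / normSq (z - s)) - 3 * C * z.im) + C * (1 + (z.re * z.re + z.im * z.im)) / z.im ≤ 0 := by
    intro s hs hs1
    have e : normSq (z - s) = z.im * z.im := by rw [normSq_apply]; simp [hs]
    rw [e, hs]
    have : (-(3 * C * s ^ 2) * (z.im / (z.im * z.im)) - 3 * C * z.im) + C * (1 + (s * s + z.im * z.im)) / z.im
      = C * (1 - 2 * s ^ 2 - 2 * z.im ^ 2) / z.im := by field_simp; ring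
    rw [this]
    apply div_nonpos_of_nonpos_of_nonneg _ hz.le
    apply mul_nonpos_of_nonneg_of_nonpos hC
    nlinarith [sq_nonneg z.im]
  have h1 : 0 ≤ z.im / normSq (z - R) := div_nonneg hz.le (normSq_nonneg _)
  have h2 : 0 ≤ z.im / normSq (z + R) := div_nonneg hz.le (normSq_nonneg _)
  have h3 : 0 ≤ 3 * C * R ^ 2 := by positivity
  have h4 := mul_nonneg h3 h1
  have h5 := mul_nonneg h3 h2
  rcases hx with hx | hx
  · have := key R hx (by nlinarith)
    linarith
  · have := key (-R) hx (by nlinarith)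
    push_cast at this
    rw [sub_neg_eq_add, neg_sq] at this
    linarith

theorem mExp_top {C R : ℝ} (hC : 0 ≤ C) (hR : 1 ≤ R) {z : ℂ} (hz : z.im = R) (hx : |z.re| ≤ R) :
    (mExp C R z).re + C * (1 + ‖z‖ ^ 2) / z.im ≤ 0 := by
  rw [mExp_re, ← normSq_eq_norm_sq, normSq_apply z]
  have hp : 0 < z.im := by linarith
  have h1 : 0 ≤ z.im / normSq (z - R) := div_nonneg hp.le (normSq_nonneg _)
  have h2 : 0 ≤ z.im / normSq (z + R) := div_nonneg hp.le (normSq_nonneg _)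
  have h3 : 0 ≤ 3 * C * R ^ 2 := by positivity
  have h4 := mul_nonneg h3 h1
  have h5 := mul_nonneg h3 h2
  have h6 : C * (1 + (z.re * z.re + z.im * z.im)) / z.im ≤ 3 * C * z.im := by
    rw [div_le_iff₀ hp, mul_assoc, mul_assoc, mul_comm 3, mul_assoc]
    apply mul_le_mul_of_nonneg_left _ hC
    rw [hz]
    have := abs_le.1 hx
    nlinarith
  linarith

theorem mExp_diffAt {C R : ℝ} {z : ℂ} (h1 : z ≠ R) (h2 : z ≠ -R) : DifferentiableAt ℂ (mExp C R) z := by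
  have h1' : z - R ≠ 0 := sub_ne_zero.2 h1
  have h2' : z + R ≠ 0 := by rwa [← sub_neg_eq_add, sub_ne_zero]
  unfold mExp
  fun_prop (disch := assumption)

theorem mExp_tendsto (C t : ℝ) : Tendsto (fun n : ℕ => mExp C n t) atTop (𝓝 (9 * C * I * t)) := by
  have hev : ∀ᶠ n : ℕ in atTop, mExp C n t = -(6 * C) * I * t * (1 / ((t : ℂ) ^ 2 * (1 / (n : ℂ)) ^ 2 - 1)) + 3 * C * I * t := by
    obtain ⟨N, hN⟩ := exists_nat_gt |t|
    filter_upwards [eventually_ge_atTop (N + 1)] with n hn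
    have hn' : |t| < n := hN.trans (by exact_mod_cast hn)
    have hn0 : (n : ℂ) ≠ 0 := by exact_mod_cast (show n ≠ 0 by omega)
    have hlt := abs_lt.1 hn'
    have e1 : (t : ℂ) - n ≠ 0 := by
      rw [sub_ne_zero]; exact_mod_cast hlt.2.ne
    have e2 : (t : ℂ) + n ≠ 0 := by
      have : t + n ≠ 0 := by linarith
      exact_mod_cast this
    have e3 : (t : ℂ) ^ 2 * (1 / (n : ℂ)) ^ 2 - 1 ≠ 0 := by
      have : (t : ℂ) ^ 2 * (1 / (n : ℂ)) ^ 2 - 1 = (t - n) * (t + n) / n ^ 2 := by field_simp; ring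
      rw [this]; positivity
    have e4 : (t : ℂ) ^ 2 - n ^ 2 ≠ 0 := by
      have : (t : ℂ) ^ 2 - n ^ 2 = (t - n) * (t + n) := by ring
      rw [this]; positivity
    have : (t : ℂ) ^ 2 * (1 / (n : ℂ)) ^ 2 - 1 = (t ^ 2 - n ^ 2) / n ^ 2 := by field_simp
    rw [this]
    simp only [mExp]
    push_cast
    field_simp
    ring
  refine Tendsto.congr' (hev.mono fun n h => h.symm) ?_
  have h0 : Tendsto (fun n : ℕ => (1 / (n : ℂ))) atTop (𝓝 0) := tendsto_one_div_atTop_nhds_zero_nat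
  have h1 : Tendsto (fun n : ℕ => (t : ℂ) ^ 2 * (1 / (n : ℂ)) ^ 2 - 1) atTop (𝓝 ((t : ℂ) ^ 2 * 0 ^ 2 - 1)) :=
    ((h0.pow 2).const_mul _).sub_const _
  have h2 := ((h1.inv₀ (by simp)).const_mul (-(6 * C) * I * t)).add_const (3 * C * I * t)
  simp only [one_div] at *
  convert h2 using 2
  ring_nf

/-- the rectangle estimate -/
theorem rect_est {G : ℂ → ℂ} (hd : DifferentiableOn ℂ G UHP) (hc : ContinuousOn G CUHP) {C K R R0 : ℝ}
    (hC : 0 ≤ C) (hK : 0 ≤ K) (hR : 1 ≤ R) (hR0 : R0 ≤ R)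
    (hb : ∀ z ∈ UHP, R0 ≤ ‖z‖ → ‖G z‖ ≤ K * Real.exp (C * (1 + ‖z‖ ^ 2) / z.im) / (1 + ‖z‖ ^ 2)) :
    ‖∫ x in (-R)..R, G x * cexp (mExp C R x)‖ ≤ 4 * R * (K / (1 + R ^ 2)) := by
  have hR' : 0 < R := by linarith
  set H : ℂ → ℂ := fun z => G z * cexp (mExp C R z) with hH
  set D := K / (1 + R ^ 2) with hD
  have hD0 : 0 ≤ D := by positivity
  have hbd : ∀ z ∈ UHP, R ≤ ‖z‖ → (mExp C R z).re + C * (1 + ‖z‖ ^ 2) / z.im ≤ 0 → ‖H z‖ ≤ D := by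
    intro z hz hzR he
    rw [hH, norm_mul, norm_exp]
    calc _ ≤ (K * Real.exp (C * (1 + ‖z‖ ^ 2) / z.im) / (1 + ‖z‖ ^ 2)) * Real.exp (mExp C R z).re :=
          mul_le_mul_of_nonneg_right (hb z hz (hR0.trans hzR)) (Real.exp_nonneg _)
      _ = K / (1 + ‖z‖ ^ 2) * Real.exp ((mExp C R z).re + C * (1 + ‖z‖ ^ 2) / z.im) := by
          rw [Real.exp_add]; ring
      _ ≤ K / (1 + ‖z‖ ^ 2) * 1 := by
          gcongr
          exact Real.exp_le_one_iff.2 he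
      _ ≤ D := by rw [mul_one, hD]; gcongr
  have hne : ∀ z ∈ UHP, z ≠ R ∧ z ≠ -R := by
    intro z hz
    have hz' : z.im ≠ 0 := ne_of_gt hz
    constructor <;> (rintro rfl; simp at hz')
  have hHd : DifferentiableOn ℂ H UHP := by
    intro z hz
    exact (hd z hz).mul ((mExp_diffAt (hne z hz).1 (hne z hz).2).cexp.differentiableWithinAt)
  have step : ∀ κ ∈ Ioo 0 R, ‖∫ x in (-R)..R, H (x + κ * I)‖ ≤ 4 * R * D := by
    intro κ hκ
    have hrect := Complex.integral_boundary_rect_eq_zero_of_differentiableOn H (-R + κ * I) (R + R * I) ?_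
    · simp at hrect
      have t1 : ‖∫ x in (-R)..R, H (x + R * I)‖ ≤ D * |R - -R| := by
        refine intervalIntegral.norm_integral_le_of_norm_le_const fun x hx => ?_
        rw [uIoc_of_le (by linarith)] at hx
        have hz : (x + R * I : ℂ).im = R := by simp
        refine hbd _ (by simp [UHP]; linarith) ?_ (mExp_top hC hR hz (by simp [abs_le]; exact ⟨hx.1.le, hx.2⟩))
        calc R = |(x + R * I : ℂ).im| := by rw [hz, abs_of_pos hR']
          _ ≤ _ := abs_im_le_norm _
      have tside : ∀ σ : ℝ, (σ = R ∨ σ = -R) → ‖∫ y in κ..R, H (σ + y * I)‖ ≤ D * |R - κ| := by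
        intro σ hσ
        refine intervalIntegral.norm_integral_le_of_norm_le_const fun y hy => ?_
        rw [uIoc_of_le hκ.2.le] at hy
        have hre : (σ + y * I : ℂ).re = σ := by simp
        have him : 0 < (σ + y * I : ℂ).im := by simp; linarith [hy.1, hκ.1]
        refine hbd _ him ?_ (mExp_side hC hR him (by rw [hre]; exact hσ))
        calc R = |(σ + y * I : ℂ).re| := by rw [hre]; rcases hσ with h | h <;> simp [h, abs_of_pos hR']
          _ ≤ _ := abs_re_le_norm _
      have t2 := tside R (Or.inl rfl)
      have t3 := tside (-R) (Or.inr rfl)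
      push_cast at t3
      have e : ∫ x in (-R)..R, H (x + κ * I) = (∫ x in (-R)..R, H (x + R * I)) - I * (∫ y in κ..R, H (R + y * I))
         + I * (∫ y in κ..R, H (-R + y * I)) := by linear_combination hrect
      rw [e]
      have n1 := norm_add_le ((∫ x in (-R)..R, H (x + R * I)) - I * (∫ y in κ..R, H (R + y * I))) (I * (∫ y in κ..R, H (-R + y * I)))
      have n2 := norm_sub_le (∫ x in (-R)..R, H (x + R * I)) (I * (∫ y in κ..R, H (R + y * I)))
      rw [norm_mul, norm_I, one_mul] at n1 n2
      rw [abs_of_pos (by linarith)] at t1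
      rw [abs_of_pos (by linarith [hκ.2])] at t2 t3
      have := mul_nonneg hD0 hκ.1.le
      nlinarith
    · refine hHd.mono fun z hz => ?_
      rw [mem_reProdIm] at hz
      have := hz.2
      simp only [add_im, neg_im, ofReal_im, mul_im, ofReal_re, I_im, I_re] at this
      norm_num at this
      rw [uIcc_of_le hκ.2.le] at this
      exact hκ.1.trans_le this.1
  -- limit
  obtain ⟨M, hM⟩ := (isCompact_Icc.reProdIm (isCompact_Icc (a := (0 : ℝ)) (b := R)) : IsCompact (Icc (-R) R ×ℂ Icc 0 R)).exists_bound_of_continuousOn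
    (hc.mono fun z hz => hz.2.1)
  have hmem : ∀ᶠ κ : ℝ in 𝓝[>] 0, κ ∈ Ioo 0 R := Ioo_mem_nhdsGT hR'
  have hlim : Tendsto (fun κ : ℝ => ∫ x in (-R)..R, H (x + κ * I)) (𝓝[>] 0) (𝓝 (∫ x in (-R)..R, H x)) := by
    refine intervalIntegral.tendsto_integral_filter_of_dominated_convergence (fun _ => M) ?_ ?_ (by simp) ?_
    · filter_upwards [hmem] with κ hκ
      refine Continuous.aestronglyMeasurable ?_
      refine hHd.continuousOn.comp_continuous (by fun_prop) fun x => ?_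
      simp [UHP]; exact hκ.1
    · filter_upwards [hmem] with κ hκ
      refine Eventually.of_forall fun x hx => ?_
      rw [uIoc_of_le (by linarith)] at hx
      have h1 := hM (x + κ * I) (by rw [mem_reProdIm]; simp; exact ⟨⟨hx.1.le, hx.2⟩, hκ.1.le, hκ.2.le⟩)
      rw [hH, norm_mul, norm_exp]
      have h2 : Real.exp (mExp C R (x + κ * I)).re ≤ 1 := Real.exp_le_one_iff.2 (mExp_re_nonpos hC (by simp; exact hκ.1.le))
      calc _ ≤ M * 1 := mul_le_mul h1 h2 (Real.exp_nonneg _) ((norm_nonneg _).trans h1)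
        _ = M := mul_one _
    · have hae : ∀ᵐ x : ℝ, x ≠ R := by simp [ae_iff]
      filter_upwards [hae] with x hxR hx
      rw [uIoc_of_le (by linarith)] at hx
      have hpath : Tendsto (fun κ : ℝ => (x + κ * I : ℂ)) (𝓝[>] 0) (𝓝[CUHP] (x : ℂ)) := by
        refine tendsto_nhdsWithin_iff.2 ⟨?_, ?_⟩
        · have : ContinuousAt (fun κ : ℝ => (x + κ * I : ℂ)) 0 := by fun_prop
          have h := this.tendsto.mono_left (nhdsWithin_le_nhds (s := Ioi 0))
          simpa using h
        · filter_upwards [self_mem_nhdsWithin] with κ hκ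
          simp [CUHP]; exact le_of_lt hκ
      refine Tendsto.comp (g := H) ?_ hpath
      have hcx : ContinuousWithinAt G CUHP x := hc x (by simp [CUHP])
      refine hcx.mul ?_
      refine (mExp_diffAt ?_ ?_).cexp.continuousAt.continuousWithinAt
      · exact_mod_cast hxR
      · exact_mod_cast hx.1.ne'
  refine le_of_tendsto hlim.norm ?_
  filter_upwards [hmem] with κ hκ using step κ hκ

theorem L1 {G : ℂ → ℂ} (hd : DifferentiableOn ℂ G UHP) (hc : ContinuousOn G CUHP) {C K R0 : ℝ}
    (hC : 0 ≤ C) (hK : 0 ≤ K) (hi : Integrable fun t : ℝ => G t)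
    (hb : ∀ z ∈ UHP, R0 ≤ ‖z‖ → ‖G z‖ ≤ K * Real.exp (C * (1 + ‖z‖ ^ 2) / z.im) / (1 + ‖z‖ ^ 2)) :
    ∫ t : ℝ, G t * cexp (9 * C * I * t) = 0 := by
  have hlim : Tendsto (fun n : ℕ => ∫ x : ℝ, (Ioc (-(n : ℝ)) n).indicator (fun x : ℝ => G x * cexp (mExp C n x)) x) atTop
      (𝓝 (∫ t : ℝ, G t * cexp (9 * C * I * t))) := by
    refine tendsto_integral_of_dominated_convergence (fun t => ‖G t‖) ?_ hi.norm ?_ ?_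
    · intro n
      refine AEStronglyMeasurable.indicator (hi.1.mul ?_) measurableSet_Ioc
      refine Measurable.aestronglyMeasurable ?_
      unfold mExp
      fun_prop
    · intro n
      refine Eventually.of_forall fun t => ?_
      refine (norm_indicator_le_norm_self _ _).trans ?_
      rw [norm_mul, norm_exp]
      have := mExp_re_real C n t
      rw [this]; simp
    · refine Eventually.of_forall fun t => ?_
      have h1 := ((mExp_tendsto C t).cexp).const_mul (G t)
      refine h1.congr' ?_
      obtain ⟨N, hN⟩ := exists_nat_gt |t|
      filter_upwards [eventually_ge_atTop N] with n hn
      have hn' : |t| < n := hN.trans_le (by exact_mod_cast hn)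
      have hlt := abs_lt.1 hn'
      rw [indicator_of_mem (show t ∈ Ioc (-(n : ℝ)) n from ⟨hlt.1, hlt.2.le⟩)]
  have hb2 : ∀ᶠ n : ℕ in atTop, ‖∫ x : ℝ, (Ioc (-(n : ℝ)) n).indicator (fun x : ℝ => G x * cexp (mExp C n x)) x‖ ≤ 4 * K * (1 / (n : ℝ)) := by
    obtain ⟨N, hN⟩ := exists_nat_gt R0
    filter_upwards [eventually_ge_atTop (N + 1)] with n hn
    have hn1 : (1 : ℝ) ≤ n := by exact_mod_cast (show 1 ≤ n by omega)
    have hn2 : R0 ≤ n := hN.le.trans (by exact_mod_cast (show N ≤ n by omega))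
    rw [integral_indicator measurableSet_Ioc, ← intervalIntegral.integral_of_le (by linarith)]
    have e := rect_est hd hc hC hK hn1 hn2 hb
    push_cast at e
    refine e.trans ?_
    rw [mul_div_assoc', mul_one_div, div_le_div_iff₀ (by positivity) (by positivity)]
    nlinarith
  have h0 : Tendsto (fun n : ℕ => 4 * K * (1 / (n : ℝ))) atTop (𝓝 (4 * K * 0)) :=
    tendsto_one_div_atTop_nhds_zero_nat.const_mul _
  have := le_of_tendsto_of_tendsto hlim.norm h0 hb2
  rw [mul_zero] at this
  exact norm_le_zero_iff.1 this

theorem L2 {G : ℂ → ℂ} (hd : DifferentiableOn ℂ G UHP) (hc : ContinuousOn G CUHP) {R0 : ℝ}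
    (hi : Integrable fun t : ℝ => G t)
    (hb : ∀ C > 0, ∃ K ≥ 0, ∀ z ∈ UHP, R0 ≤ ‖z‖ → ‖G z‖ ≤ K * Real.exp (C * (1 + ‖z‖ ^ 2) / z.im) / (1 + ‖z‖ ^ 2)) :
    ∫ t : ℝ, G t = 0 := by
  have hlim : Tendsto (fun n : ℕ => ∫ t : ℝ, G t * cexp (9 * ((1 / ((n : ℝ) + 1) : ℝ) : ℂ) * I * t)) atTop
      (𝓝 (∫ t : ℝ, G t)) := by
    refine tendsto_integral_of_dominated_convergence (fun t => ‖G t‖) ?_ hi.norm ?_ ?_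
    · intro n
      refine hi.1.mul (Continuous.aestronglyMeasurable (by fun_prop))
    · intro n
      refine Eventually.of_forall fun t => ?_
      rw [norm_mul, norm_exp]
      simp
    · refine Eventually.of_forall fun t => ?_
      have h0 : Tendsto (fun n : ℕ => ((1 / ((n : ℝ) + 1) : ℝ) : ℂ)) atTop (𝓝 ((0 : ℝ) : ℂ)) :=
        (continuous_ofReal.tendsto _).comp tendsto_one_div_add_atTop_nhds_zero_nat
      have h1 := ((((h0.const_mul 9).mul_const I).mul_const (t : ℂ)).cexp).const_mul (G t)
      simpa using h1
  have h0 : ∀ n : ℕ, ∫ t : ℝ, G t * cexp (9 * ((1 / ((n : ℝ) + 1) : ℝ) : ℂ) * I * t) = 0 := by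
    intro n
    obtain ⟨K, hK, hb⟩ := hb (1 / ((n : ℝ) + 1)) (by positivity)
    exact L1 hd hc (by positivity) hK hi hb
  simp only [h0] at hlim
  exact (tendsto_nhds_unique hlim tendsto_const_nhds)

end DBC

namespace DBC

theorem norm_sub_sq (t : ℝ) (z : ℂ) : ‖(t : ℂ) - z‖ ^ 2 = (t - z.re) ^ 2 + z.im ^ 2 := by
  rw [← normSq_eq_norm_sq, normSq_apply]; simp; ring

theorem pk_eq {z : ℂ} (hz : z.im ≠ 0) (t : ℝ) : 1 / ‖(t : ℂ) - z‖ ^ 2 = (z.im ^ 2)⁻¹ * (1 + ((t - z.re) / z.im) ^ 2)⁻¹ := by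
  rw [norm_sub_sq]
  have : (t - z.re) ^ 2 + z.im ^ 2 ≠ 0 := by positivity
  field_simp
  ring

theorem pk_int {z : ℂ} (hz : z.im ≠ 0) : Integrable fun t : ℝ => 1 / ‖(t : ℂ) - z‖ ^ 2 := by
  simp_rw [pk_eq hz]
  exact ((integrable_inv_one_add_sq.comp_div hz).comp_sub_right z.re).const_mul _

theorem pk_val {z : ℂ} (hz : 0 < z.im) : ∫ t : ℝ, 1 / ‖(t : ℂ) - z‖ ^ 2 = Real.pi / z.im := by
  simp_rw [pk_eq hz.ne']
  rw [integral_const_mul, integral_sub_right_eq_self (fun t : ℝ => (1 + (t / z.im) ^ 2)⁻¹) z.re,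
    Measure.integral_comp_div (fun t : ℝ => (1 + t ^ 2)⁻¹), integral_univ_inv_one_add_sq, abs_of_pos hz, smul_eq_mul]
  field_simp

theorem real_sub_ne {z : ℂ} (hz : z.im ≠ 0) (t : ℝ) : (t : ℂ) - z ≠ 0 := by
  intro h
  have := congrArg im h
  simp at this
  exact hz this

theorem ck_cont {z : ℂ} (hz : z.im ≠ 0) : Continuous fun t : ℝ => 1 / ((t : ℂ) - z) :=
  Continuous.div continuous_const (by fun_prop) (real_sub_ne hz)

theorem ck_memLp {z : ℂ} (hz : z.im ≠ 0) : MemLp (fun t : ℝ => 1 / ((t : ℂ) - z)) 2 := by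
  rw [memLp_two_iff_integrable_sq_norm (ck_cont hz).aestronglyMeasurable]
  simpa using pk_int hz

theorem ppk_eq (t : ℝ) (z : ℂ) : ((t : ℂ) - z) * ((t : ℂ) - conj z) = ((‖(t : ℂ) - z‖ ^ 2 : ℝ) : ℂ) := by
  rw [← normSq_eq_norm_sq, ← mul_conj]; simp

/-- subexponential boundary growth -/
def SB (f : ℂ → ℂ) : Prop := ∀ C > 0, ∃ K ≥ 0, ∀ z ∈ UHP, ‖f z‖ ≤ K * Real.exp (C * (1 + ‖z‖ ^ 2) / z.im)

def CB (C : ℝ) (f : ℂ → ℂ) : Prop := ∃ K ≥ 0, ∀ z ∈ UHP, ‖f z‖ ≤ K * Real.exp (C * (1 + ‖z‖ ^ 2) / z.im)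

theorem one_le_expo {C : ℝ} (hC : 0 ≤ C) {z : ℂ} (hz : z ∈ UHP) : 1 ≤ Real.exp (C * (1 + ‖z‖ ^ 2) / z.im) :=
  Real.one_le_exp (div_nonneg (by positivity) (le_of_lt hz))

/-- difference quotient function -/
def dq (f : ℂ → ℂ) (z0 z : ℂ) : ℂ := dslope f z0 z / (z - conj z0)

theorem dq_diff {f : ℂ → ℂ} (hd : DifferentiableOn ℂ f UHP) {z0 : ℂ} (h0 : z0 ∈ UHP) : DifferentiableOn ℂ (dq f z0) UHP := by
  have h1 := (Complex.differentiableOn_dslope (UHP_open.mem_nhds h0)).2 hd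
  refine h1.div (by fun_prop) fun z hz => ?_
  intro h
  have := congrArg im h
  simp at this
  have a1 : 0 < z.im := hz
  have a2 : 0 < z0.im := h0
  linarith

theorem dq_cont {f : ℂ → ℂ} (hd : DifferentiableOn ℂ f UHP) (hc : ContinuousOn f CUHP) {z0 : ℂ} (h0 : z0 ∈ UHP) :
    ContinuousOn (dq f z0) CUHP := by
  have h1 := (continuousOn_dslope (mem_of_superset (UHP_open.mem_nhds h0) UHP_sub)).2
    ⟨hc, (hd z0 h0).differentiableAt (UHP_open.mem_nhds h0)⟩
  refine h1.div (by fun_prop) fun z hz => ?_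
  intro h
  have := congrArg im h
  simp at this
  have a1 : 0 ≤ z.im := hz
  have a2 : 0 < z0.im := h0
  linarith

theorem dq_ne {f : ℂ → ℂ} {z0 z : ℂ} (h : z ≠ z0) : dq f z0 z = (f z - f z0) / ((z - z0) * (z - conj z0)) := by
  rw [dq, dslope_of_ne _ h, slope_def_field, div_div]

theorem dq_real {f : ℂ → ℂ} {z0 : ℂ} (h0 : z0 ∈ UHP) (t : ℝ) :
    dq f z0 t = f t / ((‖(t : ℂ) - z0‖ ^ 2 : ℝ) : ℂ) - f z0 * ((1 / ‖(t : ℂ) - z0‖ ^ 2 : ℝ) : ℂ) := by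
  rw [dq_ne (sub_ne_zero.1 (real_sub_ne (ne_of_gt h0) t)), ppk_eq, sub_div]
  push_cast
  ring

theorem far_bound {z w : ℂ} (h : 2 * ‖w‖ + 1 ≤ ‖z‖) : ‖z‖ / 2 ≤ ‖z - w‖ := by
  have := norm_sub_norm_le z w
  linarith

theorem far2 {z w w' : ℂ} (h : 2 * ‖w‖ + 1 ≤ ‖z‖) (h' : 2 * ‖w'‖ + 1 ≤ ‖z‖) :
    (1 + ‖z‖ ^ 2) / 8 ≤ ‖(z - w) * (z - w')‖ := by
  rw [norm_mul]
  have h1 := far_bound h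
  have h2 := far_bound h'
  have h3 : 1 ≤ ‖z‖ := by linarith [norm_nonneg w]
  have := mul_le_mul h1 h2 (by positivity) (norm_nonneg _)
  nlinarith

theorem dq_bound {f : ℂ → ℂ} {z0 : ℂ} {C K : ℝ} (hC : 0 ≤ C) (hK : 0 ≤ K)
    (hb : ∀ z ∈ UHP, ‖f z‖ ≤ K * Real.exp (C * (1 + ‖z‖ ^ 2) / z.im)) :
    ∀ z ∈ UHP, 2 * ‖z0‖ + 1 ≤ ‖z‖ → ‖dq f z0 z‖ ≤ (8 * (K + ‖f z0‖)) * Real.exp (C * (1 + ‖z‖ ^ 2) / z.im) / (1 + ‖z‖ ^ 2) := by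
  intro z hz hzz
  have hne : z ≠ z0 := by rintro rfl; linarith [norm_nonneg z]
  rw [dq_ne hne, norm_div]
  have h1 : (1 + ‖z‖ ^ 2) / 8 ≤ ‖(z - z0) * (z - conj z0)‖ := far2 hzz (by rwa [norm_conj])
  have h2 : ‖f z - f z0‖ ≤ (K + ‖f z0‖) * Real.exp (C * (1 + ‖z‖ ^ 2) / z.im) := by
    have e1 := norm_sub_le (f z) (f z0)
    have e2 := hb z hz
    have e3 := one_le_expo hC hz
    nlinarith [norm_nonneg (f z0)]
  calc _ ≤ ((K + ‖f z0‖) * Real.exp (C * (1 + ‖z‖ ^ 2) / z.im)) / ((1 + ‖z‖ ^ 2) / 8) := by gcongr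
    _ = _ := by field_simp

/-- Poisson formula for functions of subexponential growth -/
theorem poisson_SB {f : ℂ → ℂ} (hd : DifferentiableOn ℂ f UHP) (hc : ContinuousOn f CUHP) (hb : SB f) {z0 : ℂ} (h0 : z0 ∈ UHP)
    (hi : Integrable fun t : ℝ => f t / ((‖(t : ℂ) - z0‖ ^ 2 : ℝ) : ℂ)) :
    ∫ t : ℝ, f t / ((‖(t : ℂ) - z0‖ ^ 2 : ℝ) : ℂ) = f z0 * (Real.pi / z0.im : ℝ) := by
  have hp : Integrable fun t : ℝ => f z0 * ((1 / ‖(t : ℂ) - z0‖ ^ 2 : ℝ) : ℂ) := (pk_int (ne_of_gt h0)).ofReal.const_mul _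
  have key : ∫ t : ℝ, dq f z0 t = 0 := by
    refine L2 (dq_diff hd h0) (dq_cont hd hc h0) (R0 := 2 * ‖z0‖ + 1) ?_ ?_
    · simp_rw [dq_real h0]; exact hi.sub hp
    · intro C hC
      obtain ⟨K, hK, hb⟩ := hb C hC
      exact ⟨8 * (K + ‖f z0‖), by positivity, dq_bound hC.le hK hb⟩
  simp_rw [dq_real h0] at key
  rw [integral_sub hi hp, integral_const_mul, integral_complex_ofReal, pk_val h0] at key
  exact sub_eq_zero.1 key

theorem poisson_CB {f : ℂ → ℂ} (hd : DifferentiableOn ℂ f UHP) (hc : ContinuousOn f CUHP) {C : ℝ} (hC : 0 ≤ C) (hb : CB C f) {z0 : ℂ} (h0 : z0 ∈ UHP)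
    (hi : Integrable fun t : ℝ => f t / ((‖(t : ℂ) - z0‖ ^ 2 : ℝ) : ℂ)) :
    ∫ t : ℝ, f t / ((‖(t : ℂ) - z0‖ ^ 2 : ℝ) : ℂ) * cexp (9 * C * I * t) = f z0 * cexp (9 * C * I * z0) * (Real.pi / z0.im : ℝ) := by
  have hpr : Integrable fun t : ℝ => ((1 / ‖(t : ℂ) - z0‖ ^ 2 : ℝ) : ℂ) := (pk_int (ne_of_gt h0)).ofReal
  have hp : Integrable fun t : ℝ => f z0 * ((1 / ‖(t : ℂ) - z0‖ ^ 2 : ℝ) : ℂ) := hpr.const_mul _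
  have hexpn : ∀ t : ℝ, ‖cexp (9 * C * I * t)‖ = 1 := fun t => by rw [norm_exp]; simp
  have hexpm : AEStronglyMeasurable (fun t : ℝ => cexp (9 * C * I * t)) volume := Continuous.aestronglyMeasurable (by fun_prop)
  have hmul : ∀ {k : ℝ → ℂ}, Integrable k → Integrable fun t => k t * cexp (9 * C * I * t) := by
    intro k hk
    refine hk.mul_bdd (c := 1) hexpm (Eventually.of_forall fun t => (hexpn t).le)
  have key : ∫ t : ℝ, dq f z0 t * cexp (9 * C * I * t) = 0 := by
    obtain ⟨K, hK, hb⟩ := hb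
    refine L1 (dq_diff hd h0) (dq_cont hd hc h0) hC (K := 8 * (K + ‖f z0‖)) (by positivity) (R0 := 2 * ‖z0‖ + 1) ?_ (dq_bound hC hK hb)
    simp_rw [dq_real h0]; exact hi.sub hp
  have hE : ∫ t : ℝ, cexp (9 * C * I * t) / ((‖(t : ℂ) - z0‖ ^ 2 : ℝ) : ℂ) = cexp (9 * C * I * z0) * (Real.pi / z0.im : ℝ) := by
    refine poisson_SB (f := fun z => cexp (9 * C * I * z)) (by fun_prop) (by fun_prop) ?_ h0 ?_
    · intro D hD
      refine ⟨1, zero_le_one, fun z hz => ?_⟩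
      rw [one_mul, norm_exp]
      refine le_trans ?_ (one_le_expo hD.le hz)
      apply Real.exp_le_one_iff.2
      have a : 0 ≤ C * z.im := mul_nonneg hC (le_of_lt hz)
      simp
      linarith
    · have := hmul hpr
      refine this.congr (Eventually.of_forall fun t => ?_)
      push_cast; ring
  simp_rw [dq_real h0, sub_mul] at key
  rw [integral_sub (hmul hi) (hmul hp)] at key
  rw [sub_eq_zero.1 key, mul_assoc (f z0), ← hE, ← integral_const_mul]
  refine integral_congr_ae (Eventually.of_forall fun t => ?_)
  push_cast; ring

theorem int_pois {f : ℂ → ℂ} (hm : MemLp (fun t : ℝ => f t) 2) {z0 : ℂ} (h0 : z0.im ≠ 0) :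
    Integrable fun t : ℝ => f t / ((‖(t : ℂ) - z0‖ ^ 2 : ℝ) : ℂ) := by
  have h1 : Integrable fun t : ℝ => f t * (1 / ((t : ℂ) - z0)) := hm.integrable_mul (ck_memLp h0)
  have h2 := h1.mul_bdd (c := |z0.im|⁻¹) (g := fun t : ℝ => 1 / ((t : ℂ) - conj z0)) (ck_cont (by simpa using h0)).aestronglyMeasurable
    (Eventually.of_forall fun t => ?_)
  · refine h2.congr (Eventually.of_forall fun t => ?_)
    beta_reduce
    rw [← ppk_eq]
    have := real_sub_ne h0 t
    have h3 : (t : ℂ) - conj z0 ≠ 0 := real_sub_ne (by simpa using h0) t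
    field_simp
  · rw [norm_div, norm_one, one_div]
    refine inv_anti₀ (abs_pos.2 h0) ?_
    have := abs_im_le_norm ((t : ℂ) - conj z0)
    simpa using this

theorem hardy_neg {f : ℂ → ℂ} (hd : DifferentiableOn ℂ f UHP) (hc : ContinuousOn f CUHP) (hb : SB f) (hm : MemLp (fun t : ℝ => f t) 2)
    {z0 : ℂ} (h0 : z0 ∈ UHP) : ∫ t : ℝ, f t / ((t : ℂ) - conj z0) = 0 := by
  have hz0 : (conj z0).im ≠ 0 := by have : 0 < z0.im := h0; simp; exact this.ne'
  have hi : Integrable fun t : ℝ => f t / ((t : ℂ) - conj z0) := by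
    have h1 : Integrable fun t : ℝ => f t * (1 / ((t : ℂ) - conj z0)) := hm.integrable_mul (ck_memLp hz0)
    simpa [div_eq_mul_inv] using h1
  have hnz : ∀ z ∈ CUHP, ∀ w : ℂ, w.im < 0 → z - w ≠ 0 := by
    intro z hz w hw h
    have a1 : 0 ≤ z.im := hz
    have := congrArg im h
    simp at this
    linarith
  have hw0 : (conj z0).im < 0 := by have : 0 < z0.im := h0; simpa using this
  have hlim : Tendsto (fun n : ℕ => ∫ t : ℝ, f t / ((t : ℂ) - conj z0) * (((n : ℂ) + 1) * I / (t - (-((n : ℂ) + 1) * I)))) atTop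
      (𝓝 (∫ t : ℝ, f t / ((t : ℂ) - conj z0))) := by
    refine tendsto_integral_of_dominated_convergence (fun t => ‖f t / ((t : ℂ) - conj z0)‖) ?_ hi.norm ?_ ?_
    · intro n
      exact hi.1.mul (Measurable.aestronglyMeasurable (by fun_prop))
    · intro n
      refine Eventually.of_forall fun t => ?_
      rw [norm_mul]
      refine mul_le_of_le_one_right (norm_nonneg _) ?_
      rw [norm_div]
      refine div_le_one_of_le₀ ?_ (norm_nonneg _)
      have := abs_im_le_norm (t - (-((n : ℂ) + 1) * I))
      have e : ‖((n : ℂ) + 1) * I‖ = n + 1 := by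
        rw [norm_mul, norm_I, mul_one]; exact_mod_cast Complex.norm_natCast (n + 1)
      rw [e]
      have e2 : (t - (-((n : ℂ) + 1) * I)).im = n + 1 := by simp
      rw [e2, abs_of_nonneg (by positivity)] at this
      exact this
    · refine Eventually.of_forall fun t => ?_
      have h1 : Tendsto (fun n : ℕ => (((n : ℂ) + 1) * I / (t - (-((n : ℂ) + 1) * I)))) atTop (𝓝 1) := by
        have h2 : Tendsto (fun n : ℕ => 1 / ((n : ℂ) + 1)) atTop (𝓝 0) := tendsto_one_div_add_atTop_nhds_zero_nat
        have h3 : Tendsto (fun n : ℕ => (1 : ℂ) / (t * (-I) * (1 / ((n : ℂ) + 1)) + 1)) atTop (𝓝 (1 / (t * (-I) * 0 + 1))) :=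
          tendsto_const_nhds.div ((h2.const_mul _).add_const _) (by simp)
        simp only [mul_zero, zero_add, div_one] at h3
        refine h3.congr fun n => ?_
        have hn : (n : ℂ) + 1 ≠ 0 := by exact_mod_cast (Nat.succ_ne_zero n)
        have e1 : (t : ℂ) - (-((n : ℂ) + 1) * I) = (t * (-I) * (1 / ((n : ℂ) + 1)) + 1) * (((n : ℂ) + 1) * I) := by
          field_simp
          linear_combination (t : ℂ) * I_sq
        rw [e1]
        have h4 : ((n : ℂ) + 1) * I ≠ 0 := mul_ne_zero hn I_ne_zero
        rw [div_mul_eq_div_div_swap, div_self h4]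
      simpa using h1.const_mul (f t / ((t : ℂ) - conj z0))
  have hz : ∀ n : ℕ, ∫ t : ℝ, f t / ((t : ℂ) - conj z0) * (((n : ℂ) + 1) * I / (t - (-((n : ℂ) + 1) * I))) = 0 := by
    intro n
    set w : ℂ := -((n : ℂ) + 1) * I with hw
    have hwi : w.im < 0 := by
      simp [hw]; linarith [(Nat.cast_nonneg n : (0 : ℝ) ≤ n)]
    have : ∀ t : ℝ, f t / ((t : ℂ) - conj z0) * (((n : ℂ) + 1) * I / (t - w)) = (f t / (((t : ℂ) - conj z0) * (t - w))) * (((n : ℂ) + 1) * I) := by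
      intro t; rw [div_mul_div_comm, mul_div_right_comm]
    simp_rw [this]
    rw [integral_mul_const]
    have key : ∫ t : ℝ, (f t / (((t : ℂ) - conj z0) * (t - w))) = 0 := by
      refine L2 (G := fun z => f z / ((z - conj z0) * (z - w))) ?_ ?_ (R0 := max (2 * ‖conj z0‖ + 1) (2 * ‖w‖ + 1)) ?_ ?_
      · exact hd.div (by fun_prop) fun z hz => mul_ne_zero (hnz z (UHP_sub hz) _ hw0) (hnz z (UHP_sub hz) _ hwi)
      · exact hc.div (by fun_prop) fun z hz => mul_ne_zero (hnz z hz _ hw0) (hnz z hz _ hwi)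
      · have h2 := hi.mul_bdd (c := |w.im|⁻¹) (g := fun t : ℝ => 1 / ((t : ℂ) - w)) (ck_cont hwi.ne).aestronglyMeasurable
          (Eventually.of_forall fun t => by
            rw [norm_div, norm_one, one_div]
            refine inv_anti₀ (abs_pos.2 hwi.ne) ?_
            have := abs_im_le_norm ((t : ℂ) - w)
            simpa using this)
        refine h2.congr (Eventually.of_forall fun t => ?_)
        beta_reduce
        rw [div_mul_div_comm, mul_one]
      · intro C hC
        obtain ⟨K, hK, hb⟩ := hb C hC
        refine ⟨8 * K, by positivity, fun z hz hzz => ?_⟩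
        have h1 := far2 ((le_max_left _ _).trans hzz) ((le_max_right _ _).trans hzz)
        rw [norm_div]
        calc _ ≤ (K * Real.exp (C * (1 + ‖z‖ ^ 2) / z.im)) / ((1 + ‖z‖ ^ 2) / 8) :=
              div_le_div₀ (by positivity) (hb z hz) (by positivity) h1
          _ = _ := by field_simp
    rw [key, zero_mul]
  simp only [hz] at hlim
  exact (tendsto_nhds_unique hlim tendsto_const_nhds)

theorem hardy_pos {f : ℂ → ℂ} (hd : DifferentiableOn ℂ f UHP) (hc : ContinuousOn f CUHP) (hb : SB f) (hm : MemLp (fun t : ℝ => f t) 2)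
    {z0 : ℂ} (h0 : z0 ∈ UHP) : ∫ t : ℝ, f t / ((t : ℂ) - z0) = 2 * Real.pi * I * f z0 := by
  have h0' : 0 < z0.im := h0
  have h1 := poisson_SB hd hc hb h0 (int_pois hm h0'.ne')
  have h2 := hardy_neg hd hc hb hm h0
  have hz0 : (conj z0).im ≠ 0 := by simp; exact h0'.ne'
  have hi : Integrable fun t : ℝ => f t / ((t : ℂ) - conj z0) := by
    have h1 : Integrable fun t : ℝ => f t * (1 / ((t : ℂ) - conj z0)) := hm.integrable_mul (ck_memLp hz0)
    simpa [div_eq_mul_inv] using h1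
  have e : ∀ t : ℝ, f t / ((t : ℂ) - z0) = f t / ((t : ℂ) - conj z0) + (2 * z0.im * I) * (f t / ((‖(t : ℂ) - z0‖ ^ 2 : ℝ) : ℂ)) := by
    intro t
    rw [← ppk_eq]
    have := real_sub_ne h0'.ne' t
    have h3 : (t : ℂ) - conj z0 ≠ 0 := real_sub_ne hz0 t
    have h4 : (2 * z0.im * I : ℂ) = z0 - conj z0 := by rw [sub_conj]; push_cast; ring
    rw [h4]
    field_simp
    ring
  simp_rw [e]
  rw [integral_add hi ((int_pois hm h0'.ne').const_mul _), h2, integral_const_mul, h1]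
  have : (z0.im : ℂ) ≠ 0 := by exact_mod_cast h0'.ne'
  push_cast
  field_simp
  ring

end DBC

namespace DBC

theorem disc_log {V : ℂ → ℂ} (hd : DifferentiableOn ℂ V (Metric.ball 0 1)) (hne : ∀ w ∈ Metric.ball (0 : ℂ) 1, V w ≠ 0) :
    ∃ g : ℂ → ℂ, DifferentiableOn ℂ g (Metric.ball 0 1) ∧ ∀ w ∈ Metric.ball (0 : ℂ) 1, V w = cexp (g w) := by
  have hop : IsOpen (Metric.ball (0 : ℂ) 1) := Metric.isOpen_ball
  have h1 : DifferentiableOn ℂ (fun w => deriv V w / V w) (Metric.ball 0 1) := (hd.deriv hop).div hd hne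
  obtain ⟨g, hg⟩ := h1.isExactOn_ball
  have h00 : (0 : ℂ) ∈ Metric.ball (0 : ℂ) 1 := by simp
  have hgd : DifferentiableOn ℂ g (Metric.ball 0 1) := fun w hw => (hg w hw).differentiableAt.differentiableWithinAt
  set k := V 0 * cexp (-g 0) with hk
  have hk0 : k ≠ 0 := mul_ne_zero (hne 0 h00) (exp_ne_zero _)
  have hconst : ∀ w ∈ Metric.ball (0 : ℂ) 1, V w * cexp (-g w) = k := by
    intro w hw
    refine hop.is_const_of_deriv_eq_zero (convex_ball _ _).isPreconnected (f := fun w => V w * cexp (-g w)) ?_ ?_ hw h00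
    · exact hd.mul (hgd.neg.cexp)
    · intro x hx
      have e1 : HasDerivAt V (deriv V x) x := (hd.differentiableAt (hop.mem_nhds hx)).hasDerivAt
      have e2 := e1.mul ((hg x hx).neg.cexp)
      have e3 := e2.deriv
      have : deriv (fun w => V w * cexp (-g w)) x = 0 := by
        refine e3.trans ?_
        have := hne x hx
        simp only [Pi.neg_apply]
        field_simp
        ring
      exact this
  refine ⟨fun w => g w + log k, hgd.add_const _, fun w hw => ?_⟩
  rw [exp_add, exp_log hk0, ← hconst w hw, exp_neg]
  field_simp

theorem disc_lower {V : ℂ → ℂ} (hd : DifferentiableOn ℂ V (Metric.ball 0 1)) (hne : ∀ w ∈ Metric.ball (0 : ℂ) 1, V w ≠ 0)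
    {M : ℝ} (hM : ∀ w ∈ Metric.ball (0 : ℂ) 1, ‖V w‖ ≤ M) :
    ∃ C ≥ 0, ∀ w ∈ Metric.ball (0 : ℂ) 1, Real.exp (-(C / (1 - ‖w‖))) ≤ ‖V w‖ := by
  obtain ⟨g, hgd, hg⟩ := disc_log hd hne
  set M' := max (Real.log M) 0 + 1 with hM'
  have hpos : 0 < M' := by positivity
  refine ⟨2 * M' + 2 * ‖g 0‖, by positivity, fun w hw => ?_⟩
  have hw1 : ‖w‖ < 1 := by simpa using hw
  have h := Complex.borelCaratheodory hpos hgd (fun x hx => ?_) one_pos hw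
  · rw [hg w hw, norm_exp]
    apply Real.exp_le_exp.2
    have h2 := abs_le.1 (abs_re_le_norm (g w))
    have h3 : 2 * M' * ‖w‖ / (1 - ‖w‖) + ‖g 0‖ * (1 + ‖w‖) / (1 - ‖w‖) ≤ (2 * M' + 2 * ‖g 0‖) / (1 - ‖w‖) := by
      rw [← add_div]
      apply div_le_div_of_nonneg_right _ (by linarith)
      nlinarith [norm_nonneg (g 0), norm_nonneg w]
    linarith [h2.1]
  · change (g x).re ≤ M'
    have h1 := hM x hx
    have h2 : 0 < ‖V x‖ := norm_pos_iff.2 (hne x hx)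
    have h3 := Real.log_le_log h2 h1
    rw [hg x hx, norm_exp, Real.log_exp] at h3
    have := le_max_left (Real.log M) 0
    linarith

theorem CB_of_bt {N : ℂ → ℂ} (h : OfBoundedType N) : ∃ C ≥ 0, CB C N := by
  obtain ⟨u, v, hu, hv, ⟨A, hA⟩, ⟨B, hB⟩, hN⟩ := h
  -- Cayley map
  have h1w : ∀ w ∈ Metric.ball (0 : ℂ) 1, 1 - w ≠ 0 := by
    intro w hw h
    have : w = 1 := by linear_combination -h
    simp [this] at hw
  have hmap : ∀ w ∈ Metric.ball (0 : ℂ) 1, I * (1 + w) / (1 - w) ∈ UHP := by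
    intro w hw
    have hw1 : ‖w‖ < 1 := by simpa using hw
    have e : (I * (1 + w) / (1 - w)).im = (1 - normSq w) / normSq (1 - w) := by
      simp [div_im, normSq_apply]; ring
    have h0 : 0 < normSq (1 - w) := normSq_pos.2 (h1w w hw)
    change 0 < (I * (1 + w) / (1 - w)).im
    rw [e]
    apply div_pos _ h0
    rw [normSq_eq_norm_sq]
    nlinarith [norm_nonneg w]
  obtain ⟨C, hC, hl⟩ := disc_lower (V := fun w => v (I * (1 + w) / (1 - w))) (M := B)
    (hv.comp (DifferentiableOn.div (by fun_prop) (by fun_prop) h1w) hmap)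
    (fun w hw => (hN _ (hmap w hw)).1) (fun w hw => hB _ (hmap w hw))
  refine ⟨C, hC, |A|, abs_nonneg _, fun z hz => ?_⟩
  have hz' : 0 < z.im := hz
  have hzi : z + I ≠ 0 := by
    intro h
    have := congrArg im h
    simp at this; linarith
  set w := (z - I) / (z + I) with hw
  have e1 : I * (1 + w) / (1 - w) = z := by
    have : 1 - w = 2 * I / (z + I) := by rw [hw]; field_simp; ring
    rw [this]
    have : 1 + w = 2 * z / (z + I) := by rw [hw]; field_simp; ring
    rw [this]
    have := I_ne_zero
    field_simp
  have hn : 1 - ‖w‖ ^ 2 = 4 * z.im / ‖z + I‖ ^ 2 := by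
    rw [hw, norm_div, div_pow]
    have : ‖z + I‖ ^ 2 ≠ 0 := by positivity
    field_simp
    rw [← normSq_eq_norm_sq, ← normSq_eq_norm_sq, normSq_apply, normSq_apply]
    simp; ring
  have hpos : 0 < ‖z + I‖ ^ 2 := by positivity
  have hlt : ‖w‖ < 1 := by
    have : 0 < 1 - ‖w‖ ^ 2 := by rw [hn]; positivity
    nlinarith [norm_nonneg w]
  have hle := hl w (by simpa using hlt)
  beta_reduce at hle
  rw [e1] at hle
  have hineq : C / (1 - ‖w‖) ≤ C * (1 + ‖z‖ ^ 2) / z.im := by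
    rw [mul_div_assoc, div_eq_mul_inv]
    refine mul_le_mul_of_nonneg_left ?_ hC
    have h3 : ‖z + I‖ ^ 2 ≤ 2 * (1 + ‖z‖ ^ 2) := by
      have := norm_add_le z I
      rw [norm_I] at this
      nlinarith [norm_nonneg (z + I), norm_nonneg z, sq_nonneg (‖z‖ - 1)]
    have h4 : z.im / (1 + ‖z‖ ^ 2) ≤ 1 - ‖w‖ := by
      have : 2 * z.im / (1 + ‖z‖ ^ 2) ≤ 1 - ‖w‖ ^ 2 := by
        rw [hn, div_le_div_iff₀ (by positivity) hpos]
        nlinarith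
      rw [mul_div_assoc] at this
      nlinarith [norm_nonneg w]
    rw [← inv_div]
    exact inv_anti₀ (by positivity) h4
  have hv0 := (hN z hz).1
  rw [(hN z hz).2, norm_div, div_le_iff₀ (norm_pos_iff.2 hv0)]
  have h5 : ‖u z‖ ≤ |A| := (hA z hz).trans (le_abs_self _)
  have h6 : 1 ≤ Real.exp (C * (1 + ‖z‖ ^ 2) / z.im) * ‖v z‖ := by
    calc (1 : ℝ) = Real.exp (C / (1 - ‖w‖)) * Real.exp (-(C / (1 - ‖w‖))) := by rw [← Real.exp_add]; simp
      _ ≤ _ := mul_le_mul (Real.exp_le_exp.2 hineq) hle (Real.exp_nonneg _) (Real.exp_nonneg _)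
  rw [mul_assoc]
  nlinarith [abs_nonneg A]

theorem SB_of_sqrt {f : ℂ → ℂ} {A : ℝ} (hA : 0 ≤ A) (hf : ∀ z ∈ UHP, ‖f z‖ ≤ A * (1 + 1 / Real.sqrt z.im)) : SB f := by
  intro C hC
  refine ⟨A * (2 + 1 / C), by positivity, fun z hz => (hf z hz).trans ?_⟩
  have hz' : 0 < z.im := hz
  rw [mul_assoc]
  refine mul_le_mul_of_nonneg_left ?_ hA
  have hs := Real.sqrt_pos.2 hz'
  have h1 : 1 / Real.sqrt z.im ≤ 1 + 1 / z.im := by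
    have e : 1 / z.im = (1 / Real.sqrt z.im) ^ 2 := by rw [div_pow, Real.sq_sqrt hz'.le, one_pow]
    rw [e]; nlinarith [sq_nonneg (1 / Real.sqrt z.im - 1 / 2)]
  have h2 : C / z.im + 1 ≤ Real.exp (C / z.im) := Real.add_one_le_exp _
  have h3 : Real.exp (C / z.im) ≤ Real.exp (C * (1 + ‖z‖ ^ 2) / z.im) := by
    apply Real.exp_le_exp.2
    apply div_le_div_of_nonneg_right _ hz'.le
    nlinarith [sq_nonneg ‖z‖]
  have h4 : 1 / z.im = (1 / C) * (C / z.im) := by field_simp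
  have h5 : 0 ≤ C / z.im := by positivity
  have h6 : 0 < 1 / C := by positivity
  set X := Real.exp (C * (1 + ‖z‖ ^ 2) / z.im)
  have h7 : (1 / C) * (C / z.im) ≤ (1 / C) * X := mul_le_mul_of_nonneg_left (by linarith) h6.le
  nlinarith

theorem pois_est {f : ℂ → ℂ} (hd : DifferentiableOn ℂ f UHP) (hc : ContinuousOn f CUHP) (hm : MemLp (fun t : ℝ => f t) 2)
    {C : ℝ} (hC : 0 ≤ C) (hb : CB C f) :
    ∃ A ≥ 0, ∀ z ∈ UHP, ‖f z‖ ≤ A * (Real.exp (9 * C * z.im) / Real.sqrt z.im) := by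
  refine ⟨Real.sqrt (∫ t : ℝ, ‖f t‖ ^ 2), Real.sqrt_nonneg _, fun z hz => ?_⟩
  have hz' : 0 < z.im := hz
  have h1 := poisson_CB hd hc hC hb hz (int_pois hm hz'.ne')
  have hpc : Continuous fun t : ℝ => ((1 / ‖(t : ℂ) - z‖ ^ 2 : ℝ) : ℂ) := by
    refine continuous_ofReal.comp (Continuous.div continuous_const (by fun_prop) fun t => ?_)
    have := real_sub_ne hz'.ne' t
    positivity
  set k : ℝ → ℂ := fun t => ((1 / ‖(t : ℂ) - z‖ ^ 2 : ℝ) : ℂ) * cexp (9 * C * I * t) with hk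
  have hkn : ∀ t, ‖k t‖ ^ 2 ≤ (1 / z.im ^ 2) * (1 / ‖(t : ℂ) - z‖ ^ 2) := by
    intro t
    have e : ‖cexp (9 * C * I * t)‖ = 1 := by rw [norm_exp]; simp
    rw [hk, norm_mul, e, mul_one, norm_real, Real.norm_of_nonneg (by positivity), sq]
    refine mul_le_mul_of_nonneg_right ?_ (by positivity)
    refine one_div_le_one_div_of_le (by positivity) ?_
    rw [norm_sub_sq]; nlinarith [sq_nonneg (t - z.re)]
  have hkm : AEStronglyMeasurable k volume := (hpc.mul (by fun_prop)).aestronglyMeasurable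
  have hki : Integrable fun t => ‖k t‖ ^ 2 := by
    refine ((pk_int hz'.ne').const_mul (1 / z.im ^ 2)).mono' (hkm.norm.pow 2) (Eventually.of_forall fun t => ?_)
    rw [Real.norm_of_nonneg (by positivity)]
    exact hkn t
  have hkL : MemLp k 2 := (memLp_two_iff_integrable_sq_norm hkm).2 hki
  have hkv : ∫ t, ‖k t‖ ^ 2 ≤ Real.pi / z.im ^ 3 := by
    refine (integral_mono hki ((pk_int hz'.ne').const_mul (1 / z.im ^ 2)) hkn).trans (le_of_eq ?_)
    rw [integral_const_mul, pk_val hz']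
    field_simp
  have h2 := cs hm hkL
  have h3 : ∫ t : ℝ, f t * k t = f z * cexp (9 * C * I * z) * (Real.pi / z.im : ℝ) := by
    rw [← h1]
    refine integral_congr_ae (Eventually.of_forall fun t => ?_)
    simp only [hk]; push_cast; ring
  rw [h3, norm_mul, norm_mul, norm_exp, norm_real, Real.norm_of_nonneg (by positivity)] at h2
  have e4 : (9 * C * I * z : ℂ).re = -(9 * C * z.im) := by simp
  rw [e4] at h2
  have h5 : Real.sqrt (∫ t, ‖k t‖ ^ 2) ≤ Real.pi / (z.im * Real.sqrt z.im) := by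
    apply Real.sqrt_le_iff.2 ⟨by positivity, hkv.trans ?_⟩
    rw [div_pow, mul_pow, Real.sq_sqrt hz'.le]
    rw [← pow_succ]
    apply div_le_div_of_nonneg_right _ (by positivity)
    nlinarith [Real.pi_gt_three]
  set L := Real.sqrt (∫ t : ℝ, ‖f t‖ ^ 2)
  have h6 : ‖f z‖ * Real.exp (-(9 * C * z.im)) * (Real.pi / z.im) ≤ L * (Real.pi / (z.im * Real.sqrt z.im)) :=
    h2.trans (mul_le_mul_of_nonneg_left h5 (Real.sqrt_nonneg _))
  have hpp : 0 < Real.exp (-(9 * C * z.im)) * (Real.pi / z.im) := by positivity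
  refine le_of_mul_le_mul_right ?_ hpp
  rw [← mul_assoc]
  refine h6.trans (le_of_eq ?_)
  rw [Real.exp_neg]
  have := Real.exp_pos (9 * C * z.im)
  field_simp

theorem SB_of_bt {N : ℂ → ℂ} (hd : DifferentiableOn ℂ N UHP) (hc : ContinuousOn N CUHP) (hm : MemLp (fun t : ℝ => N t) 2)
    (hbt : OfBoundedType N) (hmt : NonposMeanType N) : SB N := by
  obtain ⟨C, hC, hCB⟩ := CB_of_bt hbt
  obtain ⟨A, hA, hest⟩ := pois_est hd hc hm hC hCB
  set β := 9 * C with hβ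
  have hβ0 : 0 ≤ β := by positivity
  set D := A + 1 with hD
  have hD1 : 1 ≤ D := by linarith
  have hge1 : ∀ z : ℂ, 1 ≤ z.im → ‖N z‖ ≤ D * Real.exp (β * z.im) := by
    intro z hz
    refine (hest z (show 0 < z.im by linarith)).trans ?_
    refine mul_le_mul (by linarith) ?_ (by positivity) (by linarith)
    refine div_le_self (Real.exp_nonneg _) ?_
    rw [Real.one_le_sqrt]; exact hz
  have hmean : ∀ ε > 0, ∀ᶠ y : ℝ in atTop, ‖N ((y : ℂ) * I)‖ ≤ Real.exp (ε * y) := by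
    intro ε hε
    have hbd : IsBoundedUnder (· ≤ ·) atTop (fun y : ℝ => Real.log ‖N ((y : ℂ) * I)‖ / y) := by
      refine ⟨Real.log D + β, ?_⟩
      rw [eventually_map]
      filter_upwards [eventually_ge_atTop 1] with y hy
      rw [div_le_iff₀ (by linarith)]
      have h1 := hge1 (y * I) (by simpa using hy)
      simp only [mul_im, ofReal_re, I_im, mul_one, ofReal_im, I_re, mul_zero, add_zero] at h1
      have hl : 0 ≤ Real.log D := Real.log_nonneg hD1
      rcases (norm_nonneg (N (y * I))).eq_or_lt with h0 | h0
      · rw [← h0, Real.log_zero]; positivity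
      · have h2 := Real.log_le_log h0 h1
        rw [Real.log_mul (by positivity) (by positivity), Real.log_exp] at h2
        nlinarith
    have := eventually_lt_of_limsup_lt (lt_of_le_of_lt hmt hε) hbd
    filter_upwards [this, eventually_gt_atTop 0] with y hy hy0
    rw [div_lt_iff₀ hy0] at hy
    rcases (norm_nonneg (N (y * I))).eq_or_lt with h0 | h0
    · rw [← h0]; positivity
    · rw [← Real.exp_log h0]; exact Real.exp_le_exp.2 hy.le
  set M := D * Real.exp β with hMdef
  have hM0 : 0 ≤ M := by positivity
  have hPL : ∀ ε > 0, ∀ z : ℂ, 1 ≤ z.im → ‖N z‖ ≤ M * Real.exp (ε * z.im) := by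
    intro ε hε z hz
    set f : ℂ → ℂ := fun w => N (I * (w + 1)) * cexp (-ε * (w + 1)) with hf
    have him : ∀ w : ℂ, (I * (w + 1)).im = w.re + 1 := by intro w; simp
    have hfn : ∀ w, ‖f w‖ = ‖N (I * (w + 1))‖ * Real.exp (-ε * (w.re + 1)) := by
      intro w; rw [hf, norm_mul, norm_exp]; simp
    have hdf : DiffContOnCl ℂ f {z | 0 < z.re} := by
      apply DifferentiableOn.diffContOnCl
      rw [closure_setOfPred_lt_re]
      refine DifferentiableOn.mul (hd.comp (by fun_prop) fun w hw => ?_) (by fun_prop)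
      have : 0 ≤ w.re := hw
      change 0 < (I * (w + 1)).im
      rw [him]; linarith
    have key := PhragmenLindelof.right_half_plane_of_bounded_on_real (f := f) (C := M) (z := -I * z - 1) hdf ?_ ?_ ?_ ?_
    · rw [hfn] at key
      have e1 : I * (-I * z - 1 + 1) = z := by linear_combination (-z) * I_sq
      rw [e1] at key
      have e2 : (-I * z - 1).re + 1 = z.im := by simp
      rw [e2] at key
      calc ‖N z‖ = (‖N z‖ * Real.exp (-ε * z.im)) * Real.exp (ε * z.im) := by
            rw [mul_assoc, ← Real.exp_add]; simp
        _ ≤ _ := mul_le_mul_of_nonneg_right key (Real.exp_nonneg _)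
    · refine ⟨1, by norm_num, β, ?_⟩
      refine Asymptotics.IsBigO.of_bound M ?_
      rw [eventually_inf_principal]
      refine Eventually.of_forall fun w hw => ?_
      have hw' : 0 < w.re := hw
      rw [hfn, Real.rpow_one, Real.norm_of_nonneg (Real.exp_nonneg _)]
      have h1 := hge1 (I * (w + 1)) (by rw [him]; linarith)
      rw [him] at h1
      have h2 : Real.exp (-ε * (w.re + 1)) ≤ 1 := Real.exp_le_one_iff.2 (by nlinarith)
      calc _ ≤ D * Real.exp (β * (w.re + 1)) * 1 := mul_le_mul h1 h2 (Real.exp_nonneg _) (by positivity)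
        _ ≤ D * Real.exp (β * (‖w‖ + 1)) * 1 := by gcongr; exact (le_abs_self _).trans (abs_re_le_norm w)
        _ = _ := by rw [mul_add, Real.exp_add, hMdef]; ring
    · refine ⟨1, ?_⟩
      rw [eventually_map]
      have h1 := (tendsto_atTop_add_const_right atTop (1 : ℝ) tendsto_id).eventually (hmean ε hε)
      filter_upwards [h1] with x hx
      rw [hfn]
      have e : I * ((x : ℂ) + 1) = ((id x + 1 : ℝ) : ℂ) * I := by push_cast; simp [mul_comm]
      rw [e]
      calc _ ≤ Real.exp (ε * (id x + 1)) * Real.exp (-ε * ((x : ℂ).re + 1)) := mul_le_mul_of_nonneg_right hx (Real.exp_nonneg _)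
        _ = 1 := by rw [← Real.exp_add]; simp
    · intro x
      rw [hfn]
      have h1 := hge1 (I * (x * I + 1)) (by rw [him]; simp)
      rw [him] at h1
      simp at h1 ⊢
      have h2 : Real.exp (-ε) ≤ 1 := Real.exp_le_one_iff.2 (by linarith)
      calc _ ≤ (D * Real.exp β) * 1 := mul_le_mul h1 h2 (Real.exp_nonneg _) (by positivity)
        _ = M := by rw [mul_one]
    · simp; exact hz
  have hbig : ∀ z : ℂ, 1 ≤ z.im → ‖N z‖ ≤ M := by
    intro z hz
    have hl : Tendsto (fun ε : ℝ => M * Real.exp (ε * z.im)) (𝓝[>] 0) (𝓝 M) := by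
      have : ContinuousAt (fun ε : ℝ => M * Real.exp (ε * z.im)) 0 := by fun_prop
      have h := this.tendsto.mono_left (nhdsWithin_le_nhds (s := Ioi 0))
      simpa using h
    refine ge_of_tendsto hl ?_
    filter_upwards [self_mem_nhdsWithin] with ε hε using hPL ε hε z hz
  refine SB_of_sqrt hM0 fun z hz => ?_
  have hz' : 0 < z.im := hz
  rcases le_or_gt 1 z.im with h | h
  · have := hbig z h
    have : 0 ≤ M * (1 / Real.sqrt z.im) := by positivity
    linarith
  · refine (hest z hz).trans ?_
    have h1 : Real.exp (β * z.im) ≤ Real.exp β := Real.exp_le_exp.2 (by nlinarith)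
    calc _ ≤ D * (Real.exp β / Real.sqrt z.im) := by gcongr; linarith
      _ = M * (1 / Real.sqrt z.im) := by rw [hMdef]; ring
      _ ≤ _ := by nlinarith

end DBC

namespace DBC
variable {a b : ℝ} {p q r s : ℝ → ℝ} {φ φq : ℂ → ℝ → ℂ}

theorem E_diff (hφ : RealEntireSolFam a b p q r s φ φq) {c : ℝ} (hc : c ∈ Ioo a b) : Differentiable ℂ (dBE φ φq c) :=
  (hφ.entire c hc).1.add ((hφ.entire c hc).2.const_mul I)

theorem E_norm (hyp : SLHyp a b p q r s) (hφ : RealEntireSolFam a b p q r s φ φq) (z : ℂ) {c : ℝ} (hc : c ∈ Ioo a b) :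
    ‖dBE φ φq c z‖ ^ 2 - ‖dBE φ φq c (conj z)‖ ^ 2 = 4 * z.im * nrm2 a r φ c z := by
  have h := E_kernel hyp hφ z z hc
  have e : ∫ x in Ioo a c, psi r φ z x * conj (psi r φ z x) = (nrm2 a r φ c z : ℂ) := by
    rw [nrm2, ← integral_complex_ofReal]
    refine setIntegral_congr_fun measurableSet_Ioo fun x hx => ?_
    beta_reduce
    rw [mul_conj, normSq_eq_norm_sq]
  rw [e, mul_conj, mul_comm (conj _), mul_conj, normSq_eq_norm_sq, normSq_eq_norm_sq] at h
  have h2 := congrArg re h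
  generalize nrm2 a r φ c z = M at h2 ⊢
  generalize ‖dBE φ φq c z‖ ^ 2 = M at h2 ⊢
  generalize ‖dBE φ φq c (conj z)‖ ^ 2 = M at h2 ⊢
  simp at h2
  linarith

theorem E_ne (hyp : SLHyp a b p q r s) (hφ : RealEntireSolFam a b p q r s φ φq) {z : ℂ} (hz : z ∈ CUHP) {c : ℝ}
    (hc : c ∈ Ioo a b) : dBE φ φq c z ≠ 0 := by
  have hz' : 0 ≤ z.im := hz
  rcases hz'.eq_or_lt with h | h
  · have := E_real_ne hyp hφ z.re hc
    have e : ((z.re : ℝ) : ℂ) = z := by apply Complex.ext <;> simp [h]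
    rwa [e] at this
  · intro h0
    have h1 := E_norm hyp hφ z hc
    rw [h0] at h1
    have h2 := nrm2_pos hyp hφ z hc
    have h3 : 0 < 4 * z.im * nrm2 a r φ c z := by positivity
    rw [← h1] at h3
    simp at h3
    nlinarith [sq_nonneg ‖dBE φ φq c (conj z)‖]

theorem hat_bound (hyp : SLHyp a b p q r s) (hφ : RealEntireSolFam a b p q r s φ φq) {z : ℂ} (hz : z ∈ UHP) {c : ℝ}
    (hc : c ∈ Ioo a b) {g : ℝ → ℂ} (hg : MemLp g 2 (volume.restrict (Ioo a c))) :
    ‖hat a r φ c g z / dBE φ φq c z‖ ≤ Real.sqrt (∫ x in Ioo a c, ‖g x‖ ^ 2) * (1 + 1 / Real.sqrt z.im) := by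
  have hz' : 0 < z.im := hz
  have h1 := cs (psi_memLp hyp hφ z hc) hg
  have hE : 0 < ‖dBE φ φq c z‖ := norm_pos_iff.2 (E_ne hyp hφ (UHP_sub hz) hc)
  rw [norm_div, div_le_iff₀ hE]
  have h2 : Real.sqrt (∫ x in Ioo a c, ‖psi r φ z x‖ ^ 2) ≤ (1 + 1 / Real.sqrt z.im) * ‖dBE φ φq c z‖ := by
    change Real.sqrt (nrm2 a r φ c z) ≤ _
    have h3 := E_norm hyp hφ z hc
    have h4 : nrm2 a r φ c z ≤ (1 / Real.sqrt z.im * ‖dBE φ φq c z‖) ^ 2 := by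
      rw [mul_pow, div_pow, Real.sq_sqrt hz'.le, one_pow, one_div, ← div_eq_inv_mul, le_div_iff₀ hz']
      nlinarith [sq_nonneg ‖dBE φ φq c (conj z)‖, nrm2_pos hyp hφ z hc, mul_pos hz' (nrm2_pos hyp hφ z hc)]
    have h5 := Real.sqrt_le_sqrt h4
    rw [Real.sqrt_sq (by positivity)] at h5
    nlinarith
  have h6 := mul_le_mul_of_nonneg_right h2 (Real.sqrt_nonneg (∫ x in Ioo a c, ‖g x‖ ^ 2))
  refine h1.trans (h6.trans (le_of_eq (by ring)))

theorem hat_conj (hφ : RealEntireSolFam a b p q r s φ φq) {c : ℝ} (hc : c ∈ Ioo a b) (g : ℝ → ℂ) (z : ℂ) :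
    conj (hat a r φ c g (conj z)) = hat a r φ c (fun x => conj (g x)) z := by
  rw [hat, ← integral_conj, hat]
  refine setIntegral_congr_fun measurableSet_Ioo fun x hx => ?_
  beta_reduce
  rw [psi_conj hφ z ⟨hx.1, hx.2.trans hc.2⟩]
  simp

theorem div_diff (hyp : SLHyp a b p q r s) (hφ : RealEntireSolFam a b p q r s φ φq) {c : ℝ}
    (hc : c ∈ Ioo a b) {F : ℂ → ℂ} (hF : Differentiable ℂ F) : DifferentiableOn ℂ (fun z => F z / dBE φ φq c z) UHP :=
  hF.differentiableOn.div (E_diff hφ hc).differentiableOn fun _ hz => E_ne hyp hφ (UHP_sub hz) hc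

theorem div_cont (hyp : SLHyp a b p q r s) (hφ : RealEntireSolFam a b p q r s φ φq) {c : ℝ}
    (hc : c ∈ Ioo a b) {F : ℂ → ℂ} (hF : Differentiable ℂ F) : ContinuousOn (fun z => F z / dBE φ φq c z) CUHP :=
  hF.continuous.continuousOn.div (E_diff hφ hc).continuous.continuousOn fun _ hz => E_ne hyp hφ hz hc

theorem div_real_cont (hyp : SLHyp a b p q r s) (hφ : RealEntireSolFam a b p q r s φ φq) {c : ℝ}
    (hc : c ∈ Ioo a b) {F : ℂ → ℂ} (hF : Differentiable ℂ F) : Continuous (fun t : ℝ => F t / dBE φ φq c t) :=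
  (hF.continuous.comp continuous_ofReal).div ((E_diff hφ hc).continuous.comp continuous_ofReal) fun t => E_real_ne hyp hφ t hc

theorem div_SB (hyp : SLHyp a b p q r s) (hφ : RealEntireSolFam a b p q r s φ φq) {c : ℝ}
    (hc : c ∈ Ioo a b) {g : ℝ → ℂ} (hg : MemLp g 2 (volume.restrict (Ioo a c))) : SB (fun z => hat a r φ c g z / dBE φ φq c z) :=
  SB_of_sqrt (Real.sqrt_nonneg _) fun _ hz => hat_bound hyp hφ hz hc hg

theorem sharp_diff {F : ℂ → ℂ} (hF : Differentiable ℂ F) : Differentiable ℂ (fun z => conj (F (conj z))) := by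
  intro z
  have := (hF (conj z)).conj_conj
  simpa [Function.comp_def] using this

/-- Mean type from boundedness on the imaginary axis -/
theorem npmt {N : ℂ → ℂ} {A : ℝ} (hA : 0 ≤ A) (h : ∀ y : ℝ, 1 ≤ y → ‖N (y * I)‖ ≤ A) : NonposMeanType N := by
  have key : ∀ ε > 0, ∀ᶠ y : ℝ in atTop, Real.log ‖N (y * I)‖ / y ≤ ε := by
    intro ε hε
    filter_upwards [eventually_ge_atTop 1, eventually_ge_atTop (Real.log (A + 1) / ε)] with y h1 h2
    rw [div_le_iff₀ (by linarith)]
    rw [div_le_iff₀ hε] at h2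
    refine le_trans ?_ (h2.trans_eq (mul_comm _ _))
    rcases (norm_nonneg (N (y * I))).eq_or_lt with h0 | h0
    · rw [← h0, Real.log_zero]; exact Real.log_nonneg (by linarith)
    · exact Real.log_le_log h0 (by linarith [h y h1])
  rw [NonposMeanType, Filter.limsup_eq]
  by_cases hb : BddBelow {x : ℝ | ∀ᶠ y : ℝ in atTop, Real.log ‖N (y * I)‖ / y ≤ x}
  · exact le_of_forall_pos_le_add fun ε hε => by rw [zero_add]; exact csInf_le hb (key ε hε)
  · rw [Real.sInf_of_not_bddBelow hb]

end DBC

namespace DBC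

theorem cauchy_diff {w : ℝ → ℂ} (hw : Integrable w) : DifferentiableOn ℂ (fun z => ∫ t : ℝ, w t / ((t : ℂ) - z)) UHP := by
  intro z0 hz0
  have h0 : 0 < z0.im := hz0
  have hlow : ∀ z ∈ Metric.ball z0 (z0.im / 2), z0.im / 2 < z.im := by
    intro z hz
    have h1 : ‖z - z0‖ < z0.im / 2 := by simpa [dist_eq_norm] using hz
    have h2 := (abs_le.1 ((abs_im_le_norm (z - z0)).trans h1.le)).1
    have h3 := (abs_lt.1 ((abs_im_le_norm (z - z0)).trans_lt h1)).1
    simp at h3; linarith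
  have hnlow : ∀ z ∈ Metric.ball z0 (z0.im / 2), ∀ t : ℝ, z0.im / 2 ≤ ‖(t : ℂ) - z‖ := by
    intro z hz t
    have h1 := hlow z hz
    have h2 := abs_im_le_norm ((t : ℂ) - z)
    simp at h2
    have := le_abs_self z.im
    linarith
  have hmz : ∀ z ∈ Metric.ball z0 (z0.im / 2), z.im ≠ 0 := fun z hz => by have := hlow z hz; intro h; linarith
  have hbound : ∀ z ∈ Metric.ball z0 (z0.im / 2), ∀ t : ℝ, ‖1 / ((t : ℂ) - z)‖ ≤ 2 / z0.im := by
    intro z hz t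
    have h1 := hnlow z hz t
    rw [norm_div, norm_one, div_le_div_iff₀ (by linarith) h0]
    linarith
  have hz0m : z0 ∈ Metric.ball z0 (z0.im / 2) := Metric.mem_ball_self (by linarith)
  have hint : ∀ z ∈ Metric.ball z0 (z0.im / 2), Integrable (fun t : ℝ => w t / ((t : ℂ) - z)) := by
    intro z hz
    have := hw.mul_bdd (c := 2 / z0.im) (g := fun t : ℝ => 1 / ((t : ℂ) - z)) (ck_cont (hmz z hz)).aestronglyMeasurable
      (Eventually.of_forall fun t => hbound z hz t)
    simpa [div_eq_mul_inv] using this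
  have := hasDerivAt_integral_of_dominated_loc_of_deriv_le (μ := volume) (F := fun z t => w t / ((t : ℂ) - z))
    (F' := fun z t => w t * (1 / ((t : ℂ) - z)) * (1 / ((t : ℂ) - z))) (x₀ := z0) (s := Metric.ball z0 (z0.im / 2))
    (bound := fun t => ‖w t‖ * (2 / z0.im) * (2 / z0.im))
    (Metric.ball_mem_nhds _ (by linarith)) ?_ (hint z0 hz0m) ?_ ?_ ?_ ?_
  · exact this.2.differentiableAt.differentiableWithinAt
  · filter_upwards [Metric.ball_mem_nhds z0 (show 0 < z0.im / 2 by linarith)] with z hz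
    exact (hint z hz).1
  · exact (hw.1.mul (ck_cont (hmz z0 hz0m)).aestronglyMeasurable).mul (ck_cont (hmz z0 hz0m)).aestronglyMeasurable
  · refine Eventually.of_forall fun t z hz => ?_
    rw [norm_mul, norm_mul]
    have := hbound z hz t
    gcongr
  · exact (hw.norm.mul_const _).mul_const _
  · refine Eventually.of_forall fun t z hz => ?_
    have hne := real_sub_ne (hmz z hz) t
    have h1 : HasDerivAt (fun z : ℂ => (t : ℂ) - z) (-1) z := by simpa using (hasDerivAt_id z).const_sub (t : ℂ)
    have h2 := (h1.inv hne).const_mul (w t)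
    refine (h2.congr_deriv ?_)
    field_simp

theorem obt {N : ℂ → ℂ} (hd : DifferentiableOn ℂ N UHP) (hc : ContinuousOn N CUHP) (hb : SB N)
    (hm : MemLp (fun t : ℝ => N t) 2) : OfBoundedType N := by
  have hw : Integrable (fun t : ℝ => ((‖N t‖ ^ 2 : ℝ) : ℂ)) := (sq_integrable hm).ofReal
  set Q : ℂ → ℂ := fun z => (1 / (Real.pi * I)) * ∫ t : ℝ, ((‖N t‖ ^ 2 : ℝ) : ℂ) / ((t : ℂ) - z) with hQ
  have hQd : DifferentiableOn ℂ Q UHP := (cauchy_diff hw).const_mul _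
  have hre : ∀ z ∈ UHP, ‖N z‖ ^ 2 ≤ (Q z).re := by
    intro z hz
    have h0 : 0 < z.im := hz
    have hi : Integrable fun t : ℝ => ((‖N t‖ ^ 2 : ℝ) : ℂ) / ((t : ℂ) - z) := by
      have := hw.mul_bdd (c := |z.im|⁻¹) (g := fun t : ℝ => 1 / ((t : ℂ) - z)) (ck_cont h0.ne').aestronglyMeasurable
        (Eventually.of_forall fun t => ?_)
      · simpa [div_eq_mul_inv] using this
      · have h2 := abs_im_le_norm ((t : ℂ) - z)
        simp at h2
        rw [norm_div, norm_one, one_div]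
        exact inv_anti₀ (abs_pos.2 h0.ne') h2
    have e1 : (Q z).re = (z.im / Real.pi) * ∫ t : ℝ, ‖N t‖ ^ 2 / ‖(t : ℂ) - z‖ ^ 2 := by
      have : (Q z).re = (1 / Real.pi) * (∫ t : ℝ, ((‖N t‖ ^ 2 : ℝ) : ℂ) / ((t : ℂ) - z)).im := by
        simp only [hQ]
        generalize (∫ t : ℝ, ((‖N t‖ ^ 2 : ℝ) : ℂ) / ((t : ℂ) - z)) = J
        have e : (1 / (Real.pi * I) : ℂ) = ((1 / Real.pi : ℝ) : ℂ) * (-I) := by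
          have : (Real.pi : ℂ) ≠ 0 := by exact_mod_cast Real.pi_ne_zero
          push_cast; field_simp; simp
        rw [e, mul_assoc, re_ofReal_mul]; simp
      rw [this]
      have h3 : (∫ t : ℝ, ((‖N t‖ ^ 2 : ℝ) : ℂ) / ((t : ℂ) - z)).im = ∫ t : ℝ, (((‖N t‖ ^ 2 : ℝ) : ℂ) / ((t : ℂ) - z)).im :=
        (integral_im hi).symm
      rw [h3, ← integral_const_mul, ← integral_const_mul]
      refine integral_congr_ae (Eventually.of_forall fun t => ?_)
      beta_reduce
      rw [div_eq_mul_inv (((‖N t‖ ^ 2 : ℝ) : ℂ)), im_ofReal_mul, inv_im, normSq_eq_norm_sq]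
      simp
      ring
    have e2 := poisson_SB hd hc hb hz (int_pois hm h0.ne')
    have m1 : MemLp (fun t : ℝ => N t * (1 / ((t : ℂ) - z))) 2 := by
      have hms := hm.1.mul (ck_cont h0.ne').aestronglyMeasurable
      refine (hm.norm.const_mul (|z.im|⁻¹)).mono hms (Eventually.of_forall fun t => ?_)
      have h2 := abs_im_le_norm ((t : ℂ) - z)
      simp at h2
      rw [norm_mul, norm_div, norm_one, one_div, norm_mul, norm_norm, mul_comm, norm_inv, Real.norm_eq_abs, abs_abs]
      exact mul_le_mul_of_nonneg_right (inv_anti₀ (abs_pos.2 h0.ne') h2) (norm_nonneg _)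
    have hz' : (conj z).im ≠ 0 := by simp; exact h0.ne'
    have e3 := cs m1 (ck_memLp hz')
    have e4 : ∫ t : ℝ, N t * (1 / ((t : ℂ) - z)) * (1 / ((t : ℂ) - conj z)) = N z * (Real.pi / z.im : ℝ) := by
      rw [← e2]
      refine integral_congr_ae (Eventually.of_forall fun t => ?_)
      beta_reduce
      rw [← ppk_eq]
      have := real_sub_ne h0.ne' t
      have := real_sub_ne hz' t
      field_simp
    have e5 : ∫ t : ℝ, ‖1 / ((t : ℂ) - conj z)‖ ^ 2 = Real.pi / z.im := by
      rw [← pk_val hz]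
      refine integral_congr_ae (Eventually.of_forall fun t => ?_)
      beta_reduce
      have : ‖(t : ℂ) - conj z‖ = ‖(t : ℂ) - z‖ := by rw [← norm_conj]; simp
      rw [norm_div, norm_one, div_pow, one_pow, this]
    have e6 : ∫ t : ℝ, ‖N t * (1 / ((t : ℂ) - z))‖ ^ 2 = ∫ t : ℝ, ‖N t‖ ^ 2 / ‖(t : ℂ) - z‖ ^ 2 := by
      refine integral_congr_ae (Eventually.of_forall fun t => ?_)
      beta_reduce
      rw [norm_mul, norm_div, norm_one, mul_pow, div_pow, one_pow, mul_one_div]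
    rw [e4, e5, e6] at e3
    rw [e1]
    set J := ∫ t : ℝ, ‖N t‖ ^ 2 / ‖(t : ℂ) - z‖ ^ 2 with hJ
    have hJ0 : 0 ≤ J := integral_nonneg fun t => by positivity
    have hP : 0 < Real.pi / z.im := div_pos Real.pi_pos h0
    have e7 := pow_le_pow_left₀ (norm_nonneg _) e3 2
    rw [mul_pow, Real.sq_sqrt hJ0, Real.sq_sqrt hP.le, norm_mul, norm_real, Real.norm_eq_abs, abs_of_pos hP, mul_pow] at e7
    have e8 : ‖N z‖ ^ 2 * (Real.pi / z.im) ≤ J := by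
      refine le_of_mul_le_mul_right ?_ hP
      nlinarith
    have e9 : z.im / Real.pi * (‖N z‖ ^ 2 * (Real.pi / z.im)) = ‖N z‖ ^ 2 := by
      have := Real.pi_ne_zero
      field_simp
    rw [← e9]
    exact mul_le_mul_of_nonneg_left e8 (by positivity)
  have hone : ∀ z ∈ UHP, 1 + ‖N z‖ ^ 2 ≤ ‖1 + Q z‖ := fun z hz => by
    have h1 := re_le_norm (1 + Q z)
    have h2 := hre z hz
    simp at h1; linarith
  have hne : ∀ z ∈ UHP, 1 + Q z ≠ 0 := fun z hz => by
    have := hone z hz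
    rw [← norm_pos_iff]; nlinarith [sq_nonneg ‖N z‖]
  refine ⟨fun z => N z / (1 + Q z), fun z => 1 / (1 + Q z), hd.div (hQd.const_add 1) hne, (differentiableOn_const 1).div (hQd.const_add 1) hne, ⟨1, fun z hz => ?_⟩,
    ⟨1, fun z hz => ?_⟩, fun z hz => ⟨one_div_ne_zero (hne z hz), ?_⟩⟩
  · rw [norm_div, div_le_one (norm_pos_iff.2 (hne z hz))]
    nlinarith [hone z hz, sq_nonneg (‖N z‖ - 1)]
  · rw [norm_div, norm_one, div_le_one (norm_pos_iff.2 (hne z hz))]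
    nlinarith [hone z hz, sq_nonneg ‖N z‖]
  · have := hne z hz
    field_simp

end DBC

namespace DBC

theorem gram {H Y ι : Type*} [NormedAddCommGroup H] [InnerProductSpace ℂ H] [CompleteSpace H] [NormedAddCommGroup Y]
    [InnerProductSpace ℂ Y] [CompleteSpace Y] (e : ι → H) (κ : ι → Y)
    (hG : ∀ i j, inner ℂ (e i) (e j) = inner ℂ (κ i) (κ j)) (hd : ∀ x, (∀ i, inner ℂ (e i) x = 0) → x = 0) :
    ∃ T : H →L[ℂ] Y, (∀ i, T (e i) = κ i) ∧ ∀ x, ‖T x‖ = ‖x‖ := by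
  set A := Finsupp.linearCombination ℂ e with hA
  set B := Finsupp.linearCombination ℂ κ with hB
  have hin : ∀ x y, inner ℂ (B x) (B y) = inner ℂ (A x) (A y) := by
    intro x y
    simp only [hA, hB, Finsupp.linearCombination_apply, Finsupp.sum, sum_inner, inner_sum, inner_smul_left, inner_smul_right, hG]
  have hn : ∀ x, ‖B x‖ = ‖A x‖ := by
    intro x
    rw [@norm_eq_sqrt_re_inner ℂ, @norm_eq_sqrt_re_inner ℂ, hin]
  have hdense : DenseRange A := by
    have h1 : (LinearMap.range A)ᗮ = ⊥ := by
      rw [Submodule.eq_bot_iff]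
      intro x hx
      refine hd x fun i => ?_
      refine (Submodule.mem_orthogonal _ _).1 hx _ ⟨Finsupp.single i 1, by simp [hA]⟩
    have h2 := (Submodule.topologicalClosure_eq_top_iff (K := LinearMap.range A)).2 h1
    have := (Submodule.dense_iff_topologicalClosure_eq_top).2 h2
    rw [DenseRange, ← LinearMap.coe_range]
    exact this
  have hb : ∃ C, ∀ x, ‖B x‖ ≤ C * ‖A x‖ := ⟨1, fun x => by rw [hn, one_mul]⟩
  have hext := fun x => LinearMap.extendOfNorm_eq hdense hb x
  refine ⟨B.extendOfNorm A, fun i => ?_, fun x => ?_⟩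
  · have := hext (Finsupp.single i 1)
    simpa [hA, hB] using this
  · have hcl : IsClosed {x | ‖B.extendOfNorm A x‖ = ‖x‖} := isClosed_eq (by fun_prop) (by fun_prop)
    have := hdense.closure_range
    have h3 : Set.range A ⊆ {x | ‖B.extendOfNorm A x‖ = ‖x‖} := by
      rintro _ ⟨x, rfl⟩
      simp only [mem_ofPred_eq]
      rw [hext, hn]
    exact closure_minimal h3 hcl (by rw [this]; trivial)

variable {a b : ℝ} {p q r s : ℝ → ℝ} {φ φq : ℂ → ℝ → ℂ}

/-- kernel -/
def ker (a : ℝ) (r : ℝ → ℝ) (φ : ℂ → ℝ → ℂ) (c : ℝ) (ζ : ℂ) : ℂ → ℂ := hat a r φ c (fun x => conj (psi r φ ζ x))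

theorem cpsi_memLp (hyp : SLHyp a b p q r s) (hφ : RealEntireSolFam a b p q r s φ φq) (z : ℂ) {c : ℝ} (hc : c ∈ Ioo a b) :
    MemLp (fun x => conj (psi r φ z x)) 2 (volume.restrict (Ioo a c)) := (psi_memLp hyp hφ z hc).star

theorem ker_real (hyp : SLHyp a b p q r s) (hφ : RealEntireSolFam a b p q r s φ φq) {c : ℝ} (hc : c ∈ Ioo a b)
    {ζ : ℂ} (hζ : ζ ∈ UHP) (t : ℝ) : ker a r φ c ζ t / dBE φ φq c t =
      (conj (dBE φ φq c ζ) - conj (dBE φ φq c t) / dBE φ φq c t * dBE φ φq c (conj ζ)) / (2 * I * (conj ζ - t)) := by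
  have h0 : 0 < ζ.im := hζ
  have h := E_kernel hyp hφ t ζ hc
  rw [conj_ofReal] at h
  have h1 := E_real_ne hyp hφ t hc
  have h2 : conj ζ - t ≠ 0 := by
    have := real_sub_ne (z := conj ζ) (by simp; exact h0.ne') t
    rw [← neg_sub]; exact neg_ne_zero.2 this
  have h3 : dBE φ φq c t * conj (dBE φ φq c ζ) - conj (dBE φ φq c t) * dBE φ φq c (conj ζ) =
    2 * I * (conj ζ - t) * ker a r φ c ζ t := h
  have hI := I_ne_zero
  rw [div_eq_div_iff h1 (mul_ne_zero (mul_ne_zero two_ne_zero hI) h2)]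
  field_simp
  linear_combination -h3

theorem ker_memLp (hyp : SLHyp a b p q r s) (hφ : RealEntireSolFam a b p q r s φ φq) {c : ℝ} (hc : c ∈ Ioo a b)
    {ζ : ℂ} (hζ : ζ ∈ UHP) : MemLp (fun t : ℝ => ker a r φ c ζ t / dBE φ φq c t) 2 := by
  have h0 : 0 < ζ.im := hζ
  have hm := ck_memLp (z := conj ζ) (by simp; exact h0.ne')
  have hcont : Continuous (fun t : ℝ => ker a r φ c ζ t / dBE φ φq c t) :=
    div_real_cont hyp hφ hc (hat_diff hyp hφ hc (cpsi_memLp hyp hφ ζ hc))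
  refine (hm.const_mul (((‖dBE φ φq c ζ‖ + ‖dBE φ φq c (conj ζ)‖) / 2 : ℝ) : ℂ)).mono hcont.aestronglyMeasurable
    (Eventually.of_forall fun t => ?_)
  rw [ker_real hyp hφ hc hζ]
  have h1 := E_real_ne hyp hφ t hc
  have e1 : ‖conj (dBE φ φq c ζ) - conj (dBE φ φq c t) / dBE φ φq c t * dBE φ φq c (conj ζ)‖ ≤
      ‖dBE φ φq c ζ‖ + ‖dBE φ φq c (conj ζ)‖ := by
    refine (norm_sub_le _ _).trans ?_
    rw [norm_mul, norm_div, norm_conj, norm_conj, div_self (norm_ne_zero_iff.2 h1), one_mul]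
  rw [norm_div, norm_mul, norm_mul, norm_mul, norm_I, norm_real, Real.norm_eq_abs, abs_of_nonneg (by positivity), norm_div, norm_one,
    norm_sub_rev (conj ζ)]
  simp only [Complex.norm_ofNat, mul_one]
  rw [div_mul_div_comm, mul_one]
  gcongr

theorem repro (hyp : SLHyp a b p q r s) (hφ : RealEntireSolFam a b p q r s φ φq) {c : ℝ} (hc : c ∈ Ioo a b)
    {F : ℂ → ℂ} (hF : Differentiable ℂ F) (hb : SB fun z => F z / dBE φ φq c z)
    (hb' : SB fun z => conj (F (conj z)) / dBE φ φq c z) (hm : MemLp (fun t : ℝ => F t / dBE φ φq c t) 2)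
    {ζ : ℂ} (hζ : ζ ∈ UHP) :
    ∫ t : ℝ, F t / dBE φ φq c t * conj (ker a r φ c ζ t / dBE φ φq c t) = Real.pi * F ζ := by
  have h0 : 0 < ζ.im := hζ
  have hz' : (conj ζ).im ≠ 0 := by simp; exact h0.ne'
  have hFs := sharp_diff hF
  have hm' : MemLp (fun t : ℝ => conj (F (conj (t : ℂ))) / dBE φ φq c t) 2 := by
    refine hm.mono (div_real_cont hyp hφ hc hFs).aestronglyMeasurable (Eventually.of_forall fun t => ?_)
    simp
  have h1 := hardy_pos (div_diff hyp hφ hc hF) (div_cont hyp hφ hc hF) hb hm hζ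
  have h2 := hardy_neg (div_diff hyp hφ hc hFs) (div_cont hyp hφ hc hFs) hb' hm' hζ
  have i1 : Integrable fun t : ℝ => F t / dBE φ φq c t / ((t : ℂ) - ζ) := by
    have h1 : Integrable fun t : ℝ => F t / dBE φ φq c t * (1 / ((t : ℂ) - ζ)) := hm.integrable_mul (ck_memLp h0.ne')
    simpa [div_eq_mul_inv] using h1
  have i2 : Integrable fun t : ℝ => conj (conj (F (conj (t : ℂ))) / dBE φ φq c t / ((t : ℂ) - conj ζ)) := by
    have h1 : Integrable fun t : ℝ => conj (F (conj (t : ℂ))) / dBE φ φq c t * (1 / ((t : ℂ) - conj ζ)) := hm'.integrable_mul (ck_memLp hz')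
    have h3 := (memLp_one_iff_integrable.2 h1).star
    rw [memLp_one_iff_integrable] at h3
    refine h3.congr (Eventually.of_forall fun t => ?_)
    simp [div_eq_mul_inv]
  have h3 := congrArg conj h2
  rw [← integral_conj, map_zero] at h3
  have e : ∀ t : ℝ, F t / dBE φ φq c t * conj (ker a r φ c ζ t / dBE φ φq c t) =
      dBE φ φq c ζ / (2 * I) * (F t / dBE φ φq c t / ((t : ℂ) - ζ)) -
      conj (dBE φ φq c (conj ζ)) / (2 * I) * conj (conj (F (conj (t : ℂ))) / dBE φ φq c t / ((t : ℂ) - conj ζ)) := by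
    intro t
    rw [ker_real hyp hφ hc hζ]
    have a1 := E_real_ne hyp hφ t hc
    have a2 : conj (dBE φ φq c t) ≠ 0 := by simpa using a1
    have a3 := real_sub_ne h0.ne' t
    have a4 : ζ - (t : ℂ) ≠ 0 := by rw [← neg_sub]; exact neg_ne_zero.2 a3
    have hI := I_ne_zero
    simp only [map_div₀, map_sub, map_mul, conj_conj, conj_ofReal, conj_I, map_ofNat]
    have a5 : ζ - (t : ℂ) = -((t : ℂ) - ζ) := by ring
    rw [a5]
    field_simp
  rw [integral_congr_ae (Eventually.of_forall e), integral_sub (i1.const_mul _) (i2.const_mul _), integral_const_mul,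
    integral_const_mul, h1, h3]
  have := E_ne hyp hφ (UHP_sub hζ) hc
  have hI := I_ne_zero
  field_simp
  simp
end DBC

namespace DBC
variable {a b : ℝ} {p q r s : ℝ → ℝ} {φ φq : ℂ → ℝ → ℂ}

theorem entire_ext {f g : ℂ → ℂ} (hf : Differentiable ℂ f) (hg : Differentiable ℂ g) (h : ∀ z ∈ UHP, f z = g z) : f = g := by
  have h1 : AnalyticOnNhd ℂ f univ := (analyticOnNhd_univ_iff_differentiable).2 hf
  have h2 : AnalyticOnNhd ℂ g univ := (analyticOnNhd_univ_iff_differentiable).2 hg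
  refine h1.eq_of_eventuallyEq h2 (z₀ := I) ?_
  filter_upwards [UHP_open.mem_nhds (show (I : ℂ) ∈ UHP by simp [UHP])] with z hz
  exact h z hz

theorem inner_toLp' {Ω : Type*} [MeasurableSpace Ω] {μ : Measure Ω} {f : Ω → ℂ} (hf : MemLp f 2 μ) (g : Lp ℂ 2 μ) :
    inner ℂ (hf.toLp f) g = ∫ x, g x * conj (f x) ∂μ := by
  rw [L2.inner_def]
  refine integral_congr_ae ?_
  filter_upwards [hf.coeFn_toLp] with x hx
  rw [RCLike.inner_apply, hx]

theorem norm_toLp_sq {Ω : Type*} [MeasurableSpace Ω] {μ : Measure Ω} {f : Ω → ℂ} (hf : MemLp f 2 μ) :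
    ‖hf.toLp f‖ ^ 2 = ∫ x, ‖f x‖ ^ 2 ∂μ := by
  have h := inner_toLp' hf (hf.toLp f)
  rw [inner_self_eq_norm_sq_to_K] at h
  have e : ∫ x, (hf.toLp f) x * conj (f x) ∂μ = ((∫ x, ‖f x‖ ^ 2 ∂μ : ℝ) : ℂ) := by
    rw [← integral_complex_ofReal]
    refine integral_congr_ae ?_
    filter_upwards [hf.coeFn_toLp] with x hx
    rw [hx, mul_conj, normSq_eq_norm_sq]
  rw [e] at h
  apply Complex.ofReal_injective
  rw [← h]
  simp

/-- evaluation vectors -/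
def ev (hyp : SLHyp a b p q r s) (hφ : RealEntireSolFam a b p q r s φ φq) {c : ℝ} (hc : c ∈ Ioo a b) (z : ℂ) :
    Lp ℂ 2 (volume.restrict (Ioo a c)) := (cpsi_memLp hyp hφ z hc).toLp _

theorem ev_inner (hyp : SLHyp a b p q r s) (hφ : RealEntireSolFam a b p q r s φ φq) {c : ℝ} (hc : c ∈ Ioo a b) (z : ℂ)
    (g : Lp ℂ 2 (volume.restrict (Ioo a c))) : inner ℂ (ev hyp hφ hc z) g = hat a r φ c g z := by
  rw [ev, inner_toLp', hat]
  refine integral_congr_ae (Eventually.of_forall fun x => ?_)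
  beta_reduce
  rw [conj_conj, mul_comm]

theorem hat_congr {c : ℝ} {f g : ℝ → ℂ} (h : f =ᵐ[volume.restrict (Ioo a c)] g) (z : ℂ) : hat a r φ c f z = hat a r φ c g z := by
  refine integral_congr_ae ?_
  filter_upwards [h] with x hx
  rw [hx]

theorem ev_total (hyp : SLHyp a b p q r s) (hφ : RealEntireSolFam a b p q r s φ φq) {c : ℝ} (hc : c ∈ Ioo a b)
    (x : Lp ℂ 2 (volume.restrict (Ioo a c))) (h : ∀ i : UHP, inner ℂ (ev hyp hφ hc i) x = 0) : x = 0 := by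
  have h1 : hat a r φ c x = fun _ => 0 := by
    refine entire_ext (hat_diff hyp hφ hc (Lp.memLp x)) (differentiable_const 0) fun z hz => ?_
    rw [← ev_inner hyp hφ hc]; exact h ⟨z, hz⟩
  have h2 := hat_inj hyp hφ hc (Lp.memLp x) (fun z => by rw [h1])
  exact (Lp.eq_zero_iff_ae_eq_zero).2 h2

theorem dense_of_total {H ι : Type*} [NormedAddCommGroup H] [InnerProductSpace ℂ H] [CompleteSpace H] (e : ι → H)
    (hd : ∀ x, (∀ i, inner ℂ (e i) x = 0) → x = 0) : Dense (Submodule.span ℂ (Set.range e) : Set H) := by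
  rw [Submodule.dense_iff_topologicalClosure_eq_top, Submodule.topologicalClosure_eq_top_iff, Submodule.eq_bot_iff]
  intro x hx
  exact hd x fun i => (Submodule.mem_orthogonal _ _).1 hx _ (Submodule.subset_span ⟨i, rfl⟩)

theorem ker_gram (hyp : SLHyp a b p q r s) (hφ : RealEntireSolFam a b p q r s φ φq) {c : ℝ} (hc : c ∈ Ioo a b)
    {ζ η : ℂ} (hζ : ζ ∈ UHP) (hη : η ∈ UHP) :
    ∫ t : ℝ, ker a r φ c η t / dBE φ φq c t * conj (ker a r φ c ζ t / dBE φ φq c t) = Real.pi * ker a r φ c η ζ := by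
  refine repro hyp hφ hc (hat_diff hyp hφ hc (cpsi_memLp hyp hφ η hc)) (div_SB hyp hφ hc (cpsi_memLp hyp hφ η hc)) ?_
    (ker_memLp hyp hφ hc hη) hζ
  simp only [hat_conj hφ hc]
  exact div_SB hyp hφ hc (cpsi_memLp hyp hφ η hc).star

theorem exists_T (hyp : SLHyp a b p q r s) (hφ : RealEntireSolFam a b p q r s φ φq) {c : ℝ} (hc : c ∈ Ioo a b) :
    ∃ T : Lp ℂ 2 (volume.restrict (Ioo a c)) →L[ℂ] Lp ℂ 2 (volume : Measure ℝ),
      (∀ i : UHP, T (ev hyp hφ hc i) = (((Real.sqrt Real.pi)⁻¹ : ℝ) : ℂ) • (ker_memLp hyp hφ hc i.2).toLp _) ∧ ∀ x, ‖T x‖ = ‖x‖ := by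
  refine gram (fun i : UHP => ev hyp hφ hc i) _ ?_ (ev_total hyp hφ hc)
  intro i j
  rw [inner_smul_left, inner_smul_right, inner_toLp', ev_inner]
  have e1 : hat a r φ c (ev hyp hφ hc j) i = ker a r φ c j i := hat_congr (MemLp.coeFn_toLp _) _
  have e2 : ∫ x : ℝ, ((ker_memLp hyp hφ hc j.2).toLp _ : ℝ → ℂ) x * conj (ker a r φ c i x / dBE φ φq c x) =
      Real.pi * ker a r φ c j i := by
    rw [← ker_gram hyp hφ hc i.2 j.2]
    refine integral_congr_ae ?_
    filter_upwards [(ker_memLp hyp hφ hc j.2).coeFn_toLp] with x hx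
    rw [hx]
  rw [e1, e2, conj_ofReal, ← mul_assoc, ← mul_assoc, ← ofReal_mul, ← ofReal_mul]
  have : (Real.sqrt Real.pi)⁻¹ * (Real.sqrt Real.pi)⁻¹ * Real.pi = 1 := by
    rw [← mul_inv, Real.mul_self_sqrt Real.pi_pos.le, inv_mul_cancel₀ Real.pi_ne_zero]
  rw [this]; simp

theorem T_formula (hyp : SLHyp a b p q r s) (hφ : RealEntireSolFam a b p q r s φ φq) {c : ℝ} (hc : c ∈ Ioo a b)
    {T : Lp ℂ 2 (volume.restrict (Ioo a c)) →L[ℂ] Lp ℂ 2 (volume : Measure ℝ)}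
    (hT : ∀ i : UHP, T (ev hyp hφ hc i) = (((Real.sqrt Real.pi)⁻¹ : ℝ) : ℂ) • (ker_memLp hyp hφ hc i.2).toLp _)
    (g : Lp ℂ 2 (volume.restrict (Ioo a c))) :
    T g =ᵐ[volume] fun t : ℝ => (((Real.sqrt Real.pi)⁻¹ : ℝ) : ℂ) * inner ℂ (ev hyp hφ hc t) g / dBE φ φq c t := by
  have hspan : ∀ g ∈ Submodule.span ℂ (Set.range fun i : UHP => ev hyp hφ hc i),
      T g =ᵐ[volume] fun t : ℝ => (((Real.sqrt Real.pi)⁻¹ : ℝ) : ℂ) * inner ℂ (ev hyp hφ hc t) g / dBE φ φq c t := by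
    intro g hg
    induction hg using Submodule.span_induction with
    | mem x hx =>
      obtain ⟨i, rfl⟩ := hx
      beta_reduce
      rw [hT]
      filter_upwards [Lp.coeFn_smul (((Real.sqrt Real.pi)⁻¹ : ℝ) : ℂ) ((ker_memLp hyp hφ hc i.2).toLp _),
        (ker_memLp hyp hφ hc i.2).coeFn_toLp] with t h1 h2
      rw [h1, Pi.smul_apply, h2, smul_eq_mul, mul_div_assoc, ev_inner]
      have e1 : hat a r φ c (ev hyp hφ hc i) t = ker a r φ c i t := hat_congr (MemLp.coeFn_toLp _) _
      rw [e1]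
    | zero =>
      rw [map_zero]
      filter_upwards [Lp.coeFn_zero ℂ 2 (volume : Measure ℝ)] with t h1
      rw [h1]; simp
    | add x y _ _ hx hy =>
      rw [map_add]
      filter_upwards [Lp.coeFn_add (T x) (T y), hx, hy] with t h1 h2 h3
      rw [h1, Pi.add_apply, h2, h3, inner_add_right]; ring
    | smul k x _ hx =>
      rw [map_smul]
      filter_upwards [Lp.coeFn_smul k (T x), hx] with t h1 h2
      rw [h1, Pi.smul_apply, h2, inner_smul_right, smul_eq_mul]; ring
  have hdn := dense_of_total _ (ev_total hyp hφ hc)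
  obtain ⟨u, hu, hlim⟩ := mem_closure_iff_seq_limit.1 (hdn g)
  have h1 : Tendsto (fun n => T (u n)) atTop (𝓝 (T g)) := (T.continuous.tendsto g).comp hlim
  obtain ⟨ns, hns, hae⟩ := (tendstoInMeasure_of_tendsto_Lp h1).exists_seq_tendsto_ae
  have h2 : ∀ᵐ t : ℝ, ∀ n, T (u n) t = (((Real.sqrt Real.pi)⁻¹ : ℝ) : ℂ) * inner ℂ (ev hyp hφ hc t) (u n) / dBE φ φq c t :=
    ae_all_iff.2 fun n => hspan _ (hu n)
  filter_upwards [hae, h2] with t h3 h4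
  simp_rw [h4] at h3
  refine tendsto_nhds_unique h3 ?_
  have h5 : Tendsto (fun n => inner ℂ (ev hyp hφ hc t) (u (ns n))) atTop (𝓝 (inner ℂ (ev hyp hφ hc t) g)) :=
    tendsto_const_nhds.inner (hlim.comp hns.tendsto_atTop)
  exact (h5.const_mul _).div_const _

theorem hat_L2 (hyp : SLHyp a b p q r s) (hφ : RealEntireSolFam a b p q r s φ φq) {c : ℝ} (hc : c ∈ Ioo a b)
    {g : ℝ → ℂ} (hg : MemLp g 2 (volume.restrict (Ioo a c))) :
    MemLp (fun t : ℝ => hat a r φ c g t / dBE φ φq c t) 2 ∧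
      ∫ t : ℝ, ‖hat a r φ c g t / dBE φ φq c t‖ ^ 2 = Real.pi * ∫ x in Ioo a c, ‖g x‖ ^ 2 := by
  obtain ⟨T, hT, hn⟩ := exists_T hyp hφ hc
  have h1 := T_formula hyp hφ hc hT (hg.toLp g)
  have hs0 : Real.sqrt Real.pi ≠ 0 := (Real.sqrt_pos.2 Real.pi_pos).ne'
  have h2 : (fun t : ℝ => hat a r φ c g t / dBE φ φq c t) =ᵐ[volume] ((Real.sqrt Real.pi : ℂ) • T (hg.toLp g) : Lp ℂ 2 (volume : Measure ℝ)) := by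
    filter_upwards [h1, Lp.coeFn_smul (Real.sqrt Real.pi : ℂ) (T (hg.toLp g))] with t h3 h4
    rw [h4, Pi.smul_apply, h3, ev_inner, hat_congr hg.coeFn_toLp, smul_eq_mul, mul_div_assoc, ← mul_assoc, ← ofReal_mul,
      mul_inv_cancel₀ hs0]
    simp
  have hm : MemLp (fun t : ℝ => hat a r φ c g t / dBE φ φq c t) 2 := (memLp_congr_ae h2).2 (Lp.memLp _)
  refine ⟨hm, ?_⟩
  rw [← norm_toLp_sq hm, ← norm_toLp_sq hg]
  have h3 : hm.toLp _ = (Real.sqrt Real.pi : ℂ) • T (hg.toLp g) := Lp.ext (hm.coeFn_toLp.trans h2)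
  rw [h3, norm_smul, hn, mul_pow, norm_real, Real.norm_eq_abs, sq_abs, Real.sq_sqrt Real.pi_pos.le]

theorem main_norm (hyp : SLHyp a b p q r s) (hφ : RealEntireSolFam a b p q r s φ φq) {c : ℝ} (hc : c ∈ Ioo a b)
    {g : ℝ → ℂ} (hg : MemLp g 2 (volume.restrict (Ioo a c))) :
    DBnormSq (dBE φ φq c) (hat a r φ c g) = ∫ x in Ioo a c, ‖g x‖ ^ 2 := by
  have h := (hat_L2 hyp hφ hc hg).2
  simp_rw [norm_div, div_pow] at h
  rw [DBnormSq, h, ← mul_assoc, one_div, inv_mul_cancel₀ Real.pi_ne_zero, one_mul]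

theorem hat_bt (hyp : SLHyp a b p q r s) (hφ : RealEntireSolFam a b p q r s φ φq) {c : ℝ} (hc : c ∈ Ioo a b)
    {g : ℝ → ℂ} (hg : MemLp g 2 (volume.restrict (Ioo a c))) :
    OfBoundedType (fun z => hat a r φ c g z / dBE φ φq c z) ∧ NonposMeanType (fun z => hat a r φ c g z / dBE φ φq c z) := by
  refine ⟨obt (div_diff hyp hφ hc (hat_diff hyp hφ hc hg)) (div_cont hyp hφ hc (hat_diff hyp hφ hc hg)) (div_SB hyp hφ hc hg)
    (hat_L2 hyp hφ hc hg).1, ?_⟩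
  refine npmt (A := Real.sqrt (∫ x in Ioo a c, ‖g x‖ ^ 2) * 2) (by positivity) fun y hy => ?_
  have hz : ((y : ℂ) * I) ∈ UHP := by simp only [UHP, mem_ofPred_eq]; simp; linarith
  refine (hat_bound hyp hφ hz hc hg).trans ?_
  refine mul_le_mul_of_nonneg_left ?_ (Real.sqrt_nonneg _)
  have h1 : 1 ≤ Real.sqrt y := Real.one_le_sqrt.2 hy
  have : 1 / Real.sqrt y ≤ 1 := by rw [div_le_one (by linarith)]; exact h1
  simp at this ⊢; linarith

theorem main_mem (hyp : SLHyp a b p q r s) (hφ : RealEntireSolFam a b p q r s φ φq) {c : ℝ} (hc : c ∈ Ioo a b)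
    {g : ℝ → ℂ} (hg : MemLp g 2 (volume.restrict (Ioo a c))) : MemDB (dBE φ φq c) (hat a r φ c g) := by
  have h := hat_bt hyp hφ hc hg
  have h' := hat_bt hyp hφ hc hg.star
  refine ⟨hat_diff hyp hφ hc hg, ?_, h.1, h.2, ?_, ?_⟩
  · have := sq_integrable (hat_L2 hyp hφ hc hg).1
    simpa only [norm_div, div_pow] using this
  · simp only [hat_conj hφ hc]; exact h'.1
  · simp only [hat_conj hφ hc]; exact h'.2

theorem main_ex (hyp : SLHyp a b p q r s) (hφ : RealEntireSolFam a b p q r s φ φq) {c : ℝ} (hc : c ∈ Ioo a b)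
    {F : ℂ → ℂ} (hF : MemDB (dBE φ φq c) F) : ∃ g, MemLp g 2 (volume.restrict (Ioo a c)) ∧ F = hat a r φ c g := by
  obtain ⟨hd, hi, b1, m1, b2, m2⟩ := hF
  have hs := sharp_diff hd
  have hm : MemLp (fun t : ℝ => F t / dBE φ φq c t) 2 := by
    rw [memLp_two_iff_integrable_sq_norm (div_real_cont hyp hφ hc hd).aestronglyMeasurable]
    simpa only [norm_div, div_pow] using hi
  have hm' : MemLp (fun t : ℝ => conj (F (conj (t : ℂ))) / dBE φ φq c t) 2 := by
    refine hm.mono (div_real_cont hyp hφ hc hs).aestronglyMeasurable (Eventually.of_forall fun t => ?_)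
    simp
  have s1 := SB_of_bt (div_diff hyp hφ hc hd) (div_cont hyp hφ hc hd) hm b1 m1
  have s2 := SB_of_bt (div_diff hyp hφ hc hs) (div_cont hyp hφ hc hs) hm' b2 m2
  obtain ⟨T, hT, hn⟩ := exists_T hyp hφ hc
  set g : Lp ℂ 2 (volume.restrict (Ioo a c)) := (((Real.sqrt Real.pi)⁻¹ : ℝ) : ℂ) • (ContinuousLinearMap.adjoint T) (hm.toLp _) with hg
  refine ⟨g, Lp.memLp g, entire_ext hd (hat_diff hyp hφ hc (Lp.memLp g)) fun z hz => ?_⟩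
  rw [← ev_inner hyp hφ hc, hg, inner_smul_right, ContinuousLinearMap.adjoint_inner_right, hT ⟨z, hz⟩, inner_smul_left, inner_toLp']
  have e2 : ∫ x : ℝ, (hm.toLp _ : ℝ → ℂ) x * conj (ker a r φ c z x / dBE φ φq c x) = Real.pi * F z := by
    rw [← repro hyp hφ hc hd s1 s2 hm hz]
    refine integral_congr_ae ?_
    filter_upwards [hm.coeFn_toLp] with x hx
    rw [hx]
  rw [e2, conj_ofReal, ← mul_assoc, ← mul_assoc, ← ofReal_mul, ← ofReal_mul]
  have : (Real.sqrt Real.pi)⁻¹ * (Real.sqrt Real.pi)⁻¹ * Real.pi = 1 := by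
    rw [← mul_inv, Real.mul_self_sqrt Real.pi_pos.le, inv_mul_cancel₀ Real.pi_ne_zero]
  rw [this]; simp

end DBC

namespace DBC
variable {a b : ℝ} {p q r s : ℝ → ℝ} {φ φq : ℂ → ℝ → ℂ}

theorem zext_memLp {c₁ c₂ : ℝ} {g : ℝ → ℂ} (hg : MemLp g 2 (volume.restrict (Ioo a c₁))) :
    MemLp ((Ioo a c₁).indicator g) 2 (volume.restrict (Ioo a c₂)) :=
  ((memLp_indicator_iff_restrict measurableSet_Ioo).2 hg).restrict _

theorem zext_hat {c₁ c₂ : ℝ} (h : c₁ ≤ c₂) (g : ℝ → ℂ) : hat a r φ c₂ ((Ioo a c₁).indicator g) = hat a r φ c₁ g := by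
  funext z
  rw [hat, hat]
  have : ∀ x, psi r φ z x * (Ioo a c₁).indicator g x = (Ioo a c₁).indicator (fun x => psi r φ z x * g x) x := by
    intro x; by_cases hx : x ∈ Ioo a c₁ <;> simp [hx]
  simp_rw [this]
  rw [setIntegral_indicator measurableSet_Ioo, inter_eq_right.2 (Ioo_subset_Ioo_right h)]

theorem zext_norm {c₁ c₂ : ℝ} (h : c₁ ≤ c₂) (g : ℝ → ℂ) :
    ∫ x in Ioo a c₂, ‖(Ioo a c₁).indicator g x‖ ^ 2 = ∫ x in Ioo a c₁, ‖g x‖ ^ 2 := by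
  have : ∀ x, ‖(Ioo a c₁).indicator g x‖ ^ 2 = (Ioo a c₁).indicator (fun x => ‖g x‖ ^ 2) x := by
    intro x; by_cases hx : x ∈ Ioo a c₁ <;> simp [hx]
  simp_rw [this]
  rw [setIntegral_indicator measurableSet_Ioo, inter_eq_right.2 (Ioo_subset_Ioo_right h)]

theorem hat_sub (hyp : SLHyp a b p q r s) (hφ : RealEntireSolFam a b p q r s φ φq) {c : ℝ} (hc : c ∈ Ioo a b)
    {f g : ℝ → ℂ} (hf : MemLp f 2 (volume.restrict (Ioo a c))) (hg : MemLp g 2 (volume.restrict (Ioo a c))) (z : ℂ) :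
    hat a r φ c (fun x => f x - g x) z = hat a r φ c f z - hat a r φ c g z := by
  have h1 : Integrable (fun x => psi r φ z x * f x) (volume.restrict (Ioo a c)) := (psi_memLp hyp hφ z hc).integrable_mul hf
  have h2 : Integrable (fun x => psi r φ z x * g x) (volume.restrict (Ioo a c)) := (psi_memLp hyp hφ z hc).integrable_mul hg
  rw [hat, hat, hat, ← integral_sub h1 h2]
  refine integral_congr_ae (Eventually.of_forall fun x => ?_)
  beta_reduce; ring

theorem hat_inj' (hyp : SLHyp a b p q r s) (hφ : RealEntireSolFam a b p q r s φ φq) {c : ℝ} (hc : c ∈ Ioo a b)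
    {f g : ℝ → ℂ} (hf : MemLp f 2 (volume.restrict (Ioo a c))) (hg : MemLp g 2 (volume.restrict (Ioo a c)))
    (h : hat a r φ c f = hat a r φ c g) : f =ᵐ[volume.restrict (Ioo a c)] g := by
  have := hat_inj hyp hφ hc (hf.sub hg) (fun z => (hat_sub hyp hφ hc hf hg z).trans (by rw [h, sub_self]))
  filter_upwards [this] with x hx
  exact sub_eq_zero.1 hx

theorem chain_sub (hyp : SLHyp a b p q r s) (hφ : RealEntireSolFam a b p q r s φ φq) {c₁ c₂ : ℝ} (h1 : c₁ ∈ Ioo a b)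
    (h2 : c₂ ∈ Ioo a b) (h : c₁ ≤ c₂) {F : ℂ → ℂ} (hF : MemDB (dBE φ φq c₁) F) :
    MemDB (dBE φ φq c₂) F ∧ DBnormSq (dBE φ φq c₁) F = DBnormSq (dBE φ φq c₂) F := by
  obtain ⟨g, hg, rfl⟩ := main_ex hyp hφ h1 hF
  have hz := zext_memLp (c₂ := c₂) hg
  have m := main_mem hyp hφ h2 hz
  have n := main_norm hyp hφ h2 hz
  rw [zext_hat h] at m n
  refine ⟨m, ?_⟩
  rw [n, main_norm hyp hφ h1 hg, zext_norm h]

theorem chain_ne (hyp : SLHyp a b p q r s) (hφ : RealEntireSolFam a b p q r s φ φq) {c₁ c₂ : ℝ} (h1 : c₁ ∈ Ioo a b)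
    (h2 : c₂ ∈ Ioo a b) (h : c₁ < c₂) : ∃ F, MemDB (dBE φ φq c₂) F ∧ ¬ MemDB (dBE φ φq c₁) F := by
  have hm : MemLp ((Ioo c₁ c₂).indicator fun _ => (1 : ℂ)) 2 (volume.restrict (Ioo a c₂)) :=
    (memLp_indicator_const 2 measurableSet_Ioo 1 (Or.inr (by simp))).restrict _
  refine ⟨_, main_mem hyp hφ h2 hm, fun hF => ?_⟩
  obtain ⟨g, hg, he⟩ := main_ex hyp hφ h1 hF
  rw [← zext_hat h.le] at he
  have h3 := hat_inj' hyp hφ h2 hm (zext_memLp hg) he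
  have h4 : ∀ᵐ x ∂(volume.restrict (Ioo c₁ c₂)), False := by
    have h5 := ae_mono (Measure.restrict_mono (Ioo_subset_Ioo_left h1.1.le : Ioo c₁ c₂ ⊆ Ioo a c₂) le_rfl) h3
    filter_upwards [h5, ae_restrict_mem measurableSet_Ioo] with x hx hxm
    have hn : x ∉ Ioo a c₁ := fun hh => (hh.2.trans hxm.1).false
    rw [indicator_of_mem hxm, indicator_of_notMem hn] at hx
    exact one_ne_zero hx
  rw [eventually_false_iff_eq_bot, ae_eq_bot, Measure.restrict_eq_zero, Real.volume_Ioo] at h4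
  simp at h4
  linarith

theorem chain_inter (hyp : SLHyp a b p q r s) (hφ : RealEntireSolFam a b p q r s φ φq) {c : ℝ} (hc : c ∈ Ioo a b)
    {F : ℂ → ℂ} (hF : ∀ x ∈ Ioo c b, MemDB (dBE φ φq x) F) : MemDB (dBE φ φq c) F := by
  obtain ⟨u, -, hu, hlim⟩ := exists_seq_strictAnti_tendsto' hc.2
  set d := u 0 with hd
  have hdb : d ∈ Ioo a b := ⟨hc.1.trans (hu 0).1, (hu 0).2⟩
  obtain ⟨g, hg, he⟩ := main_ex hyp hφ hdb (hF d (hu 0))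
  have key : ∀ n, ∀ᵐ x ∂(volume.restrict (Ioo a d)), u n ≤ d → x ∉ Ioo a (u n) → g x = 0 := by
    intro n
    by_cases hn : u n ≤ d
    · have hub : u n ∈ Ioo a b := ⟨hc.1.trans (hu n).1, (hu n).2⟩
      obtain ⟨g', hg', he'⟩ := main_ex hyp hφ hub (hF _ (hu n))
      rw [he, ← zext_hat hn] at he'
      filter_upwards [hat_inj' hyp hφ hdb hg (zext_memLp hg') he'] with x hx _ hx'
      rw [hx, indicator_of_notMem hx']
    · exact Eventually.of_forall fun x h => absurd h hn
  have h0 : g =ᵐ[volume.restrict (Ioo a d)] (Ioo a c).indicator g := by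
    have hne : ∀ᵐ x ∂(volume.restrict (Ioo a d)), x ≠ c :=
      ae_restrict_of_ae (by simp [ae_iff])
    filter_upwards [ae_all_iff.2 key, ae_restrict_mem measurableSet_Ioo, hne] with x hx hxm hxc
    by_cases hxx : x ∈ Ioo a c
    · rw [indicator_of_mem hxx]
    · rw [indicator_of_notMem hxx]
      have hcx : c < x := by
        rcases lt_trichotomy x c with h | h | h
        · exact absurd ⟨hxm.1, h⟩ hxx
        · exact absurd h hxc
        · exact h
      obtain ⟨n, hn⟩ := ((tendsto_order.1 hlim).2 x hcx).exists
      exact hx n (hn.le.trans hxm.2.le) fun h => (h.2.trans hn).false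
  have hle : c ≤ d := (hu 0).1.le
  have hgc : MemLp g 2 (volume.restrict (Ioo a c)) := hg.mono_measure (Measure.restrict_mono (Ioo_subset_Ioo_right hle) le_rfl)
  have : F = hat a r φ c g := by
    rw [he, ← zext_hat hle]
    funext z; exact hat_congr h0 z
  rw [this]
  exact main_mem hyp hφ hc hgc

theorem chain_dense (hyp : SLHyp a b p q r s) (hφ : RealEntireSolFam a b p q r s φ φq) {c : ℝ} (hc : c ∈ Ioo a b)
    {F : ℂ → ℂ} (hF : MemDB (dBE φ φq c) F) {ε : ℝ} (hε : 0 < ε) :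
    ∃ x ∈ Ioo a c, ∃ G : ℂ → ℂ, MemDB (dBE φ φq x) G ∧ DBnormSq (dBE φ φq c) (fun z => F z - G z) < ε := by
  obtain ⟨g, hg, rfl⟩ := main_ex hyp hφ hc hF
  obtain ⟨u, -, hu, hlim⟩ := exists_seq_strictMono_tendsto' hc.1
  have hres : ∀ n, MemLp g 2 (volume.restrict (Ioo a (u n))) := fun n =>
    hg.mono_measure (Measure.restrict_mono (Ioo_subset_Ioo_right (hu n).2.le) le_rfl)
  have ht : Tendsto (fun n => ∫ x in Ioo a c, ‖g x - (Ioo a (u n)).indicator g x‖ ^ 2) atTop (𝓝 (∫ x in Ioo a c, (0 : ℝ))) := by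
    refine tendsto_integral_of_dominated_convergence (fun x => ‖g x‖ ^ 2) (fun n => ?_) (sq_integrable hg) (fun n => ?_) ?_
    · exact (hg.1.sub (zext_memLp (hres n)).1).norm.pow 2
    · refine Eventually.of_forall fun x => ?_
      by_cases hx : x ∈ Ioo a (u n) <;> simp [hx]
    · filter_upwards [ae_restrict_mem measurableSet_Ioo] with x hx
      refine tendsto_const_nhds.congr' ?_
      filter_upwards [(tendsto_order.1 hlim).1 x hx.2] with n hn
      rw [indicator_of_mem (show x ∈ Ioo a (u n) from ⟨hx.1, hn⟩)]
      simp
  rw [integral_zero] at ht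
  obtain ⟨n, hn⟩ := ((tendsto_order.1 ht).2 ε hε).exists
  have hub : u n ∈ Ioo a b := ⟨(hu n).1, (hu n).2.trans hc.2⟩
  refine ⟨u n, hu n, hat a r φ (u n) g, main_mem hyp hφ hub (hres n), ?_⟩
  have e : (fun z => hat a r φ c g z - hat a r φ (u n) g z) = hat a r φ c (fun x => g x - (Ioo a (u n)).indicator g x) := by
    funext z
    rw [hat_sub hyp hφ hc hg (zext_memLp (hres n)), zext_hat (hu n).2.le]
  rw [e]
  exact (main_norm hyp hφ hc (hg.sub (zext_memLp (hres n)))).trans_lt hn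

end DBC

/-- The de Branges spaces `𝔅(c)` form a strictly increasing chain of isometrically
embedded subspaces which is continuous: `closure (⋃_{x<c} 𝔅(x)) = 𝔅(c) = ⋂_{x>c} 𝔅(x)`. -/
theorem deBranges_chain {a b : ℝ} {p q r s : ℝ → ℝ}
    (hyp : SLHyp a b p q r s) {φ φq : ℂ → ℝ → ℂ}
    (hφ : RealEntireSolFam a b p q r s φ φq) :
    (∀ c₁ c₂ : ℝ, c₁ ∈ Set.Ioo a b → c₂ ∈ Set.Ioo a b → c₁ < c₂ →
      ({F : ℂ → ℂ | MemDB (dBE φ φq c₁) F} ⊆ {F : ℂ → ℂ | MemDB (dBE φ φq c₂) F}) ∧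
      (∀ F : ℂ → ℂ, MemDB (dBE φ φq c₁) F →
        DBnormSq (dBE φ φq c₁) F = DBnormSq (dBE φ φq c₂) F) ∧
      {F : ℂ → ℂ | MemDB (dBE φ φq c₁) F} ≠ {F : ℂ → ℂ | MemDB (dBE φ φq c₂) F}) ∧
    (∀ c ∈ Set.Ioo a b,
      {F : ℂ → ℂ | MemDB (dBE φ φq c) F} =
        ⋂ x ∈ Set.Ioo c b, {F : ℂ → ℂ | MemDB (dBE φ φq x) F}) ∧
    ∀ c ∈ Set.Ioo a b, ∀ F : ℂ → ℂ, MemDB (dBE φ φq c) F → ∀ ε : ℝ, 0 < ε →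
      ∃ x ∈ Set.Ioo a c, ∃ G : ℂ → ℂ, MemDB (dBE φ φq x) G ∧
        DBnormSq (dBE φ φq c) (fun z => F z - G z) < ε := by
  exact ⟨fun c₁ c₂ h1 h2 h => ⟨fun F hF => (DBC.chain_sub hyp hφ h1 h2 h.le hF).1,
      fun F hF => (DBC.chain_sub hyp hφ h1 h2 h.le hF).2, fun heq => by
        obtain ⟨F, hF, hn⟩ := DBC.chain_ne hyp hφ h1 h2 h
        have hm : F ∈ {F : ℂ → ℂ | MemDB (dBE φ φq c₂) F} := hF
        rw [← heq] at hm
        exact hn hm⟩,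
    fun c hc => by
      apply Set.Subset.antisymm
      · intro F hF
        exact Set.mem_iInter₂.2 fun x hx =>
          (DBC.chain_sub hyp hφ hc ⟨hc.1.trans hx.1, hx.2⟩ hx.1.le hF).1
      · intro F hF
        exact DBC.chain_inter hyp hφ hc fun x hx => Set.mem_iInter₂.1 hF x hx,
    fun c hc F hF ε hε => DBC.chain_dense hyp hφ hc hF hε⟩
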